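/- arXiv:1605.08034 — 6 statements merged into one kernel-verified Lean document; each statement's English description precedes it below -/
import Mathlib

section
/- Let d ≥ 1 and let A_1, …, A_N be complex Hermitian d×d matrices. Then (A_1, …, A_N) has the phase retrieval property on ℂ^d if and only if every nonzero complex Hermitian d×d matrix Q with rank(Q) ≤ 2 and Tr(A_jQ) = 0 for all 1 ≤ j ≤ N has exactly two nonzero eigenvalues and these have the same sign (equivalently, rank(Q) = 2 and Q is positive semidefinite or negative semidefinite). -/
open Matrix
open scoped ComplexOrder

/-- A tuple of complex Hermitian `d×d` matrices has the phase retrieval property on `ℂ^d`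
if equality of all quadratic measurements implies equality up to a unimodular constant. -/
def PhaseRetrievableC {d N : ℕ} (A : Fin N → Matrix (Fin d) (Fin d) ℂ) : Prop :=
  ∀ x y : Fin d → ℂ,
    (∀ j, star x ⬝ᵥ (A j) *ᵥ x = star y ⬝ᵥ (A j) *ᵥ y) →
      ∃ b : ℂ, ‖b‖ = 1 ∧ x = b • y

namespace Matrix

variable {n : Type*} [Fintype n]

theorem rank_vecMulVec_sub_vecMulVec_le {m R : Type*} [CommRing R] [Nontrivial R]
    (x y : m → R) (a b : n → R) : (vecMulVec x a - vecMulVec y b).rank ≤ 2 := by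
  have h : vecMulVec x a - vecMulVec y b =
      (of fun i => ![x i, y i] : Matrix m (Fin 2) R) * (of ![a, -b] : Matrix (Fin 2) n R) := by
    ext i j
    simp [mul_apply, Fin.sum_univ_two, vecMulVec_apply, sub_eq_add_neg]
  rw [h]
  exact (rank_mul_le_left _ _).trans ((rank_le_card_width _).trans_eq (by simp))

theorem rank_neg {m R : Type*} [CommRing R] (A : Matrix m n R) : (-A).rank = A.rank := by
  have h : (-A).mulVecLin = -A.mulVecLin := by
    ext
    simp
  rw [rank, rank, h, LinearMap.range_neg]

theorem trace_mul_vecMulVec_star (A : Matrix n n ℂ) (x : n → ℂ) :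
    trace (A * vecMulVec x (star x)) = star x ⬝ᵥ A *ᵥ x := by
  rw [mul_vecMulVec, trace_vecMulVec, dotProduct_comm]

omit [Fintype n] in
theorem exists_norm_one_smul_of_vecMulVec_star_eq {x y : n → ℂ}
    (h : vecMulVec x (star x) = vecMulVec y (star y)) : ∃ b : ℂ, ‖b‖ = 1 ∧ x = b • y := by
  have entry (i k) : x i * star (x k) = y i * star (y k) := congrFun (congrFun h i) k
  by_cases hy : y = 0
  · refine ⟨1, norm_one, ?_⟩
    ext i
    have := entry i i
    simpa [hy] using this
  · obtain ⟨k, hk⟩ := Function.ne_iff.mp hy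
    have hn : ‖x k‖ = ‖y k‖ := by
      have := congrArg norm (entry k k)
      simp only [norm_mul, norm_star] at this
      nlinarith [norm_nonneg (x k), norm_nonneg (y k)]
    have hyk : ‖y k‖ ≠ 0 := norm_ne_zero_iff.mpr hk
    have hxk : star (x k) ≠ 0 := by
      rw [← norm_ne_zero_iff, norm_star, hn]
      exact hyk
    refine ⟨star (y k) / star (x k), ?_, ?_⟩
    · rw [norm_div, norm_star, norm_star, hn, div_self hyk]
    · ext i
      have := entry i k
      simp only [Pi.smul_apply, smul_eq_mul]
      field_simp
      rw [this, mul_comm]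

theorem rank_le_one_of_posSemidef_vecMulVec_sub {x y : n → ℂ}
    (h : (vecMulVec x (star x) - vecMulVec y (star y)).PosSemidef) :
    (vecMulVec x (star x) - vecMulVec y (star y)).rank ≤ 1 := by
  have key (v : n → ℂ) (hv : star v ⬝ᵥ x = 0) : star v ⬝ᵥ y = 0 := by
    have h1 := h.dotProduct_mulVec_nonneg v
    have h2 : star y ⬝ᵥ v = star (star v ⬝ᵥ y) := star_dotProduct y v
    rw [sub_mulVec, vecMulVec_mulVec, vecMulVec_mulVec, dotProduct_sub, dotProduct_smul,
      dotProduct_smul, hv, h2, smul_zero, zero_sub] at h1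
    have h3 : star v ⬝ᵥ y * star (star v ⬝ᵥ y) = 0 :=
      le_antisymm (by simpa using h1) (mul_star_self_nonneg _)
    simpa using h3
  obtain ⟨c, hc⟩ : ∃ c : ℂ, star (y - c • x) ⬝ᵥ x = 0 := by
    refine ⟨star x ⬝ᵥ y / star x ⬝ᵥ x, ?_⟩
    by_cases hx : x = 0
    · simp [hx]
    · have hxx : star x ⬝ᵥ x ≠ 0 := by rwa [Ne, dotProduct_star_self_eq_zero]
      rw [star_sub, star_smul, sub_dotProduct, smul_dotProduct, star_div₀,
        ← star_dotProduct y x, ← star_dotProduct x x, smul_eq_mul, div_mul_cancel₀ _ hxx, sub_self]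
  have hv : y - c • x = 0 := by
    rw [← dotProduct_star_self_eq_zero, dotProduct_sub, dotProduct_smul, hc, key _ hc, smul_zero,
      sub_zero]
  rw [sub_eq_zero.mp hv, star_smul, smul_vecMulVec, vecMulVec_smul, ← smul_vecMulVec,
    ← smul_vecMulVec, ← sub_vecMulVec]
  exact rank_vecMulVec_le _ _

theorem IsHermitian.exists_eq_sum_vecMulVec_sub_sum [DecidableEq n] {Q : Matrix n n ℂ}
    (hQ : Q.IsHermitian) :
    ∃ w : n → n → ℂ, Q =
      ∑ i with 0 < hQ.eigenvalues i, vecMulVec (w i) (star (w i)) -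
        ∑ i with hQ.eigenvalues i < 0, vecMulVec (w i) (star (w i)) := by
  refine ⟨fun i => (Real.sqrt |hQ.eigenvalues i| : ℂ) • ⇑(hQ.eigenvectorBasis i), ?_⟩
  have hs (i : n) : (Real.sqrt |hQ.eigenvalues i| : ℂ) * Real.sqrt |hQ.eigenvalues i| =
      (|hQ.eigenvalues i| : ℝ) := by
    rw [← Complex.ofReal_mul, Real.mul_self_sqrt (abs_nonneg _)]
  conv_lhs => rw [hQ.spectral_theorem]
  rw [Finset.sum_filter, Finset.sum_filter, ← Finset.sum_sub_distrib]
  ext j k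
  rw [Unitary.conjStarAlgAut_apply, mul_apply, sum_apply]
  refine Finset.sum_congr rfl fun i _ => ?_
  rcases lt_trichotomy (hQ.eigenvalues i) 0 with hi | hi | hi
  · have := hs i
    rw [abs_of_neg hi] at this
    simp [hi, hi.not_gt, vecMulVec_apply, mul_diagonal, abs_of_neg hi]
    push_cast at this
    linear_combination (hQ.eigenvectorBasis i).ofLp j *
      starRingEnd ℂ ((hQ.eigenvectorBasis i).ofLp k) * this
  · simp [hi, mul_diagonal]
  · have := hs i
    rw [abs_of_pos hi] at this
    simp [hi, hi.not_gt, vecMulVec_apply, mul_diagonal, abs_of_pos hi]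
    linear_combination -(hQ.eigenvectorBasis i).ofLp j *
      starRingEnd ℂ ((hQ.eigenvectorBasis i).ofLp k) * this

omit [Fintype n] in
theorem exists_sum_vecMulVec_eq {ι : Type*} {s : Finset ι} (hs : s.card ≤ 1) (w : ι → n → ℂ) :
    ∃ x, ∑ i ∈ s, vecMulVec (w i) (star (w i)) = vecMulVec x (star x) := by
  rcases Nat.le_one_iff_eq_zero_or_eq_one.mp hs with h | h
  · exact ⟨0, by simp [Finset.card_eq_zero.mp h]⟩
  · obtain ⟨i, rfl⟩ := Finset.card_eq_one.mp h
    exact ⟨w i, Finset.sum_singleton _ _⟩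

theorem IsHermitian.eq_vecMulVec_sub_or_semidef {Q : Matrix n n ℂ} (hQ : Q.IsHermitian)
    (hr : Q.rank ≤ 2) :
    (∃ x y, Q = vecMulVec x (star x) - vecMulVec y (star y)) ∨
      Q.rank = 2 ∧ (Q.PosSemidef ∨ (-Q).PosSemidef) := by
  classical
  obtain ⟨w, hw⟩ := hQ.exists_eq_sum_vecMulVec_sub_sum
  set p : Finset n := {i | 0 < hQ.eigenvalues i} with hp
  set m : Finset n := {i | hQ.eigenvalues i < 0} with hm
  have hrank : Q.rank = p.card + m.card := by
    rw [hQ.rank_eq_card_non_zero_eigs, Fintype.card_subtype, ← Finset.card_union_of_disjoint]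
    · congr 1
      ext i
      simp [hp, hm, lt_or_lt_iff_ne, ne_comm]
    · rw [Finset.disjoint_left]
      intro i hi hi'
      simp only [hp, hm, Finset.mem_filter_univ] at hi hi'
      exact hi.not_gt hi'
  have psd (s : Finset n) : (∑ i ∈ s, vecMulVec (w i) (star (w i))).PosSemidef :=
    posSemidef_sum s fun i _ => posSemidef_vecMulVec_self_star _
  by_cases hp1 : p.card ≤ 1
  · by_cases hm1 : m.card ≤ 1
    · obtain ⟨x, hx⟩ := exists_sum_vecMulVec_eq hp1 w
      obtain ⟨y, hy⟩ := exists_sum_vecMulVec_eq hm1 w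
      exact .inl ⟨x, y, by rw [← hx, ← hy]; exact hw⟩
    · have h0 : p = ∅ := Finset.card_eq_zero.mp (by omega)
      refine .inr ⟨by omega, .inr ?_⟩
      rw [hw, h0]
      simpa using psd m
  · have h0 : m = ∅ := Finset.card_eq_zero.mp (by omega)
    refine .inr ⟨by omega, .inl ?_⟩
    rw [hw, h0]
    simpa using psd p

end Matrix

theorem stmt_5 (d N : ℕ) (hd : 1 ≤ d) (A : Fin N → Matrix (Fin d) (Fin d) ℂ)
    (hA : ∀ j, (A j).IsHermitian) :
    PhaseRetrievableC A ↔
      ∀ Q : Matrix (Fin d) (Fin d) ℂ, Q ≠ 0 → Q.IsHermitian → Q.rank ≤ 2 →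
        (∀ j, Matrix.trace (A j * Q) = 0) →
        Q.rank = 2 ∧ (Q.PosSemidef ∨ (-Q).PosSemidef) := by
  have htr (x y : Fin d → ℂ) (j : Fin N) :
      trace (A j * (vecMulVec x (star x) - vecMulVec y (star y))) = 0 ↔
        star x ⬝ᵥ (A j) *ᵥ x = star y ⬝ᵥ (A j) *ᵥ y := by
    rw [mul_sub, trace_sub, trace_mul_vecMulVec_star, trace_mul_vecMulVec_star, sub_eq_zero]
  constructor
  · intro h Q hQ0 hQ hr ht
    refine (hQ.eq_vecMulVec_sub_or_semidef hr).resolve_left ?_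
    rintro ⟨x, y, rfl⟩
    obtain ⟨b, hb, rfl⟩ := h x y fun j => (htr x y j).mp (ht j)
    apply hQ0
    have hbb : b * star b = 1 := by
      rw [Complex.star_def, Complex.mul_conj, Complex.normSq_eq_norm_sq, hb]
      simp
    rw [sub_eq_zero, star_smul, smul_vecMulVec, vecMulVec_smul, smul_smul, hbb, one_smul]
  · intro h x y hxy
    refine exists_norm_one_smul_of_vecMulVec_star_eq (sub_eq_zero.mp ?_)
    by_contra hQ0
    obtain ⟨hr, hpos | hneg⟩ := h _ hQ0
      ((posSemidef_vecMulVec_self_star x).isHermitian.sub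
        (posSemidef_vecMulVec_self_star y).isHermitian)
      (rank_vecMulVec_sub_vecMulVec_le _ _ _ _) fun j => (htr x y j).mpr (hxy j)
    · have := rank_le_one_of_posSemidef_vecMulVec_sub hpos
      omega
    · rw [neg_sub] at hneg
      have := rank_le_one_of_posSemidef_vecMulVec_sub hneg
      rw [← neg_sub, rank_neg] at hr
      omega
end

section
/- Let d ≥ 1, 1 ≤ r ≤ d, and N < 2rd − r². Then for any complex d×d matrices A_1, …, A_N there exists a nonzero complex d×d matrix Q with rank(Q) ≤ r such that Tr(A_jQ) = 0 for all 1 ≤ j ≤ N. Consequently, N ≥ 2rd − r² measurements are necessary to recover every rank ≤ r matrix Q ∈ ℂ^{d×d} from the linear observations (Tr(A_1Q), …, Tr(A_NQ)). -/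
open Matrix

section Minors

variable {m n K : Type*} [Fintype m] [Fintype n] [Field K]

/-- A matrix has as many linearly independent rows as its rank. -/
theorem Matrix.exists_linearIndependent_row_submatrix (A : Matrix m n K) {k : ℕ}
    (hk : A.rank = k) : ∃ g : Fin k → m, LinearIndependent K (A.submatrix g id).row := by
  rw [Matrix.rank_eq_finrank_span_row] at hk
  subst hk
  obtain ⟨f, hf, -, hind⟩ := Submodule.exists_fun_fin_finrank_span_eq K (Set.range A.row)
  choose g hg using hf
  have hrow : (A.submatrix g id).row = f := funext hg
  exact ⟨g, hrow ▸ hind⟩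

/-- A matrix has a nonvanishing minor of the size of its rank. -/
theorem Matrix.exists_submatrix_det_ne_zero (A : Matrix m n K) :
    ∃ (g : Fin A.rank → m) (h : Fin A.rank → n), (A.submatrix g h).det ≠ 0 := by
  obtain ⟨g, hg⟩ := A.exists_linearIndependent_row_submatrix rfl
  obtain ⟨h, hh⟩ := (A.submatrix g id)ᵀ.exists_linearIndependent_row_submatrix (k := A.rank)
    (by rw [Matrix.rank_transpose, hg.rank_matrix, Fintype.card_fin])
  refine ⟨g, h, ?_⟩
  have hu := Matrix.linearIndependent_rows_iff_isUnit.mp hh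
  rw [← Matrix.det_transpose]
  exact ((Matrix.isUnit_iff_isUnit_det _).mp hu).ne_zero

end Minors

theorem Matrix.det_mul_eq_zero_of_card_lt {k l R : Type*} [Fintype k] [DecidableEq k] [Fintype l]
    [CommRing R] [IsDomain R] (hkl : Fintype.card l < Fintype.card k)
    (B : Matrix k l R) (C : Matrix l k R) : (B * C).det = 0 := by
  by_contra h
  have h1 := Matrix.rank_of_det_ne_zero h
  have h2 := (Matrix.rank_mul_le_left B C).trans B.rank_le_card_width
  lia

theorem AlgHom.map_trace_map_mul {n K S B : Type*} [Fintype n] [CommSemiring K] [CommSemiring S]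
    [Algebra K S] [CommSemiring B] [Algebra K B] (χ : S →ₐ[K] B) (A : Matrix n n K)
    (z : Matrix n n S) :
    χ (trace (A.map (algebraMap K S) * z)) = trace (A.map (algebraMap K B) * z.map χ) := by
  simp [trace, Matrix.mul_apply]

/-- Fewer equations than the height of the origin of an affine cone have a common zero
other than the origin. -/
theorem MvPolynomial.exists_algHom_ne_zero_of_lt_height {ι K S A : Type*} [Finite ι] [Field K]
    [IsAlgClosed K] [CommRing S] [Algebra K S] [CommRing A] [IsDomain A] [Algebra K A]
    (θ : MvPolynomial ι K →ₐ[K] S) (hθ : Function.Surjective θ) (π : S →ₐ[K] A)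
    (hπ : ∀ i, π (θ (X i)) = 0) {N : ℕ} (f : Fin N → S) (hf : ∀ j, π (f j) = 0)
    (hN : (N : ℕ∞) < (RingHom.ker π).height) :
    ∃ ψ : S →ₐ[K] K, (∀ j, ψ (f j) = 0) ∧ ∃ i, ψ (θ (X i)) ≠ 0 := by
  have hft : Algebra.FiniteType K S := Algebra.FiniteType.of_surjective θ hθ
  have : IsNoetherianRing S := isNoetherianRing_of_surjective _ _ θ.toRingHom hθ
  have : IsJacobsonRing S := isJacobsonRing_of_finiteType (A := K)
  have hprime : (RingHom.ker π).IsPrime := RingHom.ker_isPrime π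
  obtain ⟨q, hq, hqπ⟩ := Ideal.exists_minimalPrimes_le
    (I := Ideal.span (Set.range f)) (J := RingHom.ker π)
    (Ideal.span_le.mpr (by rintro _ ⟨j, rfl⟩; exact hf j))
  have hqprime : q.IsPrime := hq.1.1
  have hfq : ∀ j, f j ∈ q := fun j => hq.1.2 (Ideal.subset_span ⟨j, rfl⟩)
  have hcard : q.height ≤ N := by
    refine (Ideal.height_le_card_of_mem_minimalPrimes_span (Set.finite_range f) hq).trans ?_
    have := Set.ncard_image_le (f := f) (Set.finite_univ)
    rw [Set.image_univ, Set.ncard_univ, Nat.card_fin] at this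
    exact_mod_cast this
  obtain ⟨i, hi⟩ : ∃ i, θ (X i) ∉ q := by
    by_contra! hall
    have hle : RingHom.ker π ≤ q := by
      intro s hs
      obtain ⟨g, rfl⟩ := hθ s
      have h1 : π.comp θ = (Algebra.ofId K A).comp (aeval 0) :=
        MvPolynomial.algHom_ext (by simpa using hπ)
      have h2 : (Ideal.Quotient.mkₐ K q).comp θ = (Algebra.ofId K (S ⧸ q)).comp (aeval 0) :=
        MvPolynomial.algHom_ext fun i => by
          simpa using Ideal.Quotient.eq_zero_iff_mem.mpr (hall i)
      have h3 : algebraMap K A (aeval (0 : ι → K) g) = 0 := by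
        have := DFunLike.congr_fun h1 g
        exact this.symm.trans hs
      have h4 : aeval (0 : ι → K) g = 0 :=
        (map_eq_zero_iff _ (algebraMap K A).injective).mp h3
      have h5 := DFunLike.congr_fun h2 g
      rw [AlgHom.comp_apply, AlgHom.comp_apply, h4, map_zero] at h5
      exact Ideal.Quotient.eq_zero_iff_mem.mp h5
    rw [le_antisymm hqπ hle] at hcard
    exact absurd hcard (not_le.mpr hN)
  obtain ⟨M, hM, hqM, hiM⟩ : ∃ M : Ideal S, M.IsMaximal ∧ q ≤ M ∧ θ (X i) ∉ M := by
    by_contra! hall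
    apply hi
    rw [← IsJacobsonRing.out inferInstance hqprime.isRadical, Ideal.jacobson, Ideal.mem_sInf]
    rintro M ⟨hqM, hM⟩
    exact hall M hM hqM
  let := Ideal.Quotient.field M
  have : Module.Finite K (S ⧸ M) := finite_of_finite_type_of_isJacobsonRing K (S ⧸ M)
  have hbij : Function.Bijective (Algebra.ofId K (S ⧸ M)) :=
    IsAlgClosed.algebraMap_bijective_of_isIntegral
  let e := AlgEquiv.ofBijective _ hbij
  refine ⟨(e.symm : (S ⧸ M) →ₐ[K] K).comp (Ideal.Quotient.mkₐ K M), fun j => ?_, i, ?_⟩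
  · have : Ideal.Quotient.mkₐ K M (f j) = 0 := Ideal.Quotient.eq_zero_iff_mem.mpr (hqM (hfq j))
    rw [AlgHom.comp_apply, this, map_zero]
  · rw [AlgHom.comp_apply]
    intro h
    have h' : e.symm (Ideal.Quotient.mkₐ K M (θ (X i))) = 0 := h
    rw [EmbeddingLike.map_eq_zero_iff] at h'
    exact hiM (Ideal.Quotient.eq_zero_iff_mem.mp h')

section Restrict

variable {σ K : Type*} [DecidableEq σ]

/-- The endomorphism of the polynomial ring setting the variables outside `T` to zero. -/
noncomputable def MvPolynomial.restrictVars [CommRing K] (T : Finset σ) :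
    MvPolynomial σ K →ₐ[K] MvPolynomial σ K :=
  aeval fun a => if a ∈ T then X a else 0

theorem MvPolynomial.restrictVars_X [CommRing K] (T : Finset σ) (a : σ) :
    restrictVars T (X a : MvPolynomial σ K) = if a ∈ T then X a else 0 :=
  aeval_X _ _

theorem MvPolynomial.restrictVars_restrictVars [CommRing K] {T U : Finset σ} (h : T ⊆ U)
    (g : MvPolynomial σ K) : restrictVars T (restrictVars U g) = restrictVars T g := by
  have : (restrictVars T).comp (restrictVars U) = restrictVars (K := K) T := by
    refine MvPolynomial.algHom_ext fun a => ?_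
    simp only [AlgHom.comp_apply, restrictVars_X]
    split_ifs with h1 h2 h2
    · simp [restrictVars_X, h2]
    · simp [restrictVars_X, h2]
    · exact absurd (h h2) h1
    · simp
  exact DFunLike.congr_fun this g

/-- If every variable times a fixed polynomial `D` lies in a ring `S` of polynomials, then the
ideal of elements of `S` vanishing at the origin has height at least the number of variables,
provided that `D` does not vanish identically on the `p`-axis. -/
theorem MvPolynomial.card_le_height_ker_restrictVars_empty [Fintype σ] [Field K] {S : Type*}
    [CommRing S] [Algebra K S] (φ : S →ₐ[K] MvPolynomial σ K) (p : σ) (D : MvPolynomial σ K)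
    (hD : restrictVars {p} D ≠ 0) (l : σ → S) (hl : ∀ a, φ (l a) = D * X a) :
    (Fintype.card σ : ℕ∞) ≤ (RingHom.ker ((restrictVars ∅).comp φ)).height := by
  have hprime (T : Finset σ) : (RingHom.ker ((restrictVars T).comp φ)).IsPrime :=
    RingHom.ker_isPrime _
  have hlt (T : Finset σ) (a : σ) (ha : a ∉ T) (hp : p ∈ insert a T) :
      RingHom.ker ((restrictVars (insert a T)).comp φ) <
        RingHom.ker ((restrictVars T).comp φ) := by
    refine lt_of_le_of_ne (fun s hs => ?_) fun heq => ?_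
    · rw [RingHom.mem_ker, AlgHom.comp_apply] at hs ⊢
      rw [← restrictVars_restrictVars (Finset.subset_insert a T), hs, map_zero]
    · have h1 : l a ∈ RingHom.ker ((restrictVars T).comp φ) := by
        simp [RingHom.mem_ker, hl, restrictVars_X, ha]
      rw [← heq, RingHom.mem_ker, AlgHom.comp_apply, hl, map_mul, restrictVars_X,
        if_pos (Finset.mem_insert_self a T), mul_eq_zero] at h1
      rcases h1 with h1 | h1
      · apply hD
        rw [← restrictVars_restrictVars (Finset.singleton_subset_iff.mpr hp), h1, map_zero]
      · exact X_ne_zero a h1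
  have hchain (U : Finset σ) (hU : p ∉ U) :
      (RingHom.ker ((restrictVars (insert p U)).comp φ)).height + U.card ≤
        (RingHom.ker ((restrictVars {p}).comp φ)).height := by
    induction U using Finset.induction_on with
    | empty => simp
    | insert a U ha ih =>
      rw [Finset.mem_insert, not_or] at hU
      refine le_trans ?_ (ih hU.2)
      rw [Finset.card_insert_of_notMem ha, Nat.cast_add, Nat.cast_one, add_comm (U.card : ℕ∞),
        ← add_assoc, Finset.insert_comm]
      gcongr
      refine Ideal.height_add_one_le_of_lt_of_isPrime (hlt _ a ?_ ?_)
      · simp [ha, Ne.symm hU.1]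
      · simp
  have h1 := hchain (Finset.univ.erase p) (by simp)
  have h2 := Ideal.height_add_one_le_of_lt_of_isPrime (hlt ∅ p (by simp) (by simp))
  have h3 : Fintype.card σ = (Finset.univ.erase p).card + 1 := by
    rw [Finset.card_erase_add_one (Finset.mem_univ p), Finset.card_univ]
  rw [h3, Nat.cast_add, Nat.cast_one]
  refine le_trans ?_ h2
  gcongr
  exact le_trans le_add_self h1

end Restrict

section Generic

variable {K : Type*} [Field K] {α β : Type*} [Fintype α] [DecidableEq α]

/-- The square matrix of variables, with the variable at `(p, p)` added to the other diagonal
entries. -/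
noncomputable def genericCorner (K : Type*) [Field K] {α : Type*} [DecidableEq α] (β : Type*)
    (p : α) : Matrix α α (MvPolynomial ((α × α) ⊕ (β × α) ⊕ (α × β)) K) :=
  .of fun i j => .X (.inl (i, j)) + if i = j ∧ i ≠ p then .X (.inl (p, p)) else 0

/-- The `β × α` matrix of variables. -/
noncomputable def genericLower (K : Type*) [Field K] (α β : Type*) :
    Matrix β α (MvPolynomial ((α × α) ⊕ (β × α) ⊕ (α × β)) K) :=
  .of fun i j => .X (.inr (.inl (i, j)))

/-- The `α × β` matrix of variables. -/
noncomputable def genericUpper (K : Type*) [Field K] (α β : Type*) :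
    Matrix α β (MvPolynomial ((α × α) ⊕ (β × α) ⊕ (α × β)) K) :=
  .of fun i j => .X (.inr (.inr (i, j)))

/-- A generic matrix of rank at most `Fintype.card α`, in block form. -/
noncomputable def genericLowRank (K : Type*) [Field K] {α : Type*} [Fintype α] [DecidableEq α]
    (β : Type*) (p : α) :
    Matrix (α ⊕ β) (α ⊕ β) (MvPolynomial ((α × α) ⊕ (β × α) ⊕ (α × β)) K) :=
  fromRows (genericCorner K β p) (genericLower K α β) *
    ((genericCorner K β p).adjugate * fromCols (genericCorner K β p) (genericUpper K α β))

theorem genericLowRank_eq_fromBlocks (p : α) :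
    genericLowRank K β p = fromBlocks
      ((genericCorner K β p).det • genericCorner K β p)
      ((genericCorner K β p).det • genericUpper K α β)
      ((genericCorner K β p).det • genericLower K α β)
      (genericLower K α β * ((genericCorner K β p).adjugate * genericUpper K α β)) := by
  rw [genericLowRank, mul_fromCols, fromRows_mul_fromCols, adjugate_mul, ← Matrix.mul_assoc,
    mul_adjugate]
  simp

open MvPolynomial in
theorem restrictVars_det_genericCorner_ne_zero [DecidableEq β] (p : α) :
    restrictVars {.inl (p, p)} (genericCorner K β p).det ≠ 0 := by
  have h : (restrictVars {.inl (p, p)}).mapMatrix (genericCorner K β p) =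
      (X (.inl (p, p)) : MvPolynomial ((α × α) ⊕ (β × α) ⊕ (α × β)) K) • 1 := by
    ext1 i j
    simp only [genericCorner, AlgHom.mapMatrix_apply, map_apply, of_apply, map_add,
      restrictVars_X, Matrix.smul_apply, one_apply, apply_ite (restrictVars _), map_zero,
      Finset.mem_singleton, Sum.inl.injEq, Prod.mk.injEq]
    by_cases hij : i = j
    · subst hij
      by_cases hip : i = p <;> simp [hip]
    · have : ¬ (i = p ∧ j = p) := fun h => hij (h.1.trans h.2.symm)
      simp [hij, this]
  rw [AlgHom.map_det, h, det_smul, det_one, mul_one]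
  exact pow_ne_zero _ (X_ne_zero _)

open MvPolynomial in
/-- Fewer than `(card α)² + 2 (card α) (card β)` linear forms on block matrices have a common zero
of rank at most `card α` other than `0`. -/
theorem Matrix.exists_ne_zero_rank_le_card_trace_mul_eq_zero [IsAlgClosed K] [Fintype β]
    [DecidableEq β] [Nonempty α] {N : ℕ}
    (hN : N < Fintype.card ((α × α) ⊕ (β × α) ⊕ (α × β)))
    (A : Fin N → Matrix (α ⊕ β) (α ⊕ β) K) :
    ∃ Q : Matrix (α ⊕ β) (α ⊕ β) K, Q ≠ 0 ∧ Q.rank ≤ Fintype.card α ∧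
      ∀ j, trace (A j * Q) = 0 := by
  obtain ⟨p⟩ := ‹Nonempty α›
  let Z := genericLowRank K β p
  let Θ : MvPolynomial ((α ⊕ β) × (α ⊕ β)) K →ₐ[K] _ := aeval fun x => Z x.1 x.2
  let φ := Θ.range.val
  let θ := Θ.rangeRestrict
  let z : Matrix (α ⊕ β) (α ⊕ β) Θ.range := .of fun i j => θ (X (i, j))
  have hz (i j) : φ (z i j) = Z i j := aeval_X _ _
  let l : (α × α) ⊕ (β × α) ⊕ (α × β) → Θ.range
    | .inl (i, j) => z (.inl i) (.inl j) -
        if i = j ∧ i ≠ p then z (.inl p) (.inl p) else 0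
    | .inr (.inl (i, j)) => z (.inr i) (.inl j)
    | .inr (.inr (i, j)) => z (.inl i) (.inr j)
  have hl (a) : φ (l a) = (genericCorner K β p).det * X a := by
    rcases a with ⟨i, j⟩ | ⟨i, j⟩ | ⟨i, j⟩
    · simp only [l, map_sub, apply_ite φ, map_zero, hz, Z, genericLowRank_eq_fromBlocks,
        fromBlocks_apply₁₁, smul_apply, smul_eq_mul]
      simp only [genericCorner, of_apply]
      split_ifs <;> simp_all [mul_add]
    · simp only [l, hz, Z, genericLowRank_eq_fromBlocks, fromBlocks_apply₂₁, smul_apply,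
        smul_eq_mul, genericLower, of_apply]
    · simp only [l, hz, Z, genericLowRank_eq_fromBlocks, fromBlocks_apply₁₂, smul_apply,
        smul_eq_mul, genericUpper, of_apply]
  have hheight := card_le_height_ker_restrictVars_empty φ _ _
    (restrictVars_det_genericCorner_ne_zero p) l hl
  let π := (restrictVars ∅).comp φ
  have hπ (i j) : π (z i j) = 0 := by
    have hC : (restrictVars ∅).mapMatrix (genericCorner K β p) = 0 := by
      ext1 i j
      simp [genericCorner, restrictVars_X, apply_ite (restrictVars _)]
    have hL : (genericLower K α β).map (restrictVars ∅) = 0 := by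
      ext1 i j
      simp [genericLower, restrictVars_X]
    have hR : (fromRows (genericCorner K β p) (genericLower K α β)).map (restrictVars ∅) = 0 := by
      ext1 i j
      rcases i with i | i
      · exact congr_fun₂ hC i j
      · exact congr_fun₂ hL i j
    have : Z.map (restrictVars ∅) = 0 := by
      simp only [Z, genericLowRank]
      rw [Matrix.map_mul, hR, Matrix.zero_mul]
    exact (congrArg (restrictVars ∅) (hz i j)).trans (congr_fun₂ this i j)
  let f (j : Fin N) : Θ.range := trace ((A j).map (algebraMap K Θ.range) * z)
  have hf (j) : π (f j) = 0 := by
    have : z.map π = 0 := by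
      ext1 i j
      exact hπ i j
    rw [AlgHom.map_trace_map_mul, this, Matrix.mul_zero, trace_zero]
  obtain ⟨ψ, hψf, ⟨i, i'⟩, hi⟩ := exists_algHom_ne_zero_of_lt_height θ Θ.rangeRestrict_surjective π
    (fun x => hπ x.1 x.2) f hf (lt_of_lt_of_le (by exact_mod_cast hN) hheight)
  refine ⟨z.map ψ, fun h => hi (congr_fun₂ h i i'), ?_, fun j => ?_⟩
  · by_contra! hlt
    obtain ⟨g, h, hdet⟩ := (z.map ψ).exists_submatrix_det_ne_zero
    have hZ : (Z.submatrix g h).det = 0 := by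
      simp only [Z, genericLowRank]
      rw [submatrix_mul _ _ g id h Function.bijective_id]
      exact det_mul_eq_zero_of_card_lt (by simpa using hlt) _ _
    have hz0 : (z.submatrix g h).det = 0 := by
      apply Subtype.val_injective
      change φ _ = φ 0
      rw [AlgHom.map_det, map_zero, ← hZ]
      congr 1
      ext1 a b
      exact hz _ _
    apply hdet
    exact (AlgHom.map_det ψ (z.submatrix g h)).symm.trans (by rw [hz0, map_zero])
  · have := AlgHom.map_trace_map_mul ψ (A j) z
    rw [hψf] at this
    simpa using this.symm

end Generic

theorem stmt_7 (d r N : ℕ) (hr : 1 ≤ r) (hrd : r ≤ d) (hN : N < 2 * r * d - r ^ 2)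
    (A : Fin N → Matrix (Fin d) (Fin d) ℂ) :
    ∃ Q : Matrix (Fin d) (Fin d) ℂ, Q ≠ 0 ∧ Q.rank ≤ r ∧
      ∀ j, Matrix.trace (A j * Q) = 0 := by
  obtain ⟨s, rfl⟩ := Nat.exists_eq_add_of_le hrd
  have : Nonempty (Fin r) := ⟨⟨0, hr⟩⟩
  let e : Fin r ⊕ Fin s ≃ Fin (r + s) := finSumFinEquiv
  have hcard : N < Fintype.card ((Fin r × Fin r) ⊕ (Fin s × Fin r) ⊕ (Fin r × Fin s)) := by
    simp only [Fintype.card_sum, Fintype.card_prod, Fintype.card_fin]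
    refine hN.trans_le (Nat.sub_le_iff_le_add.mpr (le_of_eq ?_))
    ring
  obtain ⟨Q, hQ0, hQr, hQ⟩ := Matrix.exists_ne_zero_rank_le_card_trace_mul_eq_zero hcard
    fun j => (A j).submatrix e e
  refine ⟨Q.submatrix e.symm e.symm, fun h => hQ0 ?_, ?_, fun j => ?_⟩
  · simpa using congrArg (fun M => M.submatrix e e) h
  · rw [Matrix.rank_submatrix]
    simpa using hQr
  · have h1 : A j * Q.submatrix e.symm e.symm =
        ((A j).submatrix e e * Q).submatrix e.symm e.symm := by
      rw [← Matrix.submatrix_mul_equiv _ _ _ e.symm]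
      simp
    rw [h1, ← hQ j]
    exact e.symm.sum_comp fun i => ((A j).submatrix e e * Q) i i
end

section
/- Let p, q ≥ 1, N ≥ p + q − 1, and 1 ≤ r_1, …, r_N ≤ min(p, q). Let V ⊂ (ℝ^{p×q})^N denote the set of N-tuples (B_1, …, B_N) of real p×q matrices with rank(B_j) ≤ r_j for all j, equipped with the Euclidean topology. Then the set of tuples (B_1, …, B_N) ∈ V such that rank(B_j) = r_j for all j and the corresponding bilinear form L(x, y) = (xᵀB_1y, …, xᵀB_Ny) is nonsingular is dense in V. -/
open Matrix

/-- The bilinear form corresponding to matrices `B_1, …, B_N` is nonsingular if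
`xᵀB_jy = 0` for all `j` implies `x = 0` or `y = 0`. -/
def NonsingularBilinear {p q N : ℕ} (B : Fin N → Matrix (Fin p) (Fin q) ℝ) : Prop :=
  ∀ (x : Fin p → ℝ) (y : Fin q → ℝ), (∀ j, x ⬝ᵥ (B j) *ᵥ y = 0) → x = 0 ∨ y = 0

section Rank

theorem Matrix.rank_add_le_add {m n : Type*} [Finite m] [Fintype n] (A B : Matrix m n ℝ) : (A + B).rank ≤ A.rank + B.rank := by
  have h : LinearMap.range (A + B).mulVecLin ≤
      LinearMap.range A.mulVecLin ⊔ LinearMap.range B.mulVecLin := by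
    rintro _ ⟨v, rfl⟩
    rw [Matrix.mulVecLin_add]
    exact Submodule.add_mem_sup ⟨v, rfl⟩ ⟨v, rfl⟩
  exact (Submodule.finrank_mono h).trans (Submodule.finrank_add_le_finrank_add_finrank _ _)

variable {m n : Type*} [Fintype m] [Fintype n]

theorem Matrix.isOpen_setOf_le_rank (k : ℕ) : IsOpen {A : Matrix m n ℝ | k ≤ A.rank} := by
  classical
  let φ : Matrix m n ℝ →ₗ[ℝ] ((n → ℝ) →L[ℝ] (m → ℝ)) :=
    LinearMap.toContinuousLinearMap.toLinearMap ∘ₗ (Matrix.toLin' (R := ℝ)).toLinearMap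
  have hφ : Continuous φ := φ.continuous_of_finiteDimensional
  convert (isOpen_setOfPred_nat_le_rank (𝕜 := ℝ) (E := n → ℝ) (F := m → ℝ) k).preimage hφ using 1
  ext A
  change k ≤ Module.finrank ℝ (LinearMap.range A.mulVecLin) ↔
    (k : Cardinal) ≤ Module.rank ℝ (LinearMap.range (Matrix.toLin' A))
  rw [← Module.finrank_eq_rank, Nat.cast_le]
  rfl

/-- Wedderburn rank reduction: a nonzero matrix becomes a matrix of smaller rank after
subtracting a suitable rank-one matrix. -/
theorem Matrix.exists_rank_lt_add_vecMulVec {A : Matrix m n ℝ} (hA : 0 < A.rank) :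
    ∃ (a : m → ℝ) (b : n → ℝ) (C : Matrix m n ℝ), A = vecMulVec a b + C ∧ C.rank < A.rank := by
  obtain ⟨v, hv⟩ : ∃ v, A *ᵥ v ≠ 0 := by
    by_contra! h
    have h0 : A.mulVecLin = 0 := LinearMap.ext h
    rw [Matrix.rank, h0, LinearMap.range_zero, finrank_bot] at hA
    exact hA.false
  set w := A *ᵥ v with hw
  have hww : w ⬝ᵥ w ≠ 0 := by simpa [dotProduct_self_eq_zero] using hv
  let b : n → ℝ := (w ⬝ᵥ w)⁻¹ • (w ᵥ* A)
  refine ⟨w, b, A - vecMulVec w b, by simp, Submodule.finrank_lt_finrank_of_lt ?_⟩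
  have key : ∀ z, (A - vecMulVec w b) *ᵥ z = A *ᵥ (z - (b ⬝ᵥ z) • v) := by
    intro z
    rw [sub_mulVec, vecMulVec_mulVec, mulVec_sub, mulVec_smul, ← hw]
    simp
  refine lt_of_le_of_ne ?_ fun h => ?_
  · rintro _ ⟨z, rfl⟩
    exact ⟨_, (key z).symm⟩
  · have hmem : w ∈ LinearMap.range A.mulVecLin := ⟨v, rfl⟩
    rw [← h] at hmem
    obtain ⟨z, hz⟩ := hmem
    apply hww
    calc w ⬝ᵥ w = w ⬝ᵥ (A - vecMulVec w b) *ᵥ z := by rw [← mulVecLin_apply, hz]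
      _ = 0 := by
        rw [sub_mulVec, vecMulVec_mulVec, dotProduct_sub, dotProduct_mulVec]
        simp [b, hww, mul_comm]

theorem Matrix.mem_closure_rank_eq_succ {A : Matrix m n ℝ} (hm : A.rank < Fintype.card m)
    (hn : A.rank < Fintype.card n) : A ∈ closure {B : Matrix m n ℝ | B.rank = A.rank + 1} := by
  obtain ⟨v, hv, hv0⟩ : ∃ v, A *ᵥ v = 0 ∧ v ≠ 0 := by
    by_contra! h
    have hker : LinearMap.ker A.mulVecLin = ⊥ := LinearMap.ker_eq_bot'.2 h
    have := A.mulVecLin.finrank_range_add_finrank_ker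
    rw [hker] at this
    simp only [finrank_bot, Module.finrank_fintype_fun_eq_card] at this
    exact hn.ne this
  obtain ⟨w, hw⟩ : ∃ w, w ∉ LinearMap.range A.mulVecLin := by
    by_contra! h
    have htop : LinearMap.range A.mulVecLin = ⊤ := Submodule.eq_top_iff'.2 h
    refine hm.ne ?_
    rw [Matrix.rank, htop]
    simp
  have hvv : v ⬝ᵥ v ≠ 0 := by simpa [dotProduct_self_eq_zero] using hv0
  have hrank : ∀ t : ℝ, t ≠ 0 → (A + t • vecMulVec w v).rank = A.rank + 1 := by
    intro t ht
    apply le_antisymm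
    · rw [← smul_vecMulVec]
      exact (rank_add_le_add _ _).trans (Nat.add_le_add_left (rank_vecMulVec_le _ _) _)
    · apply Nat.succ_le_of_lt
      apply Submodule.finrank_lt_finrank_of_lt
      have happ : ∀ z, (A + t • vecMulVec w v) *ᵥ z = A *ᵥ z + (t * (v ⬝ᵥ z)) • w := by
        intro z
        rw [add_mulVec, smul_mulVec, vecMulVec_mulVec]
        simp [mul_smul]
      refine lt_of_le_of_ne ?_ fun h => hw ?_
      · rintro _ ⟨z, rfl⟩
        refine ⟨z - ((v ⬝ᵥ v)⁻¹ * (v ⬝ᵥ z)) • v, ?_⟩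
        rw [mulVecLin_apply, happ, mulVec_sub, mulVec_smul, hv, dotProduct_sub, dotProduct_smul]
        simp only [smul_eq_mul, smul_zero, sub_zero, mulVecLin_apply]
        field_simp
        simp
      · rw [h]
        refine ⟨(t * (v ⬝ᵥ v))⁻¹ • v, ?_⟩
        rw [mulVecLin_apply, happ, mulVec_smul, hv, dotProduct_smul]
        simp only [smul_eq_mul, smul_zero, zero_add]
        field_simp
        simp
  have hcont : Continuous fun t : ℝ => A + t • vecMulVec w v := by fun_prop
  have h0 : (0 : ℝ) ∈ closure {t : ℝ | t ≠ 0} := by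
    have : Dense {t : ℝ | t ≠ 0} := dense_compl_singleton (0 : ℝ)
    exact this 0
  simpa using map_mem_closure hcont h0 fun t ht => hrank t ht

theorem Matrix.mem_closure_rank_eq {A : Matrix m n ℝ} {r : ℕ} (hA : A.rank ≤ r)
    (hm : r ≤ Fintype.card m) (hn : r ≤ Fintype.card n) :
    A ∈ closure {B : Matrix m n ℝ | B.rank = r} := by
  induction r, hA using Nat.le_induction with
  | base => exact subset_closure rfl
  | succ k _ ih =>
    refine closure_minimal ?_ isClosed_closure (ih (by omega) (by omega))
    rintro B rfl
    exact mem_closure_rank_eq_succ hm hn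

end Rank

section Parametrization

variable {p q N : ℕ}

/-- A solution `t` of `s * t + c = 0` for `s = σ * exp μ` with `σ = ±1`; for `σ = 0` it is the
arbitrary number `μ`. -/
noncomputable def solutionParam (σ : SignType) (c μ : ℝ) : ℝ :=
  if σ = 0 then μ else -((σ : ℝ) * c * Real.exp (-μ))

theorem exists_solutionParam {s t c : ℝ} (h : s * t + c = 0) :
    ∃ (σ : SignType) (μ : ℝ), s = σ * Real.exp μ ∧ t = solutionParam σ c μ := by
  rcases lt_trichotomy s 0 with hs | hs | hs
  · refine ⟨-1, Real.log (-s), ?_, ?_⟩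
    · rw [Real.exp_log (by linarith)]; simp
    · simp only [solutionParam, Real.exp_neg, Real.exp_log (neg_pos.2 hs)]
      have : s ≠ 0 := hs.ne
      simp
      field_simp
      linarith
  · exact ⟨0, t, by simp [hs], by simp [solutionParam]⟩
  · refine ⟨1, Real.log s, ?_, ?_⟩
    · rw [Real.exp_log hs]; simp
    · simp only [solutionParam, Real.exp_neg, Real.exp_log hs]
      have : s ≠ 0 := hs.ne'
      simp
      field_simp
      linarith

/-- The vector whose entries other than the `i`-th are given by `a`, and whose product with
`i.insertNth 1 x` is `s`. -/
def completeVec (i : Fin (p + 1)) (x a : Fin p → ℝ) (s : ℝ) : Fin (p + 1) → ℝ :=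
  i.insertNth (s - x ⬝ᵥ a) a

theorem eq_completeVec (i : Fin (p + 1)) (x : Fin p → ℝ) (a : Fin (p + 1) → ℝ) :
    a = completeVec i x (i.removeNth a) ((i.insertNth 1 x : Fin (p + 1) → ℝ) ⬝ᵥ a) := by
  rw [completeVec, Fin.eq_insertNth_iff]
  refine ⟨?_, rfl⟩
  rw [dotProduct, Fin.sum_univ_succAbove _ i]
  simp [dotProduct, Fin.removeNth]

/-- The parametrization, for fixed discrete data, of the pairs of vectors `(a_j, b_j)` for which
`vecMulVec a_j b_j + C_j` defines a singular bilinear form. -/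
noncomputable def singularParam (C : Fin N → Matrix (Fin (p + 1)) (Fin (q + 1)) ℝ)
    (i : Fin (p + 1)) (k : Fin (q + 1)) (σ : Fin N → SignType)
    (e : (Fin p → ℝ) × (Fin q → ℝ) × (Fin N → (Fin p → ℝ) × (Fin q → ℝ) × ℝ)) :
    Fin N → (Fin (p + 1) → ℝ) × (Fin (q + 1) → ℝ) := fun j =>
  (completeVec i e.1 (e.2.2 j).1 (σ j * Real.exp (e.2.2 j).2.2),
   completeVec k e.2.1 (e.2.2 j).2.1 (solutionParam (σ j)
    ((i.insertNth 1 e.1 : Fin (p + 1) → ℝ) ⬝ᵥ C j *ᵥ (k.insertNth 1 e.2.1 : Fin (q + 1) → ℝ))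
    (e.2.2 j).2.2))

section ContDiff

variable {E : Type*} [NormedAddCommGroup E] [NormedSpace ℝ E]

theorem ContDiff.dotProduct_real {ι : Type*} [Fintype ι] {x a : E → ι → ℝ} (hx : ContDiff ℝ 1 x)
    (ha : ContDiff ℝ 1 a) : ContDiff ℝ 1 fun e => x e ⬝ᵥ a e := by
  rw [contDiff_pi] at hx ha
  exact ContDiff.sum fun l _ => (hx l).mul (ha l)

theorem ContDiff.insertNth_real (i : Fin (p + 1)) {s : E → ℝ} {a : E → Fin p → ℝ}
    (hs : ContDiff ℝ 1 s) (ha : ContDiff ℝ 1 a) :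
    ContDiff ℝ 1 fun e => (i.insertNth (s e) (a e) : Fin (p + 1) → ℝ) := by
  rw [contDiff_pi] at ha ⊢
  rw [Fin.forall_iff_succAbove i]
  exact ⟨by simpa using hs, fun l => by simpa using ha l⟩

theorem ContDiff.completeVec (i : Fin (p + 1)) {x a : E → Fin p → ℝ} {s : E → ℝ}
    (hx : ContDiff ℝ 1 x) (ha : ContDiff ℝ 1 a) (hs : ContDiff ℝ 1 s) :
    ContDiff ℝ 1 fun e => completeVec i (x e) (a e) (s e) :=
  .insertNth_real i (hs.sub (hx.dotProduct_real ha)) ha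

theorem ContDiff.solutionParam (σ : SignType) {c μ : E → ℝ} (hc : ContDiff ℝ 1 c)
    (hμ : ContDiff ℝ 1 μ) : ContDiff ℝ 1 fun e => solutionParam σ (c e) (μ e) := by
  unfold _root_.solutionParam
  split_ifs
  · exact hμ
  · exact ((contDiff_const.mul hc).mul hμ.neg.exp).neg

end ContDiff

theorem contDiff_singularParam (C : Fin N → Matrix (Fin (p + 1)) (Fin (q + 1)) ℝ)
    (i : Fin (p + 1)) (k : Fin (q + 1)) (σ : Fin N → SignType) :
    ContDiff ℝ 1 (singularParam C i k σ) := by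
  rw [contDiff_pi]
  intro j
  have hy : ContDiff ℝ 1 fun e : (Fin p → ℝ) × (Fin q → ℝ) ×
      (Fin N → (Fin p → ℝ) × (Fin q → ℝ) × ℝ) => e.2.1 := by fun_prop
  have hj : ContDiff ℝ 1 fun e : (Fin p → ℝ) × (Fin q → ℝ) ×
      (Fin N → (Fin p → ℝ) × (Fin q → ℝ) × ℝ) => e.2.2 j := by fun_prop
  refine .prodMk (.completeVec i contDiff_fst hj.fst (contDiff_const.mul hj.snd.snd.exp))
    (.completeVec k hy hj.snd.fst (.solutionParam _ (.dotProduct_real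
      (.insertNth_real i contDiff_const contDiff_fst) ?_) hj.snd.snd))
  exact contDiff_pi.2 fun l =>
    contDiff_const.dotProduct_real (.insertNth_real k contDiff_const hy)

theorem mem_range_singularParam {C : Fin N → Matrix (Fin (p + 1)) (Fin (q + 1)) ℝ}
    {i : Fin (p + 1)} {k : Fin (q + 1)} {w : Fin N → (Fin (p + 1) → ℝ) × (Fin (q + 1) → ℝ)}
    {x : Fin p → ℝ} {y : Fin q → ℝ}
    (h : ∀ j, (i.insertNth 1 x : Fin (p + 1) → ℝ) ⬝ᵥ
      (vecMulVec (w j).1 (w j).2 + C j) *ᵥ (k.insertNth 1 y : Fin (q + 1) → ℝ) = 0) :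
    ∃ σ, w ∈ Set.range (singularParam C i k σ) := by
  have h' : ∀ j, ((i.insertNth 1 x : Fin (p + 1) → ℝ) ⬝ᵥ (w j).1) *
      ((k.insertNth 1 y : Fin (q + 1) → ℝ) ⬝ᵥ (w j).2) +
      (i.insertNth 1 x : Fin (p + 1) → ℝ) ⬝ᵥ C j *ᵥ (k.insertNth 1 y : Fin (q + 1) → ℝ) = 0 := by
    intro j
    rw [← h j, add_mulVec, dotProduct_add, vecMulVec_mulVec, dotProduct_comm _ (w j).2]
    simp [mul_comm]
  choose σ μ hs ht using fun j => exists_solutionParam (h' j)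
  refine ⟨σ, (x, y, fun j => (i.removeNth (w j).1, k.removeNth (w j).2, μ j)), ?_⟩
  funext j
  exact Prod.ext (by rw [eq_completeVec i x (w j).1, hs]; simp [singularParam, completeVec])
    (by rw [eq_completeVec k y (w j).2, ht]; simp [singularParam, completeVec])

theorem exists_smul_eq_insertNth {x : Fin (p + 1) → ℝ} (hx : x ≠ 0) :
    ∃ (i : Fin (p + 1)) (c : ℝ) (x' : Fin p → ℝ), c • x = i.insertNth 1 x' := by
  obtain ⟨i, hi⟩ := Function.ne_iff.1 hx
  refine ⟨i, (x i)⁻¹, i.removeNth ((x i)⁻¹ • x), ?_⟩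
  rw [Fin.eq_insertNth_iff]
  exact ⟨inv_mul_cancel₀ hi, rfl⟩

theorem dense_nonsingularBilinear_vecMulVec_add (hN : p + q + 1 ≤ N)
    (C : Fin N → Matrix (Fin (p + 1)) (Fin (q + 1)) ℝ) :
    Dense {w : Fin N → (Fin (p + 1) → ℝ) × (Fin (q + 1) → ℝ) |
      NonsingularBilinear fun j => vecMulVec (w j).1 (w j).2 + C j} := by
  let S := ⋃ d : Fin (p + 1) × Fin (q + 1) × (Fin N → SignType),
    Set.range (singularParam C d.1 d.2.1 d.2.2)
  have hS : Dense Sᶜ := by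
    apply dense_compl_of_dimH_lt_finrank
    rw [dimH_iUnion]
    refine lt_of_le_of_lt (iSup_le fun d =>
      (contDiff_singularParam C d.1 d.2.1 d.2.2).dimH_range_le) ?_
    rw [Nat.cast_lt]
    simp only [Module.finrank_prod, Module.finrank_pi_fintype, Module.finrank_self,
      Finset.sum_const, Finset.card_univ, Fintype.card_fin, smul_eq_mul, mul_one]
    nlinarith
  refine hS.mono fun w hw x y h => ?_
  by_contra! hxy
  obtain ⟨i, c, x', hx⟩ := exists_smul_eq_insertNth hxy.1
  obtain ⟨k, d, y', hy⟩ := exists_smul_eq_insertNth hxy.2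
  obtain ⟨σ, hσ⟩ := mem_range_singularParam (C := C) (i := i) (k := k) (w := w) (x := x')
    (y := y') fun j => by
      rw [← hx, ← hy, mulVec_smul, dotProduct_smul, smul_dotProduct, h j]
      simp
  exact hw (Set.mem_iUnion.2 ⟨(i, k, σ), hσ⟩)

end Parametrization

theorem stmt_9 (p q N : ℕ) (hp : 1 ≤ p) (hq : 1 ≤ q) (hN : p + q - 1 ≤ N)
    (r : Fin N → ℕ) (hr : ∀ j, 1 ≤ r j ∧ r j ≤ min p q) :
    {B : Fin N → Matrix (Fin p) (Fin q) ℝ | ∀ j, (B j).rank ≤ r j} ⊆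
      closure {B : Fin N → Matrix (Fin p) (Fin q) ℝ |
        (∀ j, (B j).rank = r j) ∧ NonsingularBilinear B} := by
  obtain ⟨p, rfl⟩ : ∃ p', p = p' + 1 := ⟨p - 1, by omega⟩
  obtain ⟨q, rfl⟩ : ∃ q', q = q' + 1 := ⟨q - 1, by omega⟩
  intro B hB
  have hmem : B ∈ closure {B : Fin N → Matrix (Fin (p + 1)) (Fin (q + 1)) ℝ |
      ∀ j, (B j).rank = r j} := by
    have := closure_pi_set Set.univ
      fun j => {A : Matrix (Fin (p + 1)) (Fin (q + 1)) ℝ | A.rank = r j}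
    simp only [Set.pi, Set.mem_univ, true_imp_iff, Set.mem_ofPred_eq] at this
    rw [this]
    intro j
    have := hr j
    exact mem_closure_rank_eq (hB j) (by simp; omega) (by simp; omega)
  refine closure_minimal ?_ isClosed_closure hmem
  intro B hB
  choose a b C hA hC using fun j =>
    exists_rank_lt_add_vecMulVec (A := B j) (by rw [hB j]; exact (hr j).1)
  let Φ : (Fin N → (Fin (p + 1) → ℝ) × (Fin (q + 1) → ℝ)) →
      Fin N → Matrix (Fin (p + 1)) (Fin (q + 1)) ℝ := fun w j => vecMulVec (w j).1 (w j).2 + C j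
  have hΦ : Continuous Φ := by
    refine continuous_pi fun j => ?_
    have hj : Continuous fun w : Fin N → (Fin (p + 1) → ℝ) × (Fin (q + 1) → ℝ) => w j :=
      continuous_apply j
    exact (Continuous.matrix_vecMulVec hj.fst hj.snd).add continuous_const
  have hopen : IsOpen {w | ∀ j, r j ≤ (Φ w j).rank} := by
    rw [Set.ofPred_forall]
    exact isOpen_iInter_of_finite fun j =>
      (isOpen_setOf_le_rank (r j)).preimage ((continuous_apply j).comp hΦ)
  have hΦB : Φ (fun j => (a j, b j)) = B := funext fun j => (hA j).symm
  have hcl := (dense_nonsingularBilinear_vecMulVec_add (by omega) C).open_subset_closure_inter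
    hopen (show (fun j => (a j, b j)) ∈ _ by
      intro j
      rw [hΦB, hB j])
  rw [← hΦB]
  refine map_mem_closure hΦ hcl ?_
  rintro w ⟨hw, hns⟩
  refine ⟨fun j => le_antisymm ?_ (hw j), hns⟩
  have h1 := rank_add_le_add (vecMulVec (w j).1 (w j).2) (C j)
  have h2 := rank_vecMulVec_le (w j).1 (w j).2
  have h3 := hC j
  rw [hB j] at h3
  change (vecMulVec (w j).1 (w j).2 + C j).rank ≤ r j
  omega
end

section
/- Let p, q ≥ 1 and N ≤ p + q − 2. Suppose there exist real matrices B_1, …, B_N ∈ ℝ^{p×q} whose corresponding bilinear form L(x, y) = (xᵀB_1y, …, xᵀB_Ny) is nonsingular. Then for every integer n with N ≤ n ≤ p + q − 2, the binomial coefficient C(n, p−1) is even. -/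
open Matrix

theorem Polynomial.exists_isRoot_of_odd_natDegree_real {f : Polynomial ℝ}
    (hf : Odd f.natDegree) : ∃ c, f.IsRoot c := by
  by_contra! h
  rw [← Nat.not_even_iff_odd] at hf
  refine hf ?_
  clear hf
  induction f using UniqueFactorizationMonoid.induction_on_prime with
  | h₁ => simp
  | h₂ f hf => simp [Polynomial.natDegree_eq_zero_of_isUnit hf]
  | h₃ f g hf hg ih =>
    have hgdeg : g.natDegree = 2 := by
      have h0 := hg.irreducible.natDegree_pos
      have h2 := hg.irreducible.natDegree_le_two
      have h1 : g.natDegree ≠ 1 := fun h1 => by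
        obtain ⟨c, hc⟩ := Polynomial.exists_root_of_degree_eq_one
          ((Polynomial.degree_eq_iff_natDegree_eq_of_pos one_pos).2 h1)
        exact h c (Polynomial.root_mul.2 (Or.inl hc))
      omega
    rw [Polynomial.natDegree_mul hg.ne_zero hf, hgdeg]
    exact even_two.add (ih fun c hc => h c (Polynomial.root_mul.2 (Or.inr hc)))

theorem Module.End.exists_common_eigenvector_of_odd_finrank {ι V : Type*} [AddCommGroup V]
    [Module ℝ V] [FiniteDimensional ℝ V] (T : ι → Module.End ℝ V)
    (hT : ∀ i j, Commute (T i) (T j)) (hV : Odd (Module.finrank ℝ V)) :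
    ∃ v : V, v ≠ 0 ∧ ∀ i, ∃ c : ℝ, T i v = c • v := by
  induction hd : Module.finrank ℝ V using Nat.strong_induction_on generalizing V with
  | _ d ih =>
  have : Nontrivial V := Module.nontrivial_of_finrank_pos (R := ℝ) hV.pos
  by_cases hs : ∀ i, ∃ c : ℝ, ∀ v, T i v = c • v
  · obtain ⟨v, hv⟩ := exists_ne (0 : V)
    refine ⟨v, hv, fun i => ?_⟩
    obtain ⟨c, hc⟩ := hs i
    exact ⟨c, hc v⟩
  push Not at hs
  obtain ⟨i, hi⟩ := hs
  obtain ⟨c, hc⟩ : ∃ c : ℝ, (T i).charpoly.IsRoot c := by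
    apply Polynomial.exists_isRoot_of_odd_natDegree_real
    rwa [LinearMap.charpoly_natDegree]
  have hev : (T i).HasEigenvalue c := (Module.End.hasEigenvalue_iff_isRoot_charpoly _ _).2 hc
  set S : Module.End ℝ V := T i - algebraMap ℝ _ c with hS
  have hcomm : ∀ j, Commute S (T j) := fun j =>
    (hT i j).sub_left (Algebra.commute_algebraMap_left c (T j))
  have hsum := LinearMap.finrank_range_add_finrank_ker S
  have hker : 0 < Module.finrank ℝ (LinearMap.ker S) := by
    obtain ⟨v, hv⟩ := hev.exists_hasEigenvector
    refine Module.finrank_pos_iff_exists_ne_zero.2 ⟨⟨v, ?_⟩, ?_⟩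
    · simp [hS, hv.apply_eq_smul, Module.algebraMap_end_apply]
    · simpa using hv.2
  have hrange : 0 < Module.finrank ℝ (LinearMap.range S) := by
    obtain ⟨v, hv⟩ := hi c
    refine Module.finrank_pos_iff_exists_ne_zero.2 ⟨⟨S v, ⟨v, rfl⟩⟩, ?_⟩
    simpa [hS, Module.algebraMap_end_apply, sub_eq_zero] using hv
  have descend : ∀ W : Submodule ℝ V, (∀ j, ∀ w ∈ W, T j w ∈ W) →
      Odd (Module.finrank ℝ W) → Module.finrank ℝ W < d →
      ∃ v : V, v ≠ 0 ∧ ∀ i, ∃ c : ℝ, T i v = c • v := by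
    intro W hW hodd hlt
    obtain ⟨v, hv, h⟩ := ih _ hlt (V := W) (fun j => (T j).restrict (hW j))
      (fun j k => by
        ext w
        have := LinearMap.congr_fun (hT j k).eq (w : V)
        simpa using this) hodd rfl
    refine ⟨v, by simpa using hv, fun j => ?_⟩
    obtain ⟨c, hc⟩ := h j
    exact ⟨c, by simpa using congrArg Subtype.val hc⟩
  rcases Nat.even_or_odd (Module.finrank ℝ (LinearMap.ker S)) with he | ho
  · refine descend (LinearMap.range S) ?_ ?_ (by omega)
    · rintro j _ ⟨w, rfl⟩
      exact ⟨T j w, LinearMap.congr_fun (hcomm j).eq w⟩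
    · by_contra hne
      rw [Nat.not_odd_iff_even] at hne
      rw [← hsum] at hV
      exact Nat.not_even_iff_odd.2 hV (hne.add he)
  · refine descend (LinearMap.ker S) ?_ ho (by omega)
    intro j w hw
    have := LinearMap.congr_fun (hcomm j).eq w
    simp only [Module.End.mul_apply] at this
    rw [LinearMap.mem_ker] at hw ⊢
    rw [this, hw, map_zero]

namespace MvPolynomial

variable {r : ℕ}

/-- Polynomials all of whose monomials have degree less than `a`. -/
noncomputable def degreeBelow (r a : ℕ) : Submodule ℝ (MvPolynomial (Fin r) ℝ) :=
  restrictSupport ℝ {m | m.degree < a}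

theorem mem_degreeBelow {a : ℕ} {f : MvPolynomial (Fin r) ℝ} :
    f ∈ degreeBelow r a ↔ ∀ m, coeff m f ≠ 0 → m.degree < a := by
  simp [degreeBelow, mem_restrictSupport_iff, Set.subset_def]

theorem mem_degreeBelow' {a : ℕ} {f : MvPolynomial (Fin r) ℝ} :
    f ∈ degreeBelow r a ↔ ∀ m, a ≤ m.degree → coeff m f = 0 := by
  rw [mem_degreeBelow]
  refine forall_congr' fun m => ?_
  rw [← not_lt, not_imp_comm]

theorem degreeBelow_mono {a b : ℕ} (h : a ≤ b) : degreeBelow r a ≤ degreeBelow r b :=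
  restrictSupport_mono _ fun _ hm => lt_of_lt_of_le hm h

theorem degreeBelow_zero : degreeBelow r 0 = ⊥ := by
  rw [eq_bot_iff]
  intro f hf
  rw [mem_degreeBelow'] at hf
  ext m
  simpa using hf m (Nat.zero_le _)

theorem IsHomogeneous.mem_degreeBelow {a : ℕ} {f : MvPolynomial (Fin r) ℝ}
    (hf : f.IsHomogeneous a) : f ∈ degreeBelow r (a + 1) := by
  rw [mem_degreeBelow']
  intro m hm
  exact hf.coeff_eq_zero (by omega)

theorem mul_mem_degreeBelow {a b : ℕ} {f g : MvPolynomial (Fin r) ℝ} (hf : f ∈ degreeBelow r a)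
    (hg : g ∈ degreeBelow r (b + 1)) : f * g ∈ degreeBelow r (a + b) := by
  rw [mem_degreeBelow'] at *
  intro m hm
  rw [coeff_mul]
  refine Finset.sum_eq_zero fun ⟨x, y⟩ hxy => ?_
  rw [Finset.HasAntidiagonal.mem_antidiagonal] at hxy
  have hd : x.degree + y.degree = m.degree := by rw [← hxy]; exact (map_add Finsupp.degree x y).symm
  by_cases hx : a ≤ x.degree
  · rw [hf x hx, zero_mul]
  · simp only
    rw [hg y (by omega), mul_zero]

theorem mem_degreeBelow_iff_homogeneousComponent {a : ℕ} {f : MvPolynomial (Fin r) ℝ}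
    (hf : f ∈ degreeBelow r (a + 1)) :
    f ∈ degreeBelow r a ↔ homogeneousComponent a f = 0 := by
  rw [mem_degreeBelow'] at *
  constructor
  · intro h
    ext m
    rw [coeff_homogeneousComponent]
    split_ifs with hm
    · simpa using h m hm.ge
    · simp
  · intro h m hm
    rcases hm.eq_or_lt with hm | hm
    · have := congrArg (coeff m) h
      rwa [coeff_homogeneousComponent, if_pos hm.symm] at this
    · exact hf m hm

theorem homogeneousSubmodule_eq_restrictSupport (a : ℕ) :
    homogeneousSubmodule (Fin r) ℝ a = restrictSupport ℝ {m | m.degree = a} :=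
  homogeneousSubmodule_eq_finsupp_supported _ _ _

theorem finite_degree_eq (r a : ℕ) : {m : Fin r →₀ ℕ | m.degree = a}.Finite := by
  refine ((Finset.univ : Finset (Fin r)).finsuppAntidiag a).finite_toSet.subset fun m hm => ?_
  rw [Set.mem_ofPred_eq, Finsupp.degree_eq_sum] at hm
  simp [Finset.mem_finsuppAntidiag, hm]

theorem ncard_degree_eq (r a : ℕ) :
    {m : Fin r →₀ ℕ | m.degree = a}.ncard = r.multichoose a := by
  have : {m : Fin r →₀ ℕ | m.degree = a} =
      ((Finset.univ : Finset (Fin r)).finsuppAntidiag a : Set (Fin r →₀ ℕ)) := by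
    ext m
    simp [Finset.mem_finsuppAntidiag, Finsupp.degree_eq_sum]
  rw [this, Set.ncard_coe_finset, Finset.card_finsuppAntidiag_nat_eq_multichoose]
  simp

theorem degree_lt_succ (r a : ℕ) : {m : Fin r →₀ ℕ | m.degree < a + 1} =
    {m | m.degree < a} ∪ {m | m.degree = a} := by
  ext m
  simp [le_iff_lt_or_eq]

theorem finite_degree_lt (r a : ℕ) : {m : Fin r →₀ ℕ | m.degree < a}.Finite := by
  induction a with
  | zero => simp
  | succ a ih => rw [degree_lt_succ]; exact ih.union (finite_degree_eq r a)

theorem ncard_degree_lt (k a : ℕ) :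
    {m : Fin (k + 1) →₀ ℕ | m.degree < a}.ncard = (k + a).choose (k + 1) := by
  induction a with
  | zero => simp
  | succ a ih =>
    rw [degree_lt_succ, Set.ncard_union_eq _ (finite_degree_lt _ a) (finite_degree_eq _ a), ih,
      ncard_degree_eq, Nat.multichoose_eq, ← add_assoc, Nat.choose_succ_succ (k + a),
      show k + 1 + a - 1 = k + a by omega, Nat.choose_symm_add, add_comm]
    rw [Set.disjoint_left]
    intro m hm hm'
    simp only [Set.mem_ofPred_eq] at hm hm'
    omega

instance (a : ℕ) : FiniteDimensional ℝ (degreeBelow r a) := by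
  have := (finite_degree_lt r a).to_subtype
  exact Module.Finite.of_basis (basisRestrictSupport ℝ {m : Fin r →₀ ℕ | m.degree < a})

instance (a : ℕ) : FiniteDimensional ℝ (homogeneousSubmodule (Fin r) ℝ a) := by
  rw [homogeneousSubmodule_eq_restrictSupport]
  have := (finite_degree_eq r a).to_subtype
  exact Module.Finite.of_basis (basisRestrictSupport ℝ {m : Fin r →₀ ℕ | m.degree = a})

theorem finrank_degreeBelow (k a : ℕ) :
    Module.finrank ℝ (degreeBelow (k + 1) a) = (k + a).choose (k + 1) := by
  rw [← ncard_degree_lt, ← Nat.card_coe_set_eq]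
  exact Module.finrank_eq_nat_card_basis (basisRestrictSupport ℝ _)

theorem finrank_homogeneousSubmodule (k a : ℕ) :
    Module.finrank ℝ (homogeneousSubmodule (Fin (k + 1)) ℝ a) = (k + a).choose k := by
  rw [Nat.choose_symm_add, show k + a = k + 1 + a - 1 by omega, ← Nat.multichoose_eq,
    ← ncard_degree_eq, ← Nat.card_coe_set_eq, homogeneousSubmodule_eq_restrictSupport]
  exact Module.finrank_eq_nat_card_basis (basisRestrictSupport ℝ _)

/-- `g` is homogeneous of degree `a` and is the degree `a` part of `f`, all other monomials of
`f` having smaller degree. -/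
def HasLeadingForm (f g : MvPolynomial (Fin r) ℝ) (a : ℕ) : Prop :=
  g.IsHomogeneous a ∧ f - g ∈ degreeBelow r a

namespace HasLeadingForm

variable {f g f' g' : MvPolynomial (Fin r) ℝ} {a b : ℕ}

theorem of_isHomogeneous (hf : f.IsHomogeneous a) : HasLeadingForm f f a :=
  ⟨hf, by simp⟩

theorem of_mem (hf : f ∈ degreeBelow r (a + 1)) :
    HasLeadingForm f (homogeneousComponent a f) a := by
  have h := homogeneousComponent_isHomogeneous a f
  refine ⟨h, ?_⟩
  rw [mem_degreeBelow_iff_homogeneousComponent (Submodule.sub_mem _ hf h.mem_degreeBelow),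
    map_sub, homogeneousComponent_of_mem h, if_pos rfl, sub_self]

theorem mem (h : HasLeadingForm f g a) : f ∈ degreeBelow r (a + 1) := by
  rw [← sub_add_cancel f g]
  exact Submodule.add_mem _ (degreeBelow_mono (Nat.le_succ a) h.2) h.1.mem_degreeBelow

theorem eq_zero (h : HasLeadingForm f g a) (hf : f ∈ degreeBelow r a) : g = 0 := by
  have hg : g ∈ degreeBelow r a := by simpa using Submodule.sub_mem _ hf h.2
  rw [mem_degreeBelow_iff_homogeneousComponent h.1.mem_degreeBelow,
    homogeneousComponent_of_mem h.1, if_pos rfl] at hg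
  exact hg

theorem mul (h : HasLeadingForm f g a) (h' : HasLeadingForm f' g' b) :
    HasLeadingForm (f * f') (g * g') (a + b) := by
  refine ⟨h.1.mul h'.1, ?_⟩
  rw [show f * f' - g * g' = (f - g) * f' + (f' - g') * g by ring]
  refine Submodule.add_mem _ (mul_mem_degreeBelow h.2 h'.mem) ?_
  rw [add_comm]
  exact mul_mem_degreeBelow h'.2 h.1.mem_degreeBelow

theorem sum {ι : Type*} (t : Finset ι) {F G : ι → MvPolynomial (Fin r) ℝ}
    (h : ∀ i ∈ t, HasLeadingForm (F i) (G i) a) :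
    HasLeadingForm (∑ i ∈ t, F i) (∑ i ∈ t, G i) a := by
  refine ⟨IsHomogeneous.sum _ _ _ fun i hi => (h i hi).1, ?_⟩
  rw [← Finset.sum_sub_distrib]
  exact Submodule.sum_mem _ fun i hi => (h i hi).2

theorem prod {ι : Type*} (t : Finset ι) {F G : ι → MvPolynomial (Fin r) ℝ}
    (h : ∀ i ∈ t, HasLeadingForm (F i) (G i) 1) :
    HasLeadingForm (∏ i ∈ t, F i) (∏ i ∈ t, G i) t.card := by
  classical
  induction t using Finset.induction_on with
  | empty => exact of_isHomogeneous (by simpa using isHomogeneous_one (Fin r) ℝ)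
  | insert i t hi ih =>
    rw [Finset.prod_insert hi, Finset.prod_insert hi, Finset.card_insert_of_notMem hi, add_comm]
    exact (h i (Finset.mem_insert_self i t)).mul
      (ih fun j hj => h j (Finset.mem_insert_of_mem hj))

theorem C_mul (c : ℝ) (h : HasLeadingForm f g a) : HasLeadingForm (C c * f) (C c * g) a := by
  simpa using (of_isHomogeneous (isHomogeneous_C (Fin r) c)).mul h

theorem det {m : ℕ} {M N : Matrix (Fin m) (Fin m) (MvPolynomial (Fin r) ℝ)}
    (h : ∀ i j, HasLeadingForm (M i j) (N i j) 1) : HasLeadingForm M.det N.det m := by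
  rw [Matrix.det_apply', Matrix.det_apply']
  refine sum _ fun σ _ => ?_
  have := C_mul ((Equiv.Perm.sign σ : ℤ) : ℝ)
    (prod Finset.univ fun i (_ : i ∈ Finset.univ) => h (σ i) i)
  simpa using this

end HasLeadingForm

end MvPolynomial

namespace Matrix

/-- The relation between the rows of `M` indexed by the `q + 1` elements of `J` given by
Cramer's rule. -/
def cramerSyzygy {S : Type*} [CommRing S] {n q : ℕ} (M : Matrix (Fin n) (Fin q) S)
    (J : {J : Finset (Fin n) // J.card = q + 1}) : Fin n → S := fun l =>
  ∑ i : Fin (q + 1), if J.1.orderEmbOfFin J.2 i = l then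
    (-1) ^ (i : ℕ) * (M.submatrix (J.1.orderEmbOfFin J.2 ∘ i.succAbove) id).det else 0

theorem cramerSyzygy_vecMul {S : Type*} [CommRing S] {n q : ℕ} (M : Matrix (Fin n) (Fin q) S)
    (J : {J : Finset (Fin n) // J.card = q + 1}) : cramerSyzygy M J ᵥ* M = 0 := by
  ext j
  set e := J.1.orderEmbOfFin J.2
  let N : Matrix (Fin (q + 1)) (Fin (q + 1)) S :=
    Matrix.of fun i c => Fin.cons (α := fun _ => S) (M (e i) j) (fun c' => M (e i) c') c
  have hN : N.det = 0 := Matrix.det_zero_of_column_eq (i := 0) (j := j.succ)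
    (Fin.succ_ne_zero j).symm fun i => by simp [N]
  rw [Matrix.det_succ_column_zero] at hN
  rw [Pi.zero_apply, ← hN]
  simp only [vecMul, dotProduct, cramerSyzygy, Finset.sum_mul]
  rw [Finset.sum_comm]
  refine Finset.sum_congr rfl fun i _ => ?_
  simp only [ite_mul, zero_mul]
  rw [Finset.sum_ite_eq Finset.univ (J.1.orderEmbOfFin J.2 i)]
  simp only [Finset.mem_univ, if_true]
  rw [mul_right_comm]
  congr 1

end Matrix

namespace MvPolynomial

variable {r n q : ℕ}

/-- The matrix of linear forms with coefficients `A`. -/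
noncomputable def linMatrix {S : Type*} [CommRing S] (A : Fin n → Fin r → Fin q → S) :
    Matrix (Fin n) (Fin q) (MvPolynomial (Fin r) S) :=
  Matrix.of fun l j => ∑ i, C (A l i j) * X i

theorem isHomogeneous_linMatrix (A : Fin n → Fin r → Fin q → ℝ) (l : Fin n) (j : Fin q) :
    (linMatrix A l j).IsHomogeneous 1 := by
  rw [linMatrix, Matrix.of_apply]
  exact IsHomogeneous.sum _ _ _ fun i _ => isHomogeneous_C_mul_X (A l i j) i

/-- The matrix of polynomials of degree at most one with linear coefficients `A` and constant
coefficients `c`. -/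
noncomputable def affMatrix (A : Fin n → Fin r → Fin q → ℝ) (c : Fin n → Fin q → ℝ) :
    Matrix (Fin n) (Fin q) (MvPolynomial (Fin r) ℝ) :=
  Matrix.of fun l j => linMatrix A l j + C (c l j)

theorem hasLeadingForm_affMatrix (A : Fin n → Fin r → Fin q → ℝ) (c : Fin n → Fin q → ℝ)
    (l : Fin n) (j : Fin q) : HasLeadingForm (affMatrix A c l j) (linMatrix A l j) 1 := by
  refine ⟨isHomogeneous_linMatrix A l j, ?_⟩
  simpa [affMatrix] using (isHomogeneous_C (Fin r) (c l j)).mem_degreeBelow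

theorem hasLeadingForm_vecMul {A : Fin n → Fin r → Fin q → ℝ} (c : Fin n → Fin q → ℝ) {a : ℕ}
    {u v : Fin n → MvPolynomial (Fin r) ℝ} (h : ∀ l, HasLeadingForm (u l) (v l) a) (j : Fin q) :
    HasLeadingForm ((u ᵥ* affMatrix A c) j) ((v ᵥ* linMatrix A) j) (a + 1) :=
  HasLeadingForm.sum _ fun l _ => (h l).mul (hasLeadingForm_affMatrix A c l j)

theorem hasLeadingForm_cramerSyzygy (A : Fin n → Fin r → Fin q → ℝ) (c : Fin n → Fin q → ℝ)
    (J : {J : Finset (Fin n) // J.card = q + 1}) (l : Fin n) :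
    HasLeadingForm ((affMatrix A c).cramerSyzygy J l) ((linMatrix A).cramerSyzygy J l) q := by
  refine HasLeadingForm.sum _ fun i _ => ?_
  split_ifs with h
  · have := HasLeadingForm.C_mul ((-1) ^ (i : ℕ)) (HasLeadingForm.det
      (M := (affMatrix A c).submatrix (J.1.orderEmbOfFin J.2 ∘ i.succAbove) id)
      (N := (linMatrix A).submatrix (J.1.orderEmbOfFin J.2 ∘ i.succAbove) id)
      fun _ _ => hasLeadingForm_affMatrix A c _ _)
    simpa using this
  · exact HasLeadingForm.of_isHomogeneous (isHomogeneous_zero _ _ _)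

end MvPolynomial

theorem LinearIndependent.mem_span_map_of_card_eq_finrank {ι K V W : Type*} [Field K] [Fintype ι]
    [AddCommGroup V] [Module K V] [FiniteDimensional K V] [AddCommGroup W] [Module K W]
    {w : ι → W} (hw : LinearIndependent K w) (f : V →ₗ[K] W) (hf : ∀ i, ∃ v, f v = w i)
    (hcard : Fintype.card ι = Module.finrank K V) (x : V) :
    f x ∈ Submodule.span K (Set.range w) := by
  choose v hv using hf
  obtain rfl : f ∘ v = w := funext hv
  have hx : x ∈ Submodule.span K (Set.range v) := by
    rw [(LinearIndependent.of_comp f hw).span_eq_top_of_card_eq_finrank' hcard]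
    exact Submodule.mem_top
  have := Submodule.mem_map_of_mem (f := f) hx
  rwa [Submodule.map_span, ← Set.range_comp] at this

namespace MvPolynomial

variable {n q k s : ℕ}

/-- Multiplication by a matrix of linear forms on vectors of homogeneous polynomials. -/
noncomputable def linMatrixHom {r : ℕ} (A : Fin n → Fin r → Fin q → ℝ) (a : ℕ) :
    (Fin n → homogeneousSubmodule (Fin r) ℝ a) →ₗ[ℝ]
      (Fin q → homogeneousSubmodule (Fin r) ℝ (a + 1)) where
  toFun v j := ⟨((fun l => (v l : MvPolynomial (Fin r) ℝ)) ᵥ* linMatrix A) j,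
    IsHomogeneous.sum _ _ _ fun l _ => IsHomogeneous.mul (v l).2 (isHomogeneous_linMatrix A l j)⟩
  map_add' v w := by
    ext1 j
    exact Subtype.ext (congrFun (Matrix.add_vecMul (linMatrix A)
      (fun l => (v l : MvPolynomial (Fin r) ℝ)) fun l => (w l : MvPolynomial (Fin r) ℝ)) j)
  map_smul' c v := by
    ext1 j
    exact Subtype.ext (congrFun (Matrix.smul_vecMul c
      (fun l => (v l : MvPolynomial (Fin r) ℝ)) (linMatrix A)) j)

theorem linMatrixHom_eq_iff {r : ℕ} {A : Fin n → Fin r → Fin q → ℝ} {a : ℕ}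
    {v : Fin n → homogeneousSubmodule (Fin r) ℝ a}
    {w : Fin q → homogeneousSubmodule (Fin r) ℝ (a + 1)} :
    linMatrixHom A a v = w ↔
      (fun l => (v l : MvPolynomial (Fin r) ℝ)) ᵥ* linMatrix A = fun j => ↑(w j) := by
  constructor
  · rintro rfl
    rfl
  · intro h
    ext1 j
    exact Subtype.ext (congrFun h j)

section

variable {A : Fin n → Fin (k + 1) → Fin (s + 1) → ℝ} (hn : n = k + 1 + s)
  (hA : Function.Injective (linMatrixHom A s))

include hn hA

theorem linMatrixHom_surjective : Function.Surjective (linMatrixHom A s) := by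
  refine (LinearMap.injective_iff_surjective_of_finrank_eq_finrank ?_).1 hA
  simp only [Module.finrank_pi_fintype, finrank_homogeneousSubmodule, Finset.sum_const,
    Finset.card_univ, Fintype.card_fin, smul_eq_mul]
  subst hn
  have := Nat.add_one_mul_choose_eq (k + s) s
  rw [Nat.choose_symm_add, Nat.choose_symm_add, mul_comm (s + 1), ← add_assoc k s 1, ← this]
  ring

theorem linMatrixHom_succ_surjective : Function.Surjective (linMatrixHom A (s + 1)) := by
  have key : ∀ f ∈ homogeneousSubmodule (Fin (k + 1)) ℝ (s + 1 + 1), ∀ j,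
      ∃ v : Fin n → MvPolynomial (Fin (k + 1)) ℝ, (∀ l, (v l).IsHomogeneous (s + 1)) ∧
        v ᵥ* linMatrix A = Pi.single j f := by
    intro f hf j
    rw [← homogeneousSubmodule_one_pow, pow_succ', homogeneousSubmodule_one_pow] at hf
    refine Submodule.mul_induction_on hf ?_ ?_
    · intro x hx y hy
      obtain ⟨v, hv⟩ := linMatrixHom_surjective hn hA (Pi.single j ⟨y, hy⟩)
      rw [linMatrixHom_eq_iff] at hv
      refine ⟨x • fun l => (v l : MvPolynomial (Fin (k + 1)) ℝ), fun l => ?_, ?_⟩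
      · have := IsHomogeneous.mul hx (v l).2
        rwa [add_comm 1 s] at this
      · rw [Matrix.smul_vecMul, hv]
        ext1 i
        by_cases hi : i = j
        · subst hi; simp
        · simp [hi]
    · rintro x y ⟨v, hv, hv'⟩ ⟨w, hw, hw'⟩
      exact ⟨v + w, fun l => (hv l).add (hw l), by
        rw [Matrix.add_vecMul, hv', hw', Pi.single_add]⟩
  intro w
  choose v hv hv' using fun j => key (w j) (w j).2 j
  refine ⟨∑ j, fun l => ⟨v j l, hv j l⟩, ?_⟩
  rw [map_sum]
  have : ∀ j, linMatrixHom A (s + 1) (fun l => ⟨v j l, hv j l⟩) = Pi.single j (w j) := by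
    intro j
    rw [linMatrixHom_eq_iff]
    refine (hv' j).trans ?_
    ext1 i
    by_cases hi : i = j
    · subst hi; simp
    · simp [hi]
  simp only [this]
  exact Finset.univ_sum_single w

theorem finrank_ker_linMatrixHom :
    Module.finrank ℝ (LinearMap.ker (linMatrixHom A (s + 1))) = n.choose (s + 2) := by
  have h := LinearMap.finrank_range_add_finrank_ker (linMatrixHom A (s + 1))
  rw [LinearMap.range_eq_top.2 (linMatrixHom_succ_surjective hn hA), finrank_top] at h
  simp only [Module.finrank_pi_fintype, finrank_homogeneousSubmodule, Finset.sum_const,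
    Finset.card_univ, Fintype.card_fin, smul_eq_mul] at h
  have h1 : (k + (s + 1)).choose k = n.choose (s + 1) := by
    rw [Nat.choose_symm_add]; congr 1; omega
  have h2 : (k + (s + 1 + 1)).choose k = n.choose (s + 1) + n.choose (s + 2) := by
    rw [Nat.choose_symm_add, ← Nat.choose_succ_succ]; congr 1; omega
  have h3 := Nat.choose_succ_right_eq n (s + 1)
  have h4 : n - (s + 1) = k := by omega
  rw [h4] at h3
  rw [h1, h2] at h
  have h5 : n = k + (s + 1) := by omega
  generalize n.choose (s + 1) = x at *
  generalize n.choose (s + 2) = y at *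
  change y * (s + 1 + 1) = x * k at h3
  have h6 : n * x = (k + (s + 1)) * x := by rw [← h5]
  nlinarith

theorem mem_span_cramerSyzygy
    (hB : LinearIndependent ℝ fun J => (linMatrix A).cramerSyzygy J)
    {v : Fin n → MvPolynomial (Fin (k + 1)) ℝ} (hv : ∀ l, (v l).IsHomogeneous (s + 1))
    (hv0 : v ᵥ* linMatrix A = 0) :
    v ∈ Submodule.span ℝ (Set.range fun J => (linMatrix A).cramerSyzygy J) := by
  let inc : LinearMap.ker (linMatrixHom A (s + 1)) →ₗ[ℝ]
      (Fin n → MvPolynomial (Fin (k + 1)) ℝ) :=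
    (LinearMap.pi fun l => (Submodule.subtype _).comp (LinearMap.proj l)).comp
      (Submodule.subtype _)
  have hmem : ∀ v : Fin n → MvPolynomial (Fin (k + 1)) ℝ, (∀ l, (v l).IsHomogeneous (s + 1)) →
      v ᵥ* linMatrix A = 0 → ∃ w, inc w = v := fun v hv hv0 =>
    ⟨⟨fun l => ⟨v l, hv l⟩, LinearMap.mem_ker.2 (linMatrixHom_eq_iff.2 hv0)⟩, rfl⟩
  have hlead : ∀ J l, ((linMatrix A).cramerSyzygy J l).IsHomogeneous (s + 1) := fun J l =>
    (hasLeadingForm_cramerSyzygy A 0 J l).1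
  have hcard : Fintype.card {J : Finset (Fin n) // J.card = s + 1 + 1} =
      Module.finrank ℝ (LinearMap.ker (linMatrixHom A (s + 1))) := by
    rw [Fintype.card_finset_len, Fintype.card_fin]
    exact (finrank_ker_linMatrixHom hn hA).symm
  obtain ⟨x, rfl⟩ := hmem v hv hv0
  exact hB.mem_span_map_of_card_eq_finrank inc
    (fun J => hmem _ (hlead J) (Matrix.cramerSyzygy_vecMul (linMatrix A) J)) hcard x

end

variable {n k s : ℕ} {A : Fin n → Fin (k + 1) → Fin (s + 1) → ℝ} (c : Fin n → Fin (s + 1) → ℝ)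

section

variable (hA : Function.Injective (linMatrixHom A s))

include hA

theorem mem_degreeBelow_of_vecMul_affMatrix {u : Fin n → MvPolynomial (Fin (k + 1)) ℝ}
    (hu : ∀ l, u l ∈ degreeBelow (k + 1) (s + 1))
    (huM : ∀ j, (u ᵥ* affMatrix A c) j ∈ degreeBelow (k + 1) (s + 1)) (l : Fin n) :
    u l ∈ degreeBelow (k + 1) s := by
  let v : Fin n → homogeneousSubmodule (Fin (k + 1)) ℝ s := fun l =>
    ⟨homogeneousComponent s (u l), homogeneousComponent_isHomogeneous s (u l)⟩
  have hv : linMatrixHom A s v = 0 := by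
    rw [linMatrixHom_eq_iff]
    ext1 j
    exact (hasLeadingForm_vecMul c (fun l => HasLeadingForm.of_mem (hu l)) j).eq_zero (huM j)
  have hv0 : v = 0 := hA (hv.trans (map_zero _).symm)
  rw [mem_degreeBelow_iff_homogeneousComponent (hu l)]
  exact congrArg Subtype.val (congrFun hv0 l)

theorem eq_zero_of_vecMul_affMatrix_eq_zero {u : Fin n → MvPolynomial (Fin (k + 1)) ℝ}
    (hu : ∀ l, u l ∈ degreeBelow (k + 1) (s + 1)) (huM : u ᵥ* affMatrix A c = 0) : u = 0 := by
  have key : ∀ a ≤ s + 1, (∀ l, u l ∈ degreeBelow (k + 1) a) → u = 0 := by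
    intro a
    induction a with
    | zero =>
      intro _ h
      ext1 l
      simpa [degreeBelow_zero] using h l
    | succ a ih =>
      intro ha h
      refine ih (by omega) fun l => ?_
      have hX : (X 0 ^ (s - a) : MvPolynomial (Fin (k + 1)) ℝ).IsHomogeneous (s - a) :=
        isHomogeneous_X_pow 0 _
      have hlead : ∀ l, HasLeadingForm (X 0 ^ (s - a) * u l)
          (X 0 ^ (s - a) * homogeneousComponent a (u l)) s := fun l => by
        have := (HasLeadingForm.of_isHomogeneous hX).mul (HasLeadingForm.of_mem (h l))
        rwa [Nat.sub_add_cancel (by omega)] at this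
      have hmem := mem_degreeBelow_of_vecMul_affMatrix c hA
        (u := (X 0 ^ (s - a) : MvPolynomial (Fin (k + 1)) ℝ) • u) (fun l => (hlead l).mem)
        (fun j => by rw [Matrix.smul_vecMul, huM, smul_zero]; exact Submodule.zero_mem _) l
      have h0 := (hlead l).eq_zero hmem
      rw [mem_degreeBelow_iff_homogeneousComponent (h l)]
      exact (mul_eq_zero.1 h0).resolve_left (pow_ne_zero _ (X_ne_zero 0))
  exact key _ le_rfl hu

theorem exists_sub_vecMul_affMatrix_mem (hn : n = k + 1 + s)
    {m : Fin (s + 1) → MvPolynomial (Fin (k + 1)) ℝ}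
    (hm : ∀ j, m j ∈ degreeBelow (k + 1) (s + 2)) :
    ∃ u : Fin n → MvPolynomial (Fin (k + 1)) ℝ, (∀ l, u l ∈ degreeBelow (k + 1) (s + 1)) ∧
      ∀ j, m j - (u ᵥ* affMatrix A c) j ∈ degreeBelow (k + 1) (s + 1) := by
  obtain ⟨v, hv⟩ := linMatrixHom_surjective hn hA fun j =>
    ⟨homogeneousComponent (s + 1) (m j), homogeneousComponent_isHomogeneous _ _⟩
  rw [linMatrixHom_eq_iff] at hv
  refine ⟨fun l => v l, fun l => IsHomogeneous.mem_degreeBelow (v l).2, fun j => ?_⟩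
  have h1 := (HasLeadingForm.of_mem (hm j)).2
  have h2 := (hasLeadingForm_vecMul (A := A) c
    (fun l => HasLeadingForm.of_isHomogeneous (v l).2) j).2
  rw [hv] at h2
  simpa using Submodule.sub_mem _ h1 h2

theorem exists_vecMul_affMatrix_eq (hn : n = k + 1 + s)
    (hB : LinearIndependent ℝ fun J => (linMatrix A).cramerSyzygy J)
    {u : Fin n → MvPolynomial (Fin (k + 1)) ℝ}
    (hu : ∀ l, u l ∈ degreeBelow (k + 1) (s + 2))
    (huM : ∀ j, (u ᵥ* affMatrix A c) j ∈ degreeBelow (k + 1) (s + 1)) :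
    ∃ u' : Fin n → MvPolynomial (Fin (k + 1)) ℝ, (∀ l, u' l ∈ degreeBelow (k + 1) s) ∧
      u' ᵥ* affMatrix A c = u ᵥ* affMatrix A c := by
  have hv0 : (fun l => homogeneousComponent (s + 1) (u l)) ᵥ* linMatrix A = 0 := by
    ext1 j
    exact (hasLeadingForm_vecMul c (fun l => HasLeadingForm.of_mem (hu l)) j).eq_zero
      (degreeBelow_mono (Nat.le_succ _) (huM j))
  have hspan := mem_span_cramerSyzygy hn hA hB
    (fun l => homogeneousComponent_isHomogeneous (s + 1) (u l)) hv0
  obtain ⟨d, hd⟩ := (Submodule.mem_span_range_iff_exists_fun ℝ).1 hspan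
  have hM : (u - ∑ J, d J • (affMatrix A c).cramerSyzygy J) ᵥ* affMatrix A c =
      u ᵥ* affMatrix A c := by
    rw [Matrix.sub_vecMul, Matrix.sum_vecMul]
    simp [Matrix.smul_vecMul, Matrix.cramerSyzygy_vecMul]
  refine ⟨_, mem_degreeBelow_of_vecMul_affMatrix c hA (fun l => ?_) (fun j => ?_), hM⟩
  · have h1 := (HasLeadingForm.of_mem (hu l)).2
    have h2 : ∑ J, d J • ((affMatrix A c).cramerSyzygy J l - (linMatrix A).cramerSyzygy J l) ∈
        degreeBelow (k + 1) (s + 1) :=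
      Submodule.sum_mem _ fun J _ =>
        Submodule.smul_mem _ _ (hasLeadingForm_cramerSyzygy A c J l).2
    have h3 := congrFun hd l
    simp only [Finset.sum_apply, Pi.smul_apply] at h3
    simp only [smul_sub, Finset.sum_sub_distrib, h3] at h2
    simpa using Submodule.sub_mem _ h1 h2
  · rw [hM]
    exact huM j

end

end MvPolynomial

theorem Submodule.exists_common_eigenfunctional {ι W : Type*} [AddCommGroup W] [Module ℝ W]
    (T : ι → Module.End ℝ W) (hT : ∀ i j, Commute (T i) (T j)) (P N N₁ : Submodule ℝ W)
    [FiniteDimensional ℝ P] (hN₁ : N₁ ≤ N) (hTN₁ : ∀ i, ∀ w ∈ N₁, T i w ∈ N)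
    (hTN : ∀ i, ∀ w ∈ P, w ∈ N → T i w ∈ N)
    (hTP : ∀ i, ∀ w ∈ P, ∃ w' ∈ N₁, T i w - w' ∈ P)
    (hodd : Odd (Module.finrank ℝ (P.map N.mkQ))) :
    ∃ (ψ : Module.Dual ℝ W) (ξ : ι → ℝ), (∀ w ∈ N, ψ w = 0) ∧ (∃ w ∈ P, ψ w ≠ 0) ∧
      ∀ i, ∀ w ∈ P, ψ (T i w) = ξ i * ψ w := by
  obtain ⟨σ, hσ⟩ := (N.mkQ.submoduleMap P).exists_rightInverse_of_surjective
    (LinearMap.range_eq_top.2 (N.mkQ.submoduleMap_surjective P))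
  have hσ' : ∀ v : P.map N.mkQ, N.mkQ (σ v) = v := fun v =>
    congrArg Subtype.val (LinearMap.congr_fun hσ v)
  have hmem : ∀ i, ∀ w ∈ P, N.mkQ (T i w) ∈ P.map N.mkQ := by
    intro i w hw
    obtain ⟨w', hw', h⟩ := hTP i w hw
    refine ⟨_, h, ?_⟩
    have : N.mkQ w' = 0 := (Submodule.Quotient.mk_eq_zero N).2 (hN₁ hw')
    rw [map_sub, this, sub_zero]
  let S : ι → Module.End ℝ (P.map N.mkQ) := fun i =>
    LinearMap.codRestrict _ (N.mkQ ∘ₗ T i ∘ₗ P.subtype ∘ₗ σ) fun v => hmem i _ (σ v).2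
  have hSv : ∀ i (w : W) (hw : w ∈ P) (v : P.map N.mkQ), (v : W ⧸ N) = N.mkQ w →
      ((S i v : P.map N.mkQ) : W ⧸ N) = N.mkQ (T i w) := by
    intro i w hw v hv
    change N.mkQ (T i (σ v)) = _
    rw [← sub_eq_zero, ← map_sub, ← map_sub]
    refine (Submodule.Quotient.mk_eq_zero N).2 (hTN i _ (P.sub_mem (σ v).2 hw) ?_)
    refine (Submodule.Quotient.mk_eq_zero N).1 ?_
    rw [← Submodule.mkQ_apply, map_sub, hσ', hv, sub_self]
  have hSS : ∀ i j v, ((S i (S j v) : P.map N.mkQ) : W ⧸ N) = N.mkQ (T i (T j (σ v))) := by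
    intro i j v
    obtain ⟨w', hw', h⟩ := hTP j (σ v) (σ v).2
    have h0 : N.mkQ w' = 0 := (Submodule.Quotient.mk_eq_zero N).2 (hN₁ hw')
    have h1 : N.mkQ (T i w') = 0 := (Submodule.Quotient.mk_eq_zero N).2 (hTN₁ i w' hw')
    rw [hSv i _ h, map_sub, map_sub, h1, sub_zero]
    rw [map_sub, h0, sub_zero]
    exact hSv j _ (σ v).2 v (hσ' v).symm
  have hcomm : ∀ i j, Commute (S i) (S j) := fun i j => by
    ext v
    rw [Module.End.mul_apply, Module.End.mul_apply, hSS, hSS, ← Module.End.mul_apply,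
      (hT i j).eq, Module.End.mul_apply]
  obtain ⟨φ, hφ0, hφ⟩ := Module.End.exists_common_eigenvector_of_odd_finrank
    (fun i => (S i).dualMap) (fun i j => by
      ext f v
      exact congrArg f (LinearMap.congr_fun (hcomm j i).eq v))
    (by rwa [Subspace.dual_finrank_eq])
  choose ξ hξ using hφ
  obtain ⟨ψ, hψ⟩ := LinearMap.exists_extend φ
  have hψ' : ∀ v : P.map N.mkQ, ψ v = φ v := fun v => LinearMap.congr_fun hψ v
  refine ⟨ψ ∘ₗ N.mkQ, ξ, fun w hw => ?_, ?_, fun i w hw => ?_⟩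
  · rw [LinearMap.comp_apply, show N.mkQ w = 0 from (Submodule.Quotient.mk_eq_zero N).2 hw,
      map_zero]
  · by_contra! h
    refine hφ0 (LinearMap.ext fun v => ?_)
    rw [← hψ', ← hσ' v]
    exact h _ (σ v).2
  · have h1 := hSv i w hw ⟨N.mkQ w, Submodule.mem_map_of_mem hw⟩ rfl
    have h2 := LinearMap.congr_fun (hξ i) ⟨N.mkQ w, Submodule.mem_map_of_mem hw⟩
    rw [LinearMap.dualMap_apply, ← hψ', h1] at h2
    rw [LinearMap.comp_apply, h2, LinearMap.smul_apply, ← hψ', smul_eq_mul, LinearMap.comp_apply]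

namespace MvPolynomial

/-- Families of polynomials all of whose monomials have degree less than `a`. -/
noncomputable def degreeBelowPi (ι : Type*) (r a : ℕ) : Submodule ℝ (ι → MvPolynomial (Fin r) ℝ) :=
  LinearMap.range ((degreeBelow r a).subtype.compLeft ι)

theorem mem_degreeBelowPi {ι : Type*} {r a : ℕ} {u : ι → MvPolynomial (Fin r) ℝ} :
    u ∈ degreeBelowPi ι r a ↔ ∀ l, u l ∈ degreeBelow r a := by
  refine ⟨?_, fun h => ⟨fun l => ⟨u l, h l⟩, rfl⟩⟩
  rintro ⟨v, rfl⟩ l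
  exact (v l).2

instance {ι : Type*} [Finite ι] {r a : ℕ} : FiniteDimensional ℝ (degreeBelowPi ι r a) := by
  unfold degreeBelowPi
  infer_instance

theorem finrank_degreeBelowPi (ι : Type*) [Fintype ι] (k a : ℕ) :
    Module.finrank ℝ (degreeBelowPi ι (k + 1) a) = Fintype.card ι * (k + a).choose (k + 1) := by
  rw [degreeBelowPi, LinearMap.finrank_range_of_inj, Module.finrank_pi_fintype]
  · simp [finrank_degreeBelow]
  · intro u v h
    ext1 l
    exact Subtype.ext (congrFun h l)

variable {n k s : ℕ} {A : Fin n → Fin (k + 1) → Fin (s + 1) → ℝ} (c : Fin n → Fin (s + 1) → ℝ)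

theorem X_mul_mem_degreeBelow {r a : ℕ} (i : Fin r) {f : MvPolynomial (Fin r) ℝ}
    (hf : f ∈ degreeBelow r a) : X i * f ∈ degreeBelow r (a + 1) := by
  rw [mul_comm]
  exact mul_mem_degreeBelow hf (isHomogeneous_X ℝ i).mem_degreeBelow

theorem linearMap_eq_zero_of_X_mul {r a : ℕ} (ψ : MvPolynomial (Fin r) ℝ →ₗ[ℝ] ℝ) (ξ : Fin r → ℝ)
    (hψ : ∀ i, ∀ f ∈ degreeBelow r a, ψ (X i * f) = ξ i * ψ f) (h1 : ψ 1 = 0) :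
    ∀ f ∈ degreeBelow r a, ψ f = 0 := by
  have hmon : ∀ b, ∀ m : Fin r →₀ ℕ, m.degree = b → b < a → ψ (monomial m 1) = 0 := by
    intro b
    induction b with
    | zero =>
      intro m hm _
      rw [Finsupp.degree_eq_zero_iff] at hm
      subst hm
      exact h1
    | succ b ih =>
      intro m hm hb
      obtain ⟨i, hi⟩ : ∃ i, m i ≠ 0 := by
        by_contra! h
        have : m = 0 := Finsupp.ext h
        simp [this] at hm
      obtain ⟨m', rfl⟩ : ∃ m', m = Finsupp.single i 1 + m' :=
        ⟨m - Finsupp.single i 1,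
          (add_tsub_cancel_of_le (by simpa using Nat.one_le_iff_ne_zero.2 hi)).symm⟩
      have hm' : m'.degree = b := by
        rw [map_add, Finsupp.degree_single] at hm
        omega
      have hmem : monomial m' (1 : ℝ) ∈ degreeBelow r a :=
        degreeBelow_mono (by omega) (isHomogeneous_monomial (1 : ℝ) hm').mem_degreeBelow
      have := hψ i _ hmem
      rw [ih m' hm' (by omega), mul_zero, X, monomial_mul, one_mul] at this
      exact this
  intro f hf
  rw [f.as_sum, map_sum]
  refine Finset.sum_eq_zero fun m hm => ?_
  rw [← mul_one (coeff m f), ← smul_eq_mul, ← smul_monomial, map_smul,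
    hmon _ m rfl (mem_degreeBelow.1 hf m (mem_support_iff.1 hm)), smul_zero]

variable (hA : Function.Injective (linMatrixHom A s)) (hn : n = k + 1 + s)
    (hB : LinearIndependent ℝ fun J => (linMatrix A).cramerSyzygy J)

theorem succ_mul_choose_eq_choose_add_mul_choose (k s : ℕ) :
    (s + 1) * (k + (s + 1)).choose (k + 1) =
      (k + 1 + s).choose (k + 1) + (k + 1 + s) * (k + s).choose (k + 1) := by
  have h := Nat.choose_mul_succ_eq (k + s) (k + 1)
  have e1 : k + s + 1 - (k + 1) = s := by omega
  rw [e1] at h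
  rw [show k + (s + 1) = k + s + 1 by omega, show k + 1 + s = k + s + 1 by omega, add_mul,
    mul_comm (k + s + 1), h]
  ring

include hA hn hB

theorem finrank_cokernel :
    Module.finrank ℝ ((degreeBelowPi (Fin (s + 1)) (k + 1) (s + 1)).map
      ((degreeBelowPi (Fin n) (k + 1) (s + 2)).map
        ((affMatrix A c).vecMulLinear.restrictScalars ℝ)).mkQ) = n.choose (k + 1) := by
  set P := degreeBelowPi (Fin (s + 1)) (k + 1) (s + 1)
  set Φ := (affMatrix A c).vecMulLinear.restrictScalars ℝ
  set N := (degreeBelowPi (Fin n) (k + 1) (s + 2)).map Φ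
  have hPN : P ⊓ N = (degreeBelowPi (Fin n) (k + 1) s).map Φ := by
    ext w
    constructor
    · rintro ⟨hw, u, hu, rfl⟩
      obtain ⟨u', hu', h⟩ := exists_vecMul_affMatrix_eq c hA hn hB (mem_degreeBelowPi.1 hu)
        (mem_degreeBelowPi.1 hw)
      exact ⟨u', mem_degreeBelowPi.2 hu', h⟩
    · rintro ⟨u, hu, rfl⟩
      have hu := mem_degreeBelowPi.1 hu
      refine ⟨mem_degreeBelowPi.2 fun j => Submodule.sum_mem _ fun l _ =>
        mul_mem_degreeBelow (b := 1) ?_ ?_,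
        u, mem_degreeBelowPi.2 fun l => degreeBelow_mono (by omega) (hu l), rfl⟩
      · exact hu l
      · exact (hasLeadingForm_affMatrix A c l j).mem
  have h1 := LinearMap.finrank_range_add_finrank_ker (N.mkQ.domRestrict P)
  have hker : Module.finrank ℝ (LinearMap.ker (N.mkQ.domRestrict P)) =
      Module.finrank ℝ (degreeBelowPi (Fin n) (k + 1) s) := by
    rw [LinearMap.ker_domRestrict, Submodule.ker_mkQ, (Submodule.equivMapOfInjective P.subtype
      P.subtype_injective (N.comap P.subtype)).finrank_eq,
      Submodule.map_comap_subtype, hPN, ← LinearMap.range_domRestrict,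
      LinearMap.finrank_range_of_inj]
    rw [injective_iff_map_eq_zero]
    rintro ⟨u, hu⟩ h
    exact Subtype.ext (eq_zero_of_vecMul_affMatrix_eq_zero c hA
      (fun l => degreeBelow_mono (by omega) (mem_degreeBelowPi.1 hu l)) h)
  rw [LinearMap.range_domRestrict, hker, finrank_degreeBelowPi, finrank_degreeBelowPi,
    Fintype.card_fin, Fintype.card_fin, succ_mul_choose_eq_choose_add_mul_choose, ← hn] at h1
  omega

theorem exists_zero_affMatrix (hodd : Odd (n.choose (k + 1))) :
    ∃ (ξ : Fin (k + 1) → ℝ) (η : Fin (s + 1) → ℝ), η ≠ 0 ∧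
      ∀ l, ∑ j, (∑ i, A l i j * ξ i + c l j) * η j = 0 := by
  rw [← finrank_cokernel c hA hn hB] at hodd
  set P := degreeBelowPi (Fin (s + 1)) (k + 1) (s + 1) with hP
  set Φ := (affMatrix A c).vecMulLinear.restrictScalars ℝ
  set N := (degreeBelowPi (Fin n) (k + 1) (s + 2)).map Φ
  have hlsmul : ∀ (i : Fin (k + 1)) (w : Fin (s + 1) → MvPolynomial (Fin (k + 1)) ℝ),
      Algebra.lsmul ℝ ℝ _ (X i : MvPolynomial (Fin (k + 1)) ℝ) w = fun j => X i * w j :=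
    fun _ _ => rfl
  have hΦX : ∀ i (u : Fin n → MvPolynomial (Fin (k + 1)) ℝ),
      Φ (fun l => X i * u l) = fun j => X i * Φ u j := fun i u => by
    ext1 j
    simp only [Φ, LinearMap.restrictScalars_apply, vecMulLinear_apply, vecMul, dotProduct,
      Finset.mul_sum, mul_assoc]
  obtain ⟨ψ, ξ, hψN, ⟨w, hw, hψw⟩, hψ⟩ := Submodule.exists_common_eigenfunctional
    (fun i : Fin (k + 1) => Algebra.lsmul ℝ ℝ (Fin (s + 1) → MvPolynomial (Fin (k + 1)) ℝ)
      (X i : MvPolynomial (Fin (k + 1)) ℝ))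
    (fun i j => (Commute.all (X i) (X j)).map (Algebra.lsmul ℝ ℝ _)) P N
    ((degreeBelowPi (Fin n) (k + 1) (s + 1)).map Φ)
    (Submodule.map_mono fun u hu => mem_degreeBelowPi.2 fun l =>
      degreeBelow_mono (by omega) (mem_degreeBelowPi.1 hu l)) (by
      rintro i _ ⟨u, hu, rfl⟩
      exact ⟨fun l => X i * u l, mem_degreeBelowPi.2 fun l =>
        X_mul_mem_degreeBelow i (mem_degreeBelowPi.1 hu l), hΦX i u⟩) (by
      rintro i _ hw ⟨u, hu, rfl⟩
      obtain ⟨u', hu', h⟩ := exists_vecMul_affMatrix_eq c hA hn hB (mem_degreeBelowPi.1 hu)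
        (mem_degreeBelowPi.1 hw)
      refine ⟨fun l => X i * u' l, mem_degreeBelowPi.2 fun l =>
        degreeBelow_mono (by omega) (X_mul_mem_degreeBelow i (hu' l)), (hΦX i u').trans ?_⟩
      rw [hlsmul, show Φ u' = Φ u from h]) (by
      rintro i w hw
      obtain ⟨u, hu, h⟩ := exists_sub_vecMul_affMatrix_mem c hA hn (m := fun j => X i * w j)
        fun j => X_mul_mem_degreeBelow i (mem_degreeBelowPi.1 hw j)
      exact ⟨Φ u, ⟨u, mem_degreeBelowPi.2 hu, rfl⟩, mem_degreeBelowPi.2 h⟩) hodd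
  have hsum : ∀ w, ψ w = ∑ j, ψ (Pi.single j (w j)) := fun w => by
    rw [← map_sum, Finset.univ_sum_single]
  have hX : ∀ i j, ∀ f ∈ degreeBelow (k + 1) (s + 1),
      ψ (Pi.single j (X i * f)) = ξ i * ψ (Pi.single j f) := fun i j f hf => by
    have hmem : Pi.single j f ∈ P := mem_degreeBelowPi.2 fun j' => by
      rcases eq_or_ne j' j with rfl | h
      · simpa using hf
      · simp [h]
    rw [← hψ i _ hmem, hlsmul]
    congr 1
    ext1 j'
    rcases eq_or_ne j' j with rfl | h
    · simp
    · simp [h]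
  refine ⟨ξ, fun j => ψ (Pi.single j 1), fun h0 => hψw ?_, fun l => ?_⟩
  · rw [hsum]
    exact Finset.sum_eq_zero fun j _ => linearMap_eq_zero_of_X_mul
      (ψ ∘ₗ LinearMap.single ℝ (fun _ => MvPolynomial (Fin (k + 1)) ℝ) j) ξ (fun i => hX i j)
      (congrFun h0 j) _ (mem_degreeBelowPi.1 hw j)
  · have hC : ∀ j a, ψ (Pi.single j (C a)) = a * ψ (Pi.single j 1) := fun j a => by
      rw [← smul_eq_mul a, ← map_smul, ← Pi.single_smul, smul_eq_C_mul, mul_one]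
    have hCX : ∀ i j a, ψ (Pi.single j (C a * X i)) = a * ξ i * ψ (Pi.single j 1) :=
      fun i j a => by
        rw [mul_comm, hX i j _ (degreeBelow_mono (by omega)
          (isHomogeneous_C (Fin (k + 1)) a).mem_degreeBelow), hC]
        ring
    have hrow := hψN (Φ (Pi.single l 1)) ⟨_, mem_degreeBelowPi.2 fun l' => by
      rcases eq_or_ne l' l with rfl | h
      · simpa using degreeBelow_mono (by omega)
          (isHomogeneous_one (Fin (k + 1)) ℝ).mem_degreeBelow
      · simp [h], rfl⟩
    have hΦl : Φ (Pi.single l 1) = affMatrix A c l := Matrix.single_one_vecMul l _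
    rw [hΦl, hsum] at hrow
    rw [← hrow]
    refine Finset.sum_congr rfl fun j _ => ?_
    rw [affMatrix, Matrix.of_apply, linMatrix, Matrix.of_apply, Pi.single_add, map_add, hC,
      add_mul, Finset.sum_mul]
    congr 1
    rw [← LinearMap.single_apply (R := ℝ), ← LinearMap.comp_apply, map_sum]
    exact Finset.sum_congr rfl fun i _ => (hCX i j _).symm

end MvPolynomial

theorem linearIndependent_of_det_ne_zero {ι K V : Type*} [Field K] [AddCommGroup V] [Module K V]
    [Fintype ι] [DecidableEq ι] (g : ι → V) (e : ι → Module.Dual K V)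
    (h : (Matrix.of fun i j => e i (g j)).det ≠ 0) : LinearIndependent K g := by
  rw [Fintype.linearIndependent_iff]
  intro d hd
  refine congrFun (Matrix.eq_zero_of_mulVec_eq_zero h (v := d) ?_)
  ext i
  have := congrArg (e i) hd
  simpa [mulVec, dotProduct, mul_comm] using this

theorem eq_zero_of_dual_family {ι K V : Type*} [Field K] [AddCommGroup V] [Module K V]
    [FiniteDimensional K V] [Fintype ι] (g : ι → V) (e : ι → Module.Dual K V)
    (hne : ∀ i j, i ≠ j → e i (g j) = 0) (heq : ∀ i, e i (g i) ≠ 0)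
    (hcard : Fintype.card ι = Module.finrank K V) {f : V} (hf : ∀ i, e i f = 0) : f = 0 := by
  classical
  have hdiag : (Matrix.of fun i j => e i (g j)) = Matrix.diagonal fun i => e i (g i) := by
    ext i j
    rcases eq_or_ne i j with rfl | h
    · simp
    · simp [h, hne i j h]
  have hli : LinearIndependent K g := linearIndependent_of_det_ne_zero g e (by
    rw [hdiag, Matrix.det_diagonal]
    exact Finset.prod_ne_zero_iff.2 fun i _ => heq i)
  have htop := hli.span_eq_top_of_card_eq_finrank' hcard
  obtain ⟨d, rfl⟩ := (Submodule.mem_span_range_iff_exists_fun K).1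
    (htop ▸ Submodule.mem_top : f ∈ Submodule.span K (Set.range g))
  refine Finset.sum_eq_zero fun i _ => ?_
  have := hf i
  rw [map_sum, Finset.sum_eq_single i (fun j _ hj => by rw [map_smul, hne i j hj.symm, smul_zero])
    (by simp), map_smul, smul_eq_mul] at this
  rw [(mul_eq_zero.1 this).resolve_right (heq i), zero_smul]

open Polynomial in
theorem eq_zero_of_sum_mul_pow_eq_zero {ι : Type*} [Fintype ι] {t : ι → ℝ}
    (ht : Function.Injective t) {q : ℕ} (I : Finset ι) (hI : I.card ≤ q) {w : ι → ℝ}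
    (hw : ∀ l ∉ I, w l = 0) (h : ∀ j < q, ∑ l, w l * t l ^ j = 0) : w = 0 := by
  classical
  have hpoly : ∀ f : ℝ[X], f.natDegree < q → ∑ l, w l * f.eval (t l) = 0 := by
    intro f hf
    simp_rw [Polynomial.eval_eq_sum_range' hf, Finset.mul_sum]
    rw [Finset.sum_comm]
    refine Finset.sum_eq_zero fun j hj => ?_
    rw [← mul_zero (f.coeff j), ← h j (Finset.mem_range.1 hj), Finset.mul_sum]
    exact Finset.sum_congr rfl fun l _ => by ring
  ext l
  by_cases hl : l ∈ I
  swap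
  · exact hw l hl
  have hdeg : (∏ m ∈ I.erase l, (X - C (t m))).natDegree < q := by
    rw [Polynomial.natDegree_prod_of_monic _ _ fun m _ => monic_X_sub_C (t m)]
    have := Finset.card_erase_of_mem hl
    have := Finset.card_pos.2 ⟨l, hl⟩
    simp only [natDegree_X_sub_C, Finset.sum_const, smul_eq_mul, mul_one]
    omega
  have := hpoly _ hdeg
  rw [Finset.sum_eq_single l] at this
  · refine (mul_eq_zero.1 this).resolve_right ?_
    rw [Polynomial.eval_prod]
    refine Finset.prod_ne_zero_iff.2 fun m hm => ?_
    simpa [sub_eq_zero] using fun h => (Finset.ne_of_mem_erase hm) (ht h).symm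
  · intro m _ hm
    by_cases hmI : m ∈ I
    · rw [Polynomial.eval_prod, Finset.prod_eq_zero (Finset.mem_erase.2 ⟨hm, hmI⟩) (by simp),
        mul_zero]
    · rw [hw m hmI, zero_mul]
  · simp

/-- The coefficients of the monic polynomial with roots `t l` for `l ∉ I`. -/
noncomputable def vanishingPoint {n : ℕ} (t : Fin n → ℝ) (r : ℕ) (I : Finset (Fin n)) :
    Fin r → ℝ := fun i => (∏ l ∈ Iᶜ, (Polynomial.X - Polynomial.C (t l))).coeff i

theorem sum_pow_mul_vanishingPoint {n k : ℕ} (t : Fin n → ℝ) {I : Finset (Fin n)}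
    (hI : n ≤ k + I.card) (l : Fin n) :
    ∑ i : Fin (k + 1), t l ^ (i : ℕ) * vanishingPoint t (k + 1) I i = ∏ m ∈ Iᶜ, (t l - t m) := by
  have hdeg : (∏ m ∈ Iᶜ, (Polynomial.X - Polynomial.C (t m))).natDegree < k + 1 := by
    rw [Polynomial.natDegree_prod_of_monic _ _ fun m _ => Polynomial.monic_X_sub_C (t m)]
    simp only [Polynomial.natDegree_X_sub_C, Finset.sum_const, smul_eq_mul, mul_one,
      Finset.card_compl, Fintype.card_fin]
    omega
  have := Polynomial.eval_eq_sum_range' hdeg (t l)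
  rw [Polynomial.eval_prod] at this
  simp only [Polynomial.eval_sub, Polynomial.eval_X, Polynomial.eval_C] at this
  rw [this, Finset.sum_range]
  exact Finset.sum_congr rfl fun i _ => mul_comm _ _

theorem sum_pow_mul_vanishingPoint_eq_zero_iff {n k : ℕ} {t : Fin n → ℝ}
    (ht : Function.Injective t) {I : Finset (Fin n)} (hI : n ≤ k + I.card) (l : Fin n) :
    ∑ i : Fin (k + 1), t l ^ (i : ℕ) * vanishingPoint t (k + 1) I i = 0 ↔ l ∉ I := by
  rw [sum_pow_mul_vanishingPoint t hI, Finset.prod_eq_zero_iff]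
  constructor
  · rintro ⟨m, hm, h⟩
    rw [ht (sub_eq_zero.1 h)]
    simpa using hm
  · exact fun h => ⟨l, by simpa using h, sub_self _⟩

namespace MvPolynomial

/-- The coefficients of the bilinear forms `(∑ t ^ i x_i) (∑ t ^ j y_j)`. -/
def momentCoeff {n : ℕ} (t : Fin n → ℝ) (r q : ℕ) : Fin n → Fin r → Fin q → ℝ :=
  fun l i j => t l ^ (i : ℕ) * t l ^ (j : ℕ)

theorem eval_linMatrix_momentCoeff {n r q : ℕ} (t : Fin n → ℝ) (x : Fin r → ℝ) (l : Fin n)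
    (j : Fin q) : eval x (linMatrix (momentCoeff t r q) l j) =
      (∑ i : Fin r, t l ^ (i : ℕ) * x i) * t l ^ (j : ℕ) := by
  simp only [linMatrix, momentCoeff, Matrix.of_apply, map_sum, map_mul, eval_C, eval_X,
    Finset.sum_mul]
  exact Finset.sum_congr rfl fun i _ => by ring

variable {n k s : ℕ} {t : Fin n → ℝ} (hn : n = k + 1 + s) (ht : Function.Injective t)

include hn ht

theorem eq_zero_of_eval_vanishingPoint (l : Fin n) {f : MvPolynomial (Fin (k + 1)) ℝ}
    (hf : f.IsHomogeneous s) (h : ∀ I : Finset (Fin n), l ∈ I → I.card = s + 1 →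
      eval (vanishingPoint t (k + 1) I) f = 0) : f = 0 := by
  let ι := {I : Finset (Fin n) // I ∈ (Finset.univ.erase l).powersetCard s}
  have hι : ∀ I : ι, l ∉ I.1 ∧ I.1.card = s := fun I => by
    obtain ⟨h1, h2⟩ := Finset.mem_powersetCard.1 I.2
    exact ⟨fun h => by simpa using h1 h, h2⟩
  have hcard : ∀ I : ι, (insert l I.1).card = s + 1 := fun I => by
    rw [Finset.card_insert_of_notMem (hι I).1, (hι I).2]
  let a : Fin n → MvPolynomial (Fin (k + 1)) ℝ := fun m =>
    ∑ i : Fin (k + 1), C (t m ^ (i : ℕ)) * X i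
  have ha : ∀ m x, eval x (a m) = ∑ i : Fin (k + 1), t m ^ (i : ℕ) * x i := fun m x => by
    simp [a]
  have ha1 : ∀ m, (a m).IsHomogeneous 1 := fun m =>
    IsHomogeneous.sum _ _ _ fun i _ => isHomogeneous_C_mul_X _ i
  let g : ι → homogeneousSubmodule (Fin (k + 1)) ℝ s := fun I => ⟨∏ m ∈ I.1, a m, by
    have := IsHomogeneous.prod I.1 a (fun _ => 1) fun m _ => ha1 m
    rw [Finset.sum_const, smul_eq_mul, mul_one, (hι I).2] at this
    exact this⟩
  let e : ι → Module.Dual ℝ (homogeneousSubmodule (Fin (k + 1)) ℝ s) := fun I =>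
    (aeval (vanishingPoint t (k + 1) (insert l I.1))).toLinearMap ∘ₗ Submodule.subtype _
  have he : ∀ (I : ι) p, e I p = eval (vanishingPoint t (k + 1) (insert l I.1)) p.1 := fun I p => by
    rw [← aeval_eq_eval]; rfl
  have heg : ∀ I J : ι, e I (g J) = 0 ↔ ∃ m ∈ J.1, m ∉ insert l I.1 := fun I J => by
    rw [he, map_prod, Finset.prod_eq_zero_iff]
    refine exists_congr fun m => and_congr_right fun _ => ?_
    rw [ha, sum_pow_mul_vanishingPoint_eq_zero_iff ht]
    rw [hcard, hn]
    omega
  have := eq_zero_of_dual_family g e (fun I J hIJ => ?_) (fun I hI => ?_) ?_ (f := ⟨f, hf⟩)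
    fun I => by
      rw [he]
      exact h _ (Finset.mem_insert_self _ _) (hcard I)
  · exact congrArg Subtype.val this
  · rw [heg]
    by_contra! hsub
    refine hIJ (Subtype.ext (Finset.eq_of_subset_of_card_le (fun m hm => ?_) ?_).symm)
    · refine (Finset.mem_insert.1 (hsub m hm)).resolve_left ?_
      rintro rfl
      exact (hι J).1 hm
    · rw [(hι I).2, (hι J).2]
  · rw [heg] at hI
    obtain ⟨m, hm, hm'⟩ := hI
    exact hm' (Finset.mem_insert_of_mem hm)
  · rw [finrank_homogeneousSubmodule, Fintype.card_coe, Finset.card_powersetCard,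
      Finset.card_erase_of_mem (Finset.mem_univ _), Finset.card_univ, Fintype.card_fin, hn,
      show k + 1 + s - 1 = k + s by omega, Nat.choose_symm_add]

theorem linMatrixHom_momentCoeff_injective :
    Function.Injective (linMatrixHom (momentCoeff t (k + 1) (s + 1)) s) := by
  rw [injective_iff_map_eq_zero]
  intro v hv
  have hv' := linMatrixHom_eq_iff.1 hv
  ext1 l
  refine Subtype.ext (eq_zero_of_eval_vanishingPoint hn ht l (v l).2 fun I hl hI => ?_)
  have hI' : n ≤ k + I.card := by omega
  have h0 := eq_zero_of_sum_mul_pow_eq_zero ht I hI.le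
    (w := fun l => eval (vanishingPoint t (k + 1) I) (v l).1 *
      ∑ i : Fin (k + 1), t l ^ (i : ℕ) * vanishingPoint t (k + 1) I i)
    (fun l hl => by rw [(sum_pow_mul_vanishingPoint_eq_zero_iff ht hI' l).2 hl, mul_zero])
    (fun j hj => by
      have := congrArg (eval (vanishingPoint t (k + 1) I)) (congrFun hv' ⟨j, hj⟩)
      simp only [vecMul, dotProduct, map_sum, map_mul, eval_linMatrix_momentCoeff] at this
      simpa [mul_assoc] using this)
  exact (mul_eq_zero.1 (congrFun h0 l)).resolve_right
    fun h => (sum_pow_mul_vanishingPoint_eq_zero_iff ht hI' l).1 h hl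

end MvPolynomial

namespace Matrix

variable {S : Type*} [CommRing S] {n q : ℕ}

theorem map_cramerSyzygy {S' : Type*} [CommRing S'] (φ : S →+* S') (M : Matrix (Fin n) (Fin q) S)
    (J : {J : Finset (Fin n) // J.card = q + 1}) (l : Fin n) :
    φ (M.cramerSyzygy J l) = (M.map φ).cramerSyzygy J l := by
  simp only [cramerSyzygy, map_sum, apply_ite φ, map_mul, map_pow, map_neg, map_one, map_zero,
    RingHom.map_det, RingHom.mapMatrix_apply, submatrix_map]

theorem cramerSyzygy_orderEmbOfFin (M : Matrix (Fin n) (Fin q) S)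
    (J : {J : Finset (Fin n) // J.card = q + 1}) (i : Fin (q + 1)) :
    M.cramerSyzygy J (J.1.orderEmbOfFin J.2 i) =
      (-1) ^ (i : ℕ) * (M.submatrix (J.1.orderEmbOfFin J.2 ∘ i.succAbove) id).det := by
  simp [cramerSyzygy]

theorem subset_insert_of_cramerSyzygy_ne_zero {M : Matrix (Fin n) (Fin q) S}
    {J : {J : Finset (Fin n) // J.card = q + 1}} {l : Fin n} {I : Finset (Fin n)}
    (hI : ∀ m ∉ I, M m = 0) (h : M.cramerSyzygy J l ≠ 0) : J.1 ⊆ insert l I := by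
  obtain ⟨i, -, hi⟩ := Finset.exists_ne_zero_of_sum_ne_zero h
  rw [ite_ne_right_iff] at hi
  obtain ⟨rfl, hi⟩ := hi
  intro m hm
  obtain ⟨i', rfl⟩ : m ∈ Set.range (J.1.orderEmbOfFin J.2) := by
    rw [Finset.range_orderEmbOfFin]
    exact hm
  rcases eq_or_ne i' i with rfl | hne
  · exact Finset.mem_insert_self _ _
  obtain ⟨c, rfl⟩ := Fin.exists_succAbove_eq hne
  by_contra hm'
  refine hi ?_
  rw [Matrix.det_eq_zero_of_row_eq_zero c, mul_zero]
  intro j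
  exact congrFun (hI _ fun h => hm' (Finset.mem_insert_of_mem h)) j

end Matrix

namespace MvPolynomial

theorem linMatrix_map_eval {S : Type*} [CommRing S] {n r q : ℕ} (A : Fin n → Fin r → Fin q → S)
    (x : Fin r → S) :
    (linMatrix A).map (eval x) = Matrix.of fun l j => ∑ i, A l i j * x i := by
  ext l j
  simp [linMatrix]

theorem det_cramerSyzygy_momentCoeff_ne_zero {n k q : ℕ} {t : Fin n → ℝ} (hn : n = k + q)
    (ht : Function.Injective t) :
    (Matrix.of fun J J' : {J : Finset (Fin n) // J.card = q + 1} =>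
      eval (vanishingPoint t (k + 1) (J.1.erase (J.1.orderEmbOfFin J.2 0)))
        ((linMatrix (momentCoeff t (k + 1) q)).cramerSyzygy J'
          (J.1.orderEmbOfFin J.2 0))).det ≠ 0 := by
  have hmem : ∀ (J : {J : Finset (Fin n) // J.card = q + 1}) i, J.1.orderEmbOfFin J.2 i ∈ J.1 :=
    fun J i => Finset.orderEmbOfFin_mem _ _ _
  have hcard : ∀ J : {J : Finset (Fin n) // J.card = q + 1},
      n ≤ k + (J.1.erase (J.1.orderEmbOfFin J.2 0)).card := fun J => by
    rw [Finset.card_erase_of_mem (hmem J 0), J.2]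
    omega
  rw [show (Matrix.of fun J J' : {J : Finset (Fin n) // J.card = q + 1} =>
      eval (vanishingPoint t (k + 1) (J.1.erase (J.1.orderEmbOfFin J.2 0)))
        ((linMatrix (momentCoeff t (k + 1) q)).cramerSyzygy J' (J.1.orderEmbOfFin J.2 0))) =
      Matrix.diagonal fun J => eval (vanishingPoint t (k + 1) (J.1.erase
        (J.1.orderEmbOfFin J.2 0))) ((linMatrix (momentCoeff t (k + 1) q)).cramerSyzygy J
          (J.1.orderEmbOfFin J.2 0)) from ?_, Matrix.det_diagonal]
  · refine Finset.prod_ne_zero_iff.2 fun J _ => ?_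
    rw [Matrix.cramerSyzygy_orderEmbOfFin, map_mul, RingHom.map_det]
    refine mul_ne_zero (by simp) ?_
    rw [show (eval (vanishingPoint t (k + 1) (J.1.erase (J.1.orderEmbOfFin J.2 0)))).mapMatrix
        ((linMatrix (momentCoeff t (k + 1) q)).submatrix
          (J.1.orderEmbOfFin J.2 ∘ (0 : Fin (q + 1)).succAbove) id) =
        Matrix.diagonal (fun c => ∑ i : Fin (k + 1), t (J.1.orderEmbOfFin J.2 c.succ) ^ (i : ℕ) *
          vanishingPoint t (k + 1) (J.1.erase (J.1.orderEmbOfFin J.2 0)) i) *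
        Matrix.vandermonde fun c => t (J.1.orderEmbOfFin J.2 c.succ) by
      ext c j
      simp [Matrix.diagonal_mul, eval_linMatrix_momentCoeff, Matrix.vandermonde_apply],
      Matrix.det_mul, Matrix.det_diagonal]
    refine mul_ne_zero (Finset.prod_ne_zero_iff.2 fun c _ => ?_)
      (Matrix.det_vandermonde_ne_zero_iff.2 fun c c' h => ?_)
    · rw [Ne, sum_pow_mul_vanishingPoint_eq_zero_iff ht (hcard J), not_not, Finset.mem_erase]
      refine ⟨fun h => Fin.succ_ne_zero c ?_, hmem J _⟩
      exact (J.1.orderEmbOfFin J.2).injective h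
    · exact Fin.succ_injective _ ((J.1.orderEmbOfFin J.2).injective (ht h))
  · ext J J'
    rcases eq_or_ne J J' with rfl | hne
    · simp
    rw [Matrix.diagonal_apply_ne _ hne, Matrix.of_apply, Matrix.map_cramerSyzygy]
    by_contra h
    have hsub := Matrix.subset_insert_of_cramerSyzygy_ne_zero
      (I := J.1.erase (J.1.orderEmbOfFin J.2 0)) (fun m hm => by
        ext j
        rw [Matrix.map_apply, eval_linMatrix_momentCoeff,
          (sum_pow_mul_vanishingPoint_eq_zero_iff ht (hcard J) m).2 hm, zero_mul]
        rfl) h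
    rw [Finset.insert_erase (hmem J 0)] at hsub
    exact hne (Subtype.ext (Finset.eq_of_subset_of_card_le hsub (by rw [J.2, J'.2])).symm)

open Filter in
theorem eventually_linearIndependent_cramerSyzygy {n k q : ℕ} {t : Fin n → ℝ} (hn : n = k + q)
    (ht : Function.Injective t) (A : Fin n → Fin (k + 1) → Fin q → ℝ) :
    ∀ᶠ τ : ℝ in atTop, LinearIndependent ℝ fun J =>
      (linMatrix (momentCoeff t (k + 1) q + τ • A)).cramerSyzygy J := by
  let x : {J : Finset (Fin n) // J.card = q + 1} → Fin (k + 1) → ℝ := fun J =>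
    vanishingPoint t (k + 1) (J.1.erase (J.1.orderEmbOfFin J.2 0))
  let N : ℝ → Matrix {J : Finset (Fin n) // J.card = q + 1} _ ℝ := fun τ =>
    Matrix.of fun J J' => eval (x J) ((linMatrix (momentCoeff t (k + 1) q + τ • A)).cramerSyzygy J'
      (J.1.orderEmbOfFin J.2 0))
  let Np : Matrix {J : Finset (Fin n) // J.card = q + 1} _ (Polynomial ℝ) :=
    Matrix.of fun J J' => Matrix.cramerSyzygy (Matrix.of fun l j => ∑ i,
      (Polynomial.C (momentCoeff t (k + 1) q l i j) + Polynomial.X * Polynomial.C (A l i j)) *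
        Polynomial.C (x J i)) J' (J.1.orderEmbOfFin J.2 0)
  have hN : ∀ τ, Np.det.eval τ = (N τ).det := fun τ => by
    rw [← Polynomial.coe_evalRingHom, RingHom.map_det]
    congr 1
    ext J J'
    simp only [Np, N, RingHom.mapMatrix_apply, Matrix.map_apply, Matrix.of_apply,
      Matrix.map_cramerSyzygy, linMatrix_map_eval]
    congr 1
    ext l j
    simp [Polynomial.eval_finsetSum, mul_comm τ]
  have h0 : Np.det ≠ 0 := fun h => det_cramerSyzygy_momentCoeff_ne_zero hn ht (by
    have := hN 0
    rw [h, Polynomial.eval_zero] at this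
    simpa [N] using this.symm)
  filter_upwards [Polynomial.eventually_atTop_not_isRoot Np.det h0] with τ hτ
  rw [Polynomial.IsRoot, hN] at hτ
  exact linearIndependent_of_det_ne_zero _
    (fun J => (aeval (x J)).toLinearMap ∘ₗ LinearMap.proj (J.1.orderEmbOfFin J.2 0)) hτ

open Filter in
theorem _root_.LinearMap.eventually_injective_add_smul {V W : Type*} [AddCommGroup V] [Module ℝ V]
    [FiniteDimensional ℝ V] [AddCommGroup W] [Module ℝ W] {f : V →ₗ[ℝ] W}
    (hf : Function.Injective f) (g : V →ₗ[ℝ] W) :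
    ∀ᶠ τ : ℝ in atTop, Function.Injective (f + τ • g) := by
  obtain ⟨h, hh⟩ := f.exists_leftInverse_of_injective (LinearMap.ker_eq_bot.2 hf)
  have hfin : {τ : ℝ | Module.End.HasEigenvalue (h ∘ₗ g) (-τ⁻¹)}.Finite :=
    (Module.End.finite_hasEigenvalue (h ∘ₗ g)).preimage (f := fun τ : ℝ => -τ⁻¹)
      (neg_injective.comp inv_injective).injOn
  filter_upwards [atTop_le_cofinite hfin.compl_mem_cofinite, eventually_gt_atTop 0] with τ hτ hτ0
  rw [injective_iff_map_eq_zero]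
  intro v hv
  by_contra hv0
  refine hτ (Module.End.hasEigenvalue_of_hasEigenvector (x := v) ⟨?_, hv0⟩)
  rw [Module.End.mem_eigenspace_iff, LinearMap.comp_apply]
  have h1 := congrArg h hv
  rw [LinearMap.add_apply, map_add, ← LinearMap.comp_apply, hh, LinearMap.id_apply,
    LinearMap.smul_apply, map_smul, map_zero] at h1
  have h2 : h (g v) = τ⁻¹ • (τ • h (g v)) := by rw [smul_smul, inv_mul_cancel₀ hτ0.ne', one_smul]
  rw [h2, eq_neg_of_add_eq_zero_right h1, smul_neg, neg_smul]

open Filter in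
theorem eventually_injective_linMatrixHom {n k s : ℕ} {t : Fin n → ℝ} (hn : n = k + 1 + s)
    (ht : Function.Injective t) (A : Fin n → Fin (k + 1) → Fin (s + 1) → ℝ) :
    ∀ᶠ τ : ℝ in atTop, Function.Injective
      (linMatrixHom (momentCoeff t (k + 1) (s + 1) + τ • A) s) := by
  filter_upwards [LinearMap.eventually_injective_add_smul
    (linMatrixHom_momentCoeff_injective hn ht) (linMatrixHom A s)] with τ hτ
  convert hτ
  refine LinearMap.ext fun v => _root_.funext fun j => Subtype.ext ?_
  have : linMatrix (momentCoeff t (k + 1) (s + 1) + τ • A) =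
      linMatrix (momentCoeff t (k + 1) (s + 1)) + (C τ : MvPolynomial (Fin (k + 1)) ℝ) •
        linMatrix A := by
    ext1 l j
    simp [linMatrix, add_mul, Finset.sum_add_distrib, Finset.mul_sum, mul_assoc]
  simp [linMatrixHom, this, Matrix.vecMul_add, Matrix.vecMul_smul, smul_eq_C_mul]

end MvPolynomial

open Filter Topology in
theorem Matrix.eventually_nonsingular_add_smul {p q N : ℕ} (B₀ B : Fin N → Matrix (Fin p) (Fin q) ℝ)
    (hB : ∀ (x : Fin p → ℝ) (y : Fin q → ℝ), (∀ j, x ⬝ᵥ (B j) *ᵥ y = 0) → x = 0 ∨ y = 0) :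
    ∀ᶠ τ : ℝ in atTop, ∀ (x : Fin p → ℝ) (y : Fin q → ℝ),
      (∀ j, x ⬝ᵥ (B₀ j + τ • B j) *ᵥ y = 0) → x = 0 ∨ y = 0 := by
  have hcont : Continuous fun z : ℝ × (Fin p → ℝ) × (Fin q → ℝ) =>
      fun j => z.2.1 ⬝ᵥ (B j + z.1 • B₀ j) *ᵥ z.2.2 := by
    refine continuous_pi fun j => ?_
    fun_prop
  have h0 : ∀ᶠ ε : ℝ in 𝓝 0, ∀ z ∈ Metric.sphere (0 : Fin p → ℝ) 1 ×ˢ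
      Metric.sphere (0 : Fin q → ℝ) 1, (fun j => z.1 ⬝ᵥ (B j + ε • B₀ j) *ᵥ z.2) ≠ 0 := by
    refine IsCompact.eventually_forall_of_forall_eventually
      ((isCompact_sphere _ _).prod (isCompact_sphere _ _)) fun z hz => ?_
    refine hcont.continuousAt.eventually_ne fun h => ?_
    rcases hB z.1 z.2 fun j => by simpa using congrFun h j with h | h
    · simpa [h] using hz.1
    · simpa [h] using hz.2
  filter_upwards [tendsto_inv_atTop_zero.eventually h0, eventually_gt_atTop 0] with τ hτ hτ0 x y hxy
  by_contra! hne
  have hx := norm_ne_zero_iff.2 hne.1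
  have hy := norm_ne_zero_iff.2 hne.2
  refine hτ (‖x‖⁻¹ • x, ‖y‖⁻¹ • y) ⟨by simp [norm_smul, hx], by simp [norm_smul, hy]⟩ ?_
  ext j
  have h1 : B j + τ⁻¹ • B₀ j = τ⁻¹ • (B₀ j + τ • B j) := by
    rw [smul_add, smul_smul, inv_mul_cancel₀ hτ0.ne', one_smul, add_comm]
  simp only [h1, Matrix.smul_mulVec, Matrix.mulVec_smul, smul_dotProduct, dotProduct_smul, hxy j,
    smul_zero, Pi.zero_apply]

theorem Nat.even_choose_of_nonsingular {n k s : ℕ} (hn : n = k + 1 + s)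
    (B : Fin n → Matrix (Fin (k + 2)) (Fin (s + 1)) ℝ)
    (hB : ∀ (x : Fin (k + 2) → ℝ) (y : Fin (s + 1) → ℝ),
      (∀ j, x ⬝ᵥ (B j) *ᵥ y = 0) → x = 0 ∨ y = 0) : Even (n.choose (k + 1)) := by
  rw [← Nat.not_odd_iff_even]
  intro hodd
  let t : Fin n → ℝ := fun l => (l : ℕ)
  have ht : Function.Injective t := Nat.cast_injective.comp Fin.val_injective
  let B₀ : Fin n → Matrix (Fin (k + 2)) (Fin (s + 1)) ℝ := fun l => Matrix.of fun i j =>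
    Fin.cons (α := fun _ => ℝ) 0 (fun i => MvPolynomial.momentCoeff t (k + 1) (s + 1) l i j) i
  let A : Fin n → Fin (k + 1) → Fin (s + 1) → ℝ := fun l i j => B l i.succ j
  obtain ⟨τ, ⟨h1, h2⟩, h3⟩ := (((Matrix.eventually_nonsingular_add_smul B₀ B hB).and
    (MvPolynomial.eventually_injective_linMatrixHom hn ht A)).and
    (MvPolynomial.eventually_linearIndependent_cramerSyzygy (q := s + 1) (by omega) ht A)).exists
  obtain ⟨ξ, η, hη, h⟩ := MvPolynomial.exists_zero_affMatrix (fun l j => τ * B l 0 j) h2 hn h3 hodd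
  rcases h1 (Fin.cons 1 ξ) η fun l => by
    rw [Matrix.dotProduct_mulVec, dotProduct, ← h l]
    refine Finset.sum_congr rfl fun j _ => ?_
    rw [vecMul, dotProduct, Fin.sum_univ_succ]
    simp [B₀, A, add_comm, mul_comm] with h | h
  · exact one_ne_zero (congrFun h 0)
  · exact hη h

theorem stmt_10 (p q N : ℕ) (hp : 1 ≤ p) (hq : 1 ≤ q) (hN : N ≤ p + q - 2)
    (B : Fin N → Matrix (Fin p) (Fin q) ℝ)
    (hns : ∀ (x : Fin p → ℝ) (y : Fin q → ℝ),
      (∀ j, x ⬝ᵥ (B j) *ᵥ y = 0) → x = 0 ∨ y = 0) :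
    ∀ n : ℕ, N ≤ n → n ≤ p + q - 2 → Even (n.choose (p - 1)) := by
  intro n hNn hn
  obtain rfl | ⟨k, rfl⟩ : p = 1 ∨ ∃ k, p = k + 2 := by
    rcases p with _ | _ | k
    · omega
    · exact Or.inl rfl
    · exact Or.inr ⟨k, rfl⟩
  · exfalso
    let f : (Fin q → ℝ) →ₗ[ℝ] (Fin N → ℝ) := (Matrix.of fun j => B j 0).mulVecLin
    obtain ⟨y, hy, hy0⟩ := (LinearMap.ker f).ne_bot_iff.1
      (LinearMap.ker_ne_bot_of_finrank_lt (by simp; omega))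
    rcases hns 1 y fun j => by
      have : (B j *ᵥ y) 0 = 0 := congrFun (LinearMap.mem_ker.1 hy) j
      simpa [dotProduct] using this with h | h
    · exact one_ne_zero (congrFun h 0)
    · exact hy0 h
  · rcases lt_or_ge n (k + 1) with hlt | hge
    · simp [Nat.choose_eq_zero_of_lt hlt]
    obtain ⟨s, rfl⟩ := Nat.exists_eq_add_of_le hge
    obtain ⟨m, rfl⟩ := Nat.exists_eq_add_of_le (show s + 1 ≤ q by omega)
    refine Nat.even_choose_of_nonsingular rfl
      (fun l => if h : (l : ℕ) < N then (B ⟨l, h⟩).submatrix id (Fin.castAdd m) else 0)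
      fun x y hxy => ?_
    refine (hns x (Fin.append y 0) fun j => ?_).imp_right fun h => ?_
    · have := hxy (Fin.castLE hNn j)
      simp only [Fin.val_castLE, j.isLt, dif_pos] at this
      rw [← this, Matrix.dotProduct_mulVec, Matrix.dotProduct_mulVec, dotProduct,
        Fin.sum_univ_add]
      simp [dotProduct, vecMul]
    · ext j
      simpa using congrFun h (Fin.castAdd m j)
end

section
/- Let d ≥ 1, N ≥ 2d − 1, and 1 ≤ r_1, …, r_N ≤ d. Let V ⊂ (ℝ^{d×d})^N denote the set of N-tuples (A_1, …, A_N) of real symmetric d×d matrices with rank(A_j) ≤ r_j for all j, equipped with the Euclidean topology. Then the set of tuples (A_1, …, A_N) ∈ V such that rank(A_j) = r_j for all j and (A_1, …, A_N) has the phase retrieval property on ℝ^d is dense in V. -/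
open Matrix

/-- A tuple of real symmetric `d×d` matrices has the phase retrieval property on `ℝ^d`
if equality of all quadratic measurements implies equality up to sign. -/
def PhaseRetrievableR {d N : ℕ} (A : Fin N → Matrix (Fin d) (Fin d) ℝ) : Prop :=
  ∀ x y : Fin d → ℝ,
    (∀ j, x ⬝ᵥ (A j) *ᵥ x = y ⬝ᵥ (A j) *ᵥ y) → x = y ∨ x = -y

open Filter Topology

namespace PhaseRetrieval

/-- A symmetric matrix of rank at most `r ≤ d` is a limit of symmetric matrices of rank `r`. -/
lemma mem_closure_rank_eq {d r : ℕ} (hr : r ≤ d) {A : Matrix (Fin d) (Fin d) ℝ}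
    (hA : A.IsSymm) (hAr : A.rank ≤ r) :
    A ∈ closure {B : Matrix (Fin d) (Fin d) ℝ | B.IsSymm ∧ B.rank = r} := by
  have hH : A.IsHermitian := by rwa [Matrix.IsHermitian, conjTranspose_eq_transpose_of_trivial]
  set U : Matrix (Fin d) (Fin d) ℝ := (hH.eigenvectorUnitary : Matrix (Fin d) (Fin d) ℝ)
  have hUU : U * Uᵀ = 1 := by
    have := Unitary.coe_mul_star_self hH.eigenvectorUnitary
    rwa [Unitary.coe_star, star_eq_conjTranspose, conjTranspose_eq_transpose_of_trivial] at this
  have hdet : IsUnit U.det := Matrix.isUnit_det_of_right_inverse hUU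
  have hspec : A = U * diagonal hH.eigenvalues * Uᵀ := by
    have := hH.spectral_theorem
    rw [Unitary.conjStarAlgAut_apply] at this
    simpa [star_eq_conjTranspose, conjTranspose_eq_transpose_of_trivial] using this
  set S : Finset (Fin d) := Finset.univ.filter fun i => hH.eigenvalues i ≠ 0 with hS
  have hScard : S.card = A.rank := by
    rw [hH.rank_eq_card_non_zero_eigs, Fintype.card_subtype]
  obtain ⟨T, hST, hT⟩ := Finset.exists_superset_card_eq (s := S) (n := r) (by omega) (by simpa)
  let D : ℝ → Fin d → ℝ := fun t i => hH.eigenvalues i + if i ∈ T \ S then t else 0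
  have hD0 : D 0 = hH.eigenvalues := by ext i; simp [D]
  have hDc : Continuous fun t => U * diagonal (D t) * Uᵀ := by
    have : Continuous D := by
      refine continuous_pi fun i => ?_
      by_cases h : i ∈ T \ S <;> simp only [D, h, if_true, if_false] <;> fun_prop
    exact (continuous_const.matrix_mul this.matrix_diagonal).matrix_mul continuous_const
  have hlim : Tendsto (fun t => U * diagonal (D t) * Uᵀ) (𝓝[≠] 0) (𝓝 A) := by
    have := hDc.tendsto 0
    rw [hD0, ← hspec] at this
    exact this.mono_left nhdsWithin_le_nhds
  refine mem_closure_of_tendsto hlim ?_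
  filter_upwards [self_mem_nhdsWithin] with t ht
  have ht : t ≠ 0 := ht
  refine ⟨?_, ?_⟩
  · simp [Matrix.IsSymm, transpose_mul, Matrix.mul_assoc]
  · rw [rank_mul_eq_left_of_isUnit_det _ _ (by rwa [det_transpose]),
      rank_mul_eq_right_of_isUnit_det _ _ hdet, rank_diagonal, Fintype.card_subtype, ← hT]
    congr 1
    ext i
    by_cases hi : i ∈ S
    · have h1 : hH.eigenvalues i ≠ 0 := by simpa [hS] using hi
      simp [D, hi, h1, hST hi]
    · have h1 : hH.eigenvalues i = 0 := by simpa [hS] using hi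
      by_cases hiT : i ∈ T <;> simp [D, hi, h1, hiT, ht]

/-- A nonzero real symmetric matrix has a nonvanishing quadratic form. -/
lemma exists_dotProduct_mulVec_ne_zero {d : ℕ} {A : Matrix (Fin d) (Fin d) ℝ}
    (hA : A.IsSymm) (h0 : A ≠ 0) : ∃ z, z ⬝ᵥ A *ᵥ z ≠ 0 := by
  have hH : A.IsHermitian := by rwa [Matrix.IsHermitian, conjTranspose_eq_transpose_of_trivial]
  obtain ⟨v, t, ht, hv, h⟩ := hH.exists_eigenvector_of_ne_zero h0
  refine ⟨v, ?_⟩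
  rw [h, dotProduct_smul, smul_eq_mul]
  exact mul_ne_zero ht (by simpa using hv)

/-- The polynomial ring in the coordinates of two vectors `u, v ∈ ℝ^d`. -/
abbrev PairRing (d : ℕ) := MvPolynomial (Fin d ⊕ Fin d) ℝ

/-- The polynomial `uᵀ A v`. -/
noncomputable def bilinPoly (d : ℕ) : Matrix (Fin d) (Fin d) ℝ →ₗ[ℝ] PairRing d where
  toFun A := ∑ a, ∑ b, A a b • (MvPolynomial.X (Sum.inl a) * MvPolynomial.X (Sum.inr b))
  map_add' A B := by simp [add_smul, Finset.sum_add_distrib]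
  map_smul' c A := by simp [mul_smul, Finset.smul_sum]

/-- The linear form `w ↦ ⟨w, u⟩` (for `ι = Sum.inl`) or `w ↦ ⟨w, v⟩` (for `ι = Sum.inr`). -/
noncomputable def linPoly {d : ℕ} (ι : Fin d → Fin d ⊕ Fin d) : (Fin d → ℝ) →ₗ[ℝ] PairRing d where
  toFun w := ∑ a, w a • MvPolynomial.X (ι a)
  map_add' A B := by simp [add_smul, Finset.sum_add_distrib]
  map_smul' c A := by simp [mul_smul, Finset.smul_sum]

lemma bilinPoly_apply {d : ℕ} (A : Matrix (Fin d) (Fin d) ℝ) : bilinPoly d A =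
    ∑ a, ∑ b, A a b • (MvPolynomial.X (Sum.inl a) * MvPolynomial.X (Sum.inr b)) := rfl

lemma bilinPoly_vecMulVec {d : ℕ} (w : Fin d → ℝ) :
    bilinPoly d (vecMulVec w w) = linPoly Sum.inl w * linPoly Sum.inr w := by
  simp only [bilinPoly_apply, linPoly, LinearMap.coe_mk, AddHom.coe_mk, Finset.sum_mul_sum,
    vecMulVec_apply, smul_mul_smul_comm]

lemma aeval_bilinPoly {d : ℕ} {S : Type*} [CommRing S] [Algebra ℝ S] (s t : S) (u v : Fin d → ℝ)
    (A : Matrix (Fin d) (Fin d) ℝ) :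
    MvPolynomial.aeval (Sum.elim (fun a => u a • s) (fun b => v b • t)) (bilinPoly d A) =
      (u ⬝ᵥ A *ᵥ v) • (s * t) := by
  simp only [bilinPoly_apply, map_sum, map_smul, map_mul, MvPolynomial.aeval_X, Sum.elim_inl,
    Sum.elim_inr, dotProduct, mulVec, Finset.sum_smul, Finset.mul_sum, smul_mul_smul_comm,
    smul_smul]
  refine Finset.sum_congr rfl fun a _ => Finset.sum_congr rfl fun b _ => ?_
  congr 1
  ring

/-- The ideal of `PairRing d` contains neither all coordinates of `u` nor all coordinates of `v`. -/
def IsRelevant {d : ℕ} (P : Ideal (PairRing d)) : Prop :=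
  (∃ a, MvPolynomial.X (Sum.inl a) ∉ P) ∧ ∃ b, MvPolynomial.X (Sum.inr b) ∉ P

lemma exists_linPoly_notMem {d : ℕ} {S : Set (Ideal (PairRing d))} (hS : S.Finite)
    (hrel : ∀ P ∈ S, IsRelevant P) :
    ∃ w : Fin d → ℝ, ∀ P ∈ S, linPoly Sum.inl w ∉ P ∧ linPoly Sum.inr w ∉ P := by
  have := hS.to_subtype
  let p : S × Bool → Submodule ℝ (Fin d → ℝ) := fun i =>
    (i.1.1.restrictScalars ℝ).comap (linPoly (if i.2 then Sum.inl else Sum.inr))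
  by_contra! hcon
  have hcov : ⋃ i, (p i : Set (Fin d → ℝ)) = Set.univ := by
    refine Set.eq_univ_of_forall fun w => ?_
    obtain ⟨P, hP, h⟩ := hcon w
    by_cases hl : linPoly Sum.inl w ∈ P
    · exact Set.mem_iUnion.2 ⟨(⟨P, hP⟩, true), by simpa [p] using hl⟩
    · exact Set.mem_iUnion.2 ⟨(⟨P, hP⟩, false), by simpa [p] using h hl⟩
  obtain ⟨⟨⟨P, hP⟩, c⟩, hi⟩ := Subspace.exists_eq_top_of_iUnion_eq_univ hcov
  have key : ∀ a, linPoly (if c then Sum.inl else Sum.inr) (Pi.single a 1) ∈ P := fun a => by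
    have : Pi.single a 1 ∈ p (⟨P, hP⟩, c) := by rw [hi]; trivial
    simpa [p] using this
  have hX : ∀ (ι : Fin d → Fin d ⊕ Fin d) (a : Fin d),
      linPoly ι (Pi.single a 1) = MvPolynomial.X (ι a) := fun ι a => by
    simp [linPoly, Pi.single_apply]
  obtain ⟨⟨a, ha⟩, b, hb⟩ := hrel P hP
  cases c
  · exact hb (by simpa [hX] using key b)
  · exact ha (by simpa [hX] using key a)

lemma finite_setOf_quadratic_mem {R : Type*} [CommRing R] [Algebra ℝ R] (P : Ideal R) [P.IsPrime]
    (a b : R) {c : R} (hc : c ∉ P) : {t : ℝ | a + t • b + t ^ 2 • c ∈ P}.Finite := by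
  let q := Ideal.Quotient.mk P
  let p : Polynomial (R ⧸ P) :=
    Polynomial.C (q c) * Polynomial.X ^ 2 + Polynomial.C (q b) * Polynomial.X + Polynomial.C (q a)
  have hp : p ≠ 0 := fun h => by
    have h2 : p.coeff 2 = q c := by simp [p]
    rw [h, Polynomial.coeff_zero] at h2
    exact hc (Ideal.Quotient.eq_zero_iff_mem.1 h2.symm)
  have hinj : Function.Injective (algebraMap ℝ (R ⧸ P)) := (algebraMap ℝ (R ⧸ P)).injective
  refine ((p.finite_setOfPred_isRoot hp).preimage hinj.injOn).subset fun t ht => ?_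
  have ht' : q (a + t • b + t ^ 2 • c) = 0 := Ideal.Quotient.eq_zero_iff_mem.2 ht
  have hq : ∀ s : ℝ, q (algebraMap ℝ R s) = algebraMap ℝ (R ⧸ P) s := fun s => rfl
  rw [Algebra.smul_def, Algebra.smul_def, map_add, map_add, map_mul, map_mul, hq, hq, map_pow]
    at ht'
  simp only [Set.mem_preimage, Set.mem_ofPred_eq, Polynomial.IsRoot, p, Polynomial.eval_add,
    Polynomial.eval_mul, Polynomial.eval_C, Polynomial.eval_pow, Polynomial.eval_X]
  rw [← ht']
  ring

/-- Symmetric matrices of rank `r` can be perturbed, keeping the rank, so that `uᵀ A v` avoids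
finitely many relevant primes. -/
lemma mem_closure_bilinPoly_notMem {d r : ℕ} (hr : 1 ≤ r) {S : Set (Ideal (PairRing d))}
    (hS : S.Finite) (hrel : ∀ P ∈ S, IsRelevant P) (hprime : ∀ P ∈ S, P.IsPrime)
    {A : Matrix (Fin d) (Fin d) ℝ} (hA : A.IsSymm) (hAr : A.rank = r) :
    A ∈ closure {B : Matrix (Fin d) (Fin d) ℝ |
      (B.IsSymm ∧ B.rank = r) ∧ ∀ P ∈ S, bilinPoly d B ∉ P} := by
  have hA0 : A ≠ 0 := by rintro rfl; rw [rank_zero] at hAr; omega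
  obtain ⟨z, hz⟩ := exists_dotProduct_mulVec_ne_zero hA hA0
  obtain ⟨w, hw⟩ := exists_linPoly_notMem hS hrel
  let W := vecMulVec w z
  let g : ℝ → Matrix (Fin d) (Fin d) ℝ := fun t => 1 + t • W
  have hg0 : g 0 = 1 := by simp [g]
  have hgc : Continuous g := by fun_prop
  have hWAW : W * A * Wᵀ = (z ⬝ᵥ A *ᵥ z) • vecMulVec w w := by
    rw [transpose_vecMulVec, vecMulVec_mul, vecMulVec_mul_vecMulVec, ← dotProduct_mulVec,
      vecMulVec_smul]
  have hexp : ∀ t, bilinPoly d (g t * A * (g t)ᵀ) = bilinPoly d A +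
      t • bilinPoly d (W * A + A * Wᵀ) +
      t ^ 2 • ((z ⬝ᵥ A *ᵥ z) • (linPoly Sum.inl w * linPoly Sum.inr w)) := fun t => by
    rw [← bilinPoly_vecMulVec, ← map_smul, ← map_smul, ← map_smul, ← map_add, ← map_add, ← hWAW]
    congr 1
    simp only [g, transpose_add, transpose_one, transpose_smul, add_mul, mul_add, one_mul, mul_one,
      smul_mul_assoc, mul_smul_comm, smul_add, smul_smul, pow_two]
    abel
  have hlim : Tendsto (fun t => g t * A * (g t)ᵀ) (𝓝[≠] 0) (𝓝 A) := by
    have hc : Continuous fun t => g t * A * (g t)ᵀ :=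
      (hgc.matrix_mul continuous_const).matrix_mul hgc.matrix_transpose
    have := hc.tendsto 0
    rw [hg0, transpose_one, one_mul, mul_one] at this
    exact this.mono_left nhdsWithin_le_nhds
  have hdet : ∀ᶠ t in 𝓝[≠] (0 : ℝ), (g t).det ≠ 0 := by
    have : ∀ᶠ t in 𝓝 (0 : ℝ), (g t).det ≠ 0 :=
      hgc.matrix_det.continuousAt.eventually_ne (by simp [hg0])
    exact this.filter_mono nhdsWithin_le_nhds
  have hav : ∀ᶠ t in 𝓝[≠] (0 : ℝ), ∀ P ∈ S, bilinPoly d (g t * A * (g t)ᵀ) ∉ P := by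
    refine (eventually_all_finite hS).2 fun P hP => ?_
    have := hprime P hP
    have hc : (z ⬝ᵥ A *ᵥ z) • (linPoly Sum.inl w * linPoly Sum.inr w) ∉ P := fun h => by
      have h' := (P.restrictScalars ℝ).smul_mem_iff hz |>.1 h
      exact (this.mem_or_mem h').elim (hw P hP).1 (hw P hP).2
    have hfin := finite_setOf_quadratic_mem P (bilinPoly d A) (bilinPoly d (W * A + A * Wᵀ)) hc
    filter_upwards [nhdsNE_le_cofinite 0 hfin.compl_mem_cofinite] with t ht
    rw [hexp t]
    exact ht
  refine mem_closure_of_tendsto hlim ?_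
  filter_upwards [hdet, hav] with t ht1 ht2
  refine ⟨⟨?_, ?_⟩, ht2⟩
  · simp [Matrix.IsSymm, transpose_mul, Matrix.mul_assoc, hA.eq]
  · rw [rank_mul_eq_left_of_isUnit_det _ _ (by rw [det_transpose]; exact ht1.isUnit),
      rank_mul_eq_right_of_isUnit_det _ _ ht1.isUnit, hAr]

/-- For nonzero `u, v ∈ ℝ^d`, the ideal of the plane `{(s u, t v)}` is a relevant prime of height
at most `2d - 2`, and it contains every form `uᵀ A v` that vanishes at `(u, v)`. -/
lemma exists_relevant_prime_of_common_zero {d : ℕ} {u v : Fin d → ℝ} (hu : u ≠ 0) (hv : v ≠ 0) :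
    ∃ Q : Ideal (PairRing d), Q.IsPrime ∧ IsRelevant Q ∧
      (∀ A : Matrix (Fin d) (Fin d) ℝ, u ⬝ᵥ A *ᵥ v = 0 → bilinPoly d A ∈ Q) ∧
      Q.height + 2 ≤ 2 * d := by
  obtain ⟨a, ha⟩ := Function.ne_iff.1 hu
  obtain ⟨b, hb⟩ := Function.ne_iff.1 hv
  simp only [Pi.zero_apply] at ha hb
  let φ₁ : PairRing d →ₐ[ℝ] MvPolynomial (Fin 2) ℝ := MvPolynomial.aeval
    (Sum.elim (fun a => u a • MvPolynomial.X 0) (fun b => v b • MvPolynomial.X 1))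
  let ψ₁ : MvPolynomial (Fin 2) ℝ →ₐ[ℝ] Polynomial ℝ := MvPolynomial.aeval ![Polynomial.X, 1]
  let ψ₂ : Polynomial ℝ →ₐ[ℝ] ℝ := Polynomial.aeval 1
  let φ₂ := ψ₁.comp φ₁
  let φ₃ := ψ₂.comp φ₂
  have hp₁ : (RingHom.ker φ₁).IsPrime := RingHom.ker_isPrime _
  have hp₂ : (RingHom.ker φ₂).IsPrime := RingHom.ker_isPrime _
  have hp₃ : (RingHom.ker φ₃).IsPrime := RingHom.ker_isPrime _
  have h12 : RingHom.ker φ₁ < RingHom.ker φ₂ := by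
    refine SetLike.lt_iff_le_and_exists.2 ⟨fun x hx => ?_,
      MvPolynomial.X (Sum.inr b) - MvPolynomial.C (v b), ?_, fun h => ?_⟩
    · rw [RingHom.mem_ker] at hx ⊢
      simp [φ₂, hx]
    · simp [φ₂, ψ₁, φ₁, RingHom.mem_ker, Algebra.smul_def]
    · have := congrArg (MvPolynomial.eval (0 : Fin 2 → ℝ)) (RingHom.mem_ker.1 h)
      simp [φ₁] at this
      exact hb this
  have h23 : RingHom.ker φ₂ < RingHom.ker φ₃ := by
    refine SetLike.lt_iff_le_and_exists.2 ⟨fun x hx => ?_,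
      MvPolynomial.X (Sum.inl a) - MvPolynomial.C (u a), ?_, fun h => ?_⟩
    · rw [RingHom.mem_ker] at hx ⊢
      simp [φ₃, hx]
    · simp [φ₃, ψ₂, φ₂, ψ₁, φ₁, RingHom.mem_ker, Algebra.smul_def]
    · have := congrArg (Polynomial.eval (0 : ℝ)) (RingHom.mem_ker.1 h)
      simp [φ₂, ψ₁, φ₁] at this
      exact ha this
  refine ⟨RingHom.ker φ₁, hp₁, ⟨⟨a, ?_⟩, b, ?_⟩, fun A hA => ?_, ?_⟩
  · simp [RingHom.mem_ker, φ₁, ha]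
  · simp [RingHom.mem_ker, φ₁, hb]
  · rw [RingHom.mem_ker]
    simp only [φ₁]
    rw [aeval_bilinPoly, hA, zero_smul]
  · have h1 := Ideal.height_add_one_le_of_lt_of_isPrime h12
    have h2 := Ideal.height_add_one_le_of_lt_of_isPrime h23
    have h3 := Ideal.height_le_ringKrullDim_of_isPrime (I := RingHom.ker φ₃)
    rw [MvPolynomial.ringKrullDim_of_isNoetherianRing, ringKrullDim_eq_zero_of_field, zero_add,
      Nat.card_sum, Nat.card_fin] at h3
    have h4 : (RingHom.ker φ₃).height ≤ ((d + d : ℕ) : ℕ∞) := by exact_mod_cast h3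
    calc (RingHom.ker φ₁).height + 2 = (RingHom.ker φ₁).height + 1 + 1 := by
          rw [add_assoc, one_add_one_eq_two]
      _ ≤ (RingHom.ker φ₂).height + 1 := by gcongr
      _ ≤ (RingHom.ker φ₃).height := h2
      _ ≤ ((d + d : ℕ) : ℕ∞) := h4
      _ = 2 * d := by push_cast; ring

/-- If every relevant prime containing the forms `uᵀ A_j v` has height at least
`N ≥ 2d - 1`, then the tuple is phase retrievable. -/
lemma phaseRetrievableR_of_le_height {d N : ℕ} (hN : 2 * d - 1 ≤ N)
    {A : Fin N → Matrix (Fin d) (Fin d) ℝ} (hA : ∀ j, (A j).IsSymm)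
    (h : ∀ Q : Ideal (PairRing d), Q.IsPrime → IsRelevant Q → (∀ j, bilinPoly d (A j) ∈ Q) →
      (N : ℕ∞) ≤ Q.height) : PhaseRetrievableR A := by
  intro x y hxy
  by_contra! hne
  have hu : x - y ≠ 0 := sub_ne_zero.2 hne.1
  have hv : x + y ≠ 0 := fun h0 => hne.2 (eq_neg_of_add_eq_zero_left h0)
  obtain ⟨Q, hQ, hrel, hmem, hht⟩ := exists_relevant_prime_of_common_zero hu hv
  have hz : ∀ j, (x - y) ⬝ᵥ A j *ᵥ (x + y) = 0 := fun j => by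
    have hsymm : x ⬝ᵥ A j *ᵥ y = y ⬝ᵥ A j *ᵥ x := by
      rw [dotProduct_mulVec, ← mulVec_transpose, (hA j).eq, dotProduct_comm]
    simp only [sub_dotProduct, mulVec_add, dotProduct_add]
    linarith [hxy j]
  have h1 := h Q hQ hrel fun j => hmem _ (hz j)
  have h2 : ((N + 2 : ℕ) : ℕ∞) ≤ ((2 * d : ℕ) : ℕ∞) := by
    push_cast
    exact (add_le_add_left h1 2).trans hht
  have h3 : N + 2 ≤ 2 * d := by exact_mod_cast h2
  omega

/-- One can perturb the first `k` matrices so that every relevant prime containing the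
corresponding forms has height at least `k`. -/
lemma exists_perturbation {d N : ℕ} {r : Fin N → ℕ} (hr : ∀ j, 1 ≤ r j ∧ r j ≤ d)
    {A : Fin N → Matrix (Fin d) (Fin d) ℝ} (hA : ∀ j, (A j).IsSymm ∧ (A j).rank ≤ r j)
    {O : Set (Fin N → Matrix (Fin d) (Fin d) ℝ)} (hO : IsOpen O) (hAO : A ∈ O) (k : ℕ)
    (hk : k ≤ N) : ∃ B ∈ O, (∀ j : Fin N, k ≤ j → B j = A j) ∧
      (∀ j : Fin N, j < k → (B j).IsSymm ∧ (B j).rank = r j) ∧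
      ∀ Q : Ideal (PairRing d), Q.IsPrime → IsRelevant Q →
        (∀ j : Fin N, j < k → bilinPoly d (B j) ∈ Q) → (k : ℕ∞) ≤ Q.height := by
  induction k with
  | zero => exact ⟨A, hAO, by simp, by simp, by simp⟩
  | succ k ih =>
    obtain ⟨B, hBO, hBA, hBr, hBh⟩ := ih (by omega)
    let m : Fin N := ⟨k, hk⟩
    let I : Ideal (PairRing d) :=
      Ideal.span ((fun j => bilinPoly d (B j)) '' {j : Fin N | (j : ℕ) < k})
    let S : Set (Ideal (PairRing d)) := {P ∈ I.minimalPrimes | IsRelevant P}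
    have hS : S.Finite :=
      (I.finite_minimalPrimes_of_isNoetherianRing _).subset (Set.sep_subset _ _)
    have hcl : A m ∈ closure {M : Matrix (Fin d) (Fin d) ℝ |
        (M.IsSymm ∧ M.rank = r m) ∧ ∀ P ∈ S, bilinPoly d M ∉ P} :=
      closure_minimal (fun M hM => mem_closure_bilinPoly_notMem (hr m).1 hS (fun P hP => hP.2)
        (fun P hP => hP.1.1.1) hM.1 hM.2) isClosed_closure
        (mem_closure_rank_eq (hr m).2 (hA m).1 (hA m).2)
    have hupd : Continuous fun M => Function.update B m M := continuous_const.update m continuous_id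
    obtain ⟨M, hMO, ⟨hMr, hMS⟩⟩ := mem_closure_iff.1 hcl _ (hO.preimage hupd) (by
      rw [Set.mem_preimage, ← hBA m le_rfl, Function.update_eq_self]; exact hBO)
    have hlt : ∀ j : Fin N, (j : ℕ) < k → Function.update B m M j = B j := fun j hj =>
      Function.update_of_ne (fun h => by simp [h, m] at hj) _ _
    refine ⟨Function.update B m M, hMO, fun j hj => ?_, fun j hj => ?_, fun Q hQ hrel hmem => ?_⟩
    · rw [Function.update_of_ne (fun h => by simp [h, m] at hj), hBA j (by omega)]
    · rcases Nat.lt_succ_iff_lt_or_eq.1 hj with hj | hj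
      · rw [hlt j hj]; exact hBr j hj
      · obtain rfl : j = m := Fin.ext hj
        rwa [Function.update_self]
    · have hIQ : I ≤ Q := by
        refine Ideal.span_le.2 ?_
        rintro _ ⟨j, hj, rfl⟩
        have := hmem j (Nat.lt_succ_of_lt hj)
        rwa [hlt j hj] at this
      obtain ⟨P, hP, hPQ⟩ := Ideal.exists_minimalPrimes_le hIQ
      have hPp : P.IsPrime := hP.1.1
      have hPrel : IsRelevant P :=
        ⟨hrel.1.imp fun a ha h => ha (hPQ h), hrel.2.imp fun b hb h => hb (hPQ h)⟩
      have hPh := hBh P hPp hPrel fun j hj => hP.1.2 (Ideal.subset_span ⟨j, hj, rfl⟩)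
      have hMQ : bilinPoly d M ∈ Q := by
        have := hmem m (Nat.lt_succ_self k)
        rwa [Function.update_self] at this
      have hPQ' : P < Q := SetLike.lt_iff_le_and_exists.2 ⟨hPQ, _, hMQ, hMS P ⟨hP, hPrel⟩⟩
      push_cast
      exact (add_le_add_left hPh 1).trans (Ideal.height_add_one_le_of_lt_of_isPrime hPQ')

end PhaseRetrieval

theorem stmt_11 (d N : ℕ) (hd : 1 ≤ d) (hN : 2 * d - 1 ≤ N)
    (r : Fin N → ℕ) (hr : ∀ j, 1 ≤ r j ∧ r j ≤ d) :
    {A : Fin N → Matrix (Fin d) (Fin d) ℝ | ∀ j, (A j).IsSymm ∧ (A j).rank ≤ r j} ⊆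
      closure {A : Fin N → Matrix (Fin d) (Fin d) ℝ |
        (∀ j, (A j).IsSymm ∧ (A j).rank = r j) ∧ PhaseRetrievableR A} := by
  intro A hA
  refine mem_closure_iff.2 fun O hO hAO => ?_
  obtain ⟨B, hBO, -, hBr, hBh⟩ := PhaseRetrieval.exists_perturbation hr hA hO hAO N le_rfl
  exact ⟨B, hBO, fun j => hBr j j.2, PhaseRetrieval.phaseRetrievableR_of_le_height hN
    (fun j => (hBr j j.2).1) fun Q hQ hrel hmem => hBh Q hQ hrel fun j _ => hmem j⟩
end

section
/- Let d ≥ 1, N ≥ 2d − 1, and 1 ≤ r_1, …, r_N ≤ d − 1. Let P ⊂ (ℝ^{d×d})^N denote the set of N-tuples (A_1, …, A_N) where each A_j is a real orthogonal projection matrix (i.e., A_j is symmetric with A_j² = A_j) of rank r_j, equipped with the Euclidean topology. Then the set of tuples (A_1, …, A_N) ∈ P having the phase retrieval property on ℝ^d is dense in P. -/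
open Matrix

namespace PhaseRetrieval

/-- The symmetric idempotent real matrices of rank `r`, i.e. the orthogonal projections. -/
def projections (d r : ℕ) : Set (Matrix (Fin d) (Fin d) ℝ) :=
  {A | A.IsSymm ∧ A * A = A ∧ A.rank = r}

/-- The matrix of the orthogonal reflection in the hyperplane orthogonal to `w`. -/
noncomputable def reflection {d : ℕ} (w : Fin d → ℝ) : Matrix (Fin d) (Fin d) ℝ :=
  1 - (2 / (w ⬝ᵥ w)) • vecMulVec w w

lemma reflection_isSymm {d : ℕ} (w : Fin d → ℝ) : (reflection w).IsSymm := by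
  simp [reflection, Matrix.IsSymm, transpose_vecMulVec]

lemma reflection_mul_self {d : ℕ} (w : Fin d → ℝ) :
    reflection w * reflection w = 1 := by
  by_cases hw : w ⬝ᵥ w = 0
  · simp [reflection, hw]
  · simp only [reflection, sub_mul, mul_sub, one_mul, mul_one, smul_mul_assoc, mul_smul_comm,
      vecMulVec_mul_vecMulVec, vecMulVec_smul]
    ext i j
    simp only [Matrix.sub_apply, Matrix.smul_apply, smul_eq_mul]
    field_simp
    ring

lemma reflection_mulVec {d : ℕ} (w v : Fin d → ℝ) :
    reflection w *ᵥ v = v - (2 / (w ⬝ᵥ w) * (w ⬝ᵥ v)) • w := by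
  ext i
  simp [reflection, sub_mulVec, smul_mulVec, vecMulVec_mulVec]
  ring

lemma conj_mem_projections {d r : ℕ} {A H : Matrix (Fin d) (Fin d) ℝ}
    (hA : A ∈ projections d r) (hH : H.IsSymm) (hHH : H * H = 1) :
    H * A * H ∈ projections d r := by
  obtain ⟨h1, h2, h3⟩ := hA
  have hu : IsUnit H.det := (isUnit_iff_isUnit_det H).1 (IsUnit.of_mul_eq_one H hHH)
  refine ⟨?_, ?_, ?_⟩
  · rw [Matrix.IsSymm, transpose_mul, transpose_mul, hH.eq, h1.eq, mul_assoc]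
  · calc H * A * H * (H * A * H) = H * A * (H * H) * A * H := by simp only [mul_assoc]
      _ = H * (A * A) * H := by rw [hHH]; simp only [mul_assoc, one_mul]
      _ = H * A * H := by rw [h2]
  · rw [rank_mul_eq_left_of_isUnit_det _ _ hu, rank_mul_eq_right_of_isUnit_det _ _ hu, h3]

lemma dotProduct_mulVec_comm {d : ℕ} {A : Matrix (Fin d) (Fin d) ℝ} (hA : A.IsSymm)
    (x y : Fin d → ℝ) : x ⬝ᵥ A *ᵥ y = A *ᵥ x ⬝ᵥ y := by
  rw [dotProduct_mulVec, ← mulVec_transpose, hA.eq]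

lemma dotProduct_self_pos {d : ℕ} {x : Fin d → ℝ} (hx : x ≠ 0) : 0 < x ⬝ᵥ x := by
  simpa using dotProduct_star_self_pos_iff.2 hx

/-- A nonzero vector in the range of a projection that is orthogonal to neither of two
given vectors, unless the latter lie in the kernel. -/
lemma exists_range_not_orthogonal {d : ℕ} {A : Matrix (Fin d) (Fin d) ℝ} (hA : A.IsSymm)
    (hAA : A * A = A) (h0 : A ≠ 0) (u v : Fin d → ℝ) :
    ∃ a, A *ᵥ a = a ∧ a ≠ 0 ∧ (A *ᵥ u ≠ 0 → a ⬝ᵥ u ≠ 0) ∧ (A *ᵥ v ≠ 0 → a ⬝ᵥ v ≠ 0) := by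
  have hid : ∀ x, A *ᵥ (A *ᵥ x) = A *ᵥ x := fun x => by rw [mulVec_mulVec, hAA]
  have hsq : ∀ x, A *ᵥ x ⬝ᵥ x = A *ᵥ x ⬝ᵥ A *ᵥ x := fun x => by
    rw [dotProduct_mulVec_comm hA, hid]
  have hpos : ∀ x, A *ᵥ x ≠ 0 → A *ᵥ x ⬝ᵥ x ≠ 0 := fun x hx => by
    rw [hsq]; simpa using hx
  by_cases hu : A *ᵥ u = 0
  · by_cases hv : A *ᵥ v = 0
    · obtain ⟨x, hx⟩ : ∃ x, A *ᵥ x ≠ 0 := by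
        by_contra! h
        exact h0 (Matrix.ext_of_mulVec_single fun i => by
          rw [h, zero_mulVec])
      exact ⟨A *ᵥ x, hid x, hx, fun h => absurd hu h, fun h => absurd hv h⟩
    · exact ⟨A *ᵥ v, hid v, hv, fun h => absurd hu h, fun _ => hpos v hv⟩
  · by_cases hv : A *ᵥ v = 0
    · exact ⟨A *ᵥ u, hid u, hu, fun _ => hpos u hu, fun h => absurd hv h⟩
    · by_cases huv : A *ᵥ u ⬝ᵥ v = 0
      · have hvu : A *ᵥ v ⬝ᵥ u = 0 := by
          rw [← dotProduct_mulVec_comm hA, dotProduct_comm, huv]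
        have hu' : (A *ᵥ u + A *ᵥ v) ⬝ᵥ u ≠ 0 := by
          rw [add_dotProduct, hvu, add_zero]; exact hpos u hu
        have hv' : (A *ᵥ u + A *ᵥ v) ⬝ᵥ v ≠ 0 := by
          rw [add_dotProduct, huv, zero_add]; exact hpos v hv
        refine ⟨A *ᵥ u + A *ᵥ v, by rw [mulVec_add, hid, hid], ?_, fun _ => hu', fun _ => hv'⟩
        rintro h
        simp [h] at hu'
      · exact ⟨A *ᵥ u, hid u, hu, fun _ => hpos u hu, fun _ => huv⟩

/-- Conjugating a projection `A` by the reflection along `b + t a`, where `a` is fixed by `A`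
and `b` is killed by `A`. -/
lemma dotProduct_conj_reflection {d : ℕ} {A : Matrix (Fin d) (Fin d) ℝ} (hA : A.IsSymm)
    {a b u v : Fin d → ℝ} (ha : A *ᵥ a = a) (hb : A *ᵥ b = 0) (hb0 : b ≠ 0)
    (huv : u ⬝ᵥ A *ᵥ v = 0) (t : ℝ) :
    (u ⬝ᵥ (reflection (b + t • a) * A * reflection (b + t • a)) *ᵥ v) *
        (b ⬝ᵥ b + t ^ 2 * (a ⬝ᵥ a)) ^ 2 =
      2 * t * (2 * t * ((a ⬝ᵥ a) * (b ⬝ᵥ u) * (b ⬝ᵥ v) - (b ⬝ᵥ b) * (a ⬝ᵥ u) * (a ⬝ᵥ v)) -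
        (b ⬝ᵥ b - t ^ 2 * (a ⬝ᵥ a)) *
          ((b ⬝ᵥ u) * (a ⬝ᵥ v) + (a ⬝ᵥ u) * (b ⬝ᵥ v))) := by
  have hab : b ⬝ᵥ a = 0 := by
    rw [← ha, dotProduct_mulVec_comm hA, hb, zero_dotProduct]
  have hba : a ⬝ᵥ b = 0 := by rw [dotProduct_comm, hab]
  have hbb := dotProduct_self_pos hb0
  have haa : 0 ≤ a ⬝ᵥ a := by simpa using dotProduct_star_self_nonneg a
  have hn : b ⬝ᵥ b + t ^ 2 * (a ⬝ᵥ a) ≠ 0 := by positivity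
  have hw : (b + t • a) ⬝ᵥ (b + t • a) = b ⬝ᵥ b + t ^ 2 * (a ⬝ᵥ a) := by
    simp [hab, hba]; ring
  have hbv : b ⬝ᵥ A *ᵥ v = 0 := by rw [dotProduct_mulVec_comm hA, hb, zero_dotProduct]
  have hav : a ⬝ᵥ A *ᵥ v = a ⬝ᵥ v := by rw [dotProduct_mulVec_comm hA, ha]
  rw [← mulVec_mulVec, ← mulVec_mulVec, reflection_mulVec, reflection_mulVec, hw]
  simp only [mulVec_sub, mulVec_smul, mulVec_add, ha, hb, dotProduct_sub, dotProduct_smul,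
    dotProduct_add, add_dotProduct, smul_dotProduct, smul_eq_mul, huv, hbv, hav, hab,
    dotProduct_comm u a, dotProduct_comm u b, zero_add]
  field_simp
  ring

lemma exists_mem_projections_dotProduct_ne_zero {d r : ℕ} (hr1 : 1 ≤ r) (hr2 : r < d)
    {A : Matrix (Fin d) (Fin d) ℝ} (hA : A ∈ projections d r)
    {s : Set (Matrix (Fin d) (Fin d) ℝ)} (hs : IsOpen s) (hAs : A ∈ s)
    {u v : Fin d → ℝ} (hu : u ≠ 0) (hv : v ≠ 0) :
    ∃ B ∈ projections d r ∩ s, u ⬝ᵥ B *ᵥ v ≠ 0 := by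
  by_cases huv : u ⬝ᵥ A *ᵥ v = 0
  swap
  · exact ⟨A, ⟨hA, hAs⟩, huv⟩
  obtain ⟨h1, h2, h3⟩ := hA
  have hA0 : A ≠ 0 := by
    rintro rfl
    rw [rank_zero] at h3
    omega
  have hA1 : 1 - A ≠ 0 := by
    intro h
    rw [← sub_eq_zero.1 h, rank_one, Fintype.card_fin] at h3
    omega
  obtain ⟨a, ha, ha0, hau, hav⟩ := exists_range_not_orthogonal h1 h2 hA0 u v
  obtain ⟨b, hb, hb0, hbu, hbv⟩ := exists_range_not_orthogonal (A := 1 - A)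
    (isSymm_one.sub h1) (by simp [sub_mul, mul_sub, h2]) hA1 u v
  have hb : A *ᵥ b = 0 := by simpa [sub_mulVec] using hb
  have hor : ∀ x : Fin d → ℝ, x ≠ 0 → A *ᵥ x ≠ 0 ∨ (1 - A) *ᵥ x ≠ 0 := by
    intro x hx
    by_contra! h
    refine hx ?_
    have := h.2
    rwa [sub_mulVec, h.1, one_mulVec, sub_zero] at this
  have hu' : a ⬝ᵥ u ≠ 0 ∨ b ⬝ᵥ u ≠ 0 := (hor u hu).imp hau hbu
  have hv' : a ⬝ᵥ v ≠ 0 ∨ b ⬝ᵥ v ≠ 0 := (hor v hv).imp hav hbv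
  have key := dotProduct_conj_reflection h1 ha hb hb0 huv
  have hbb := dotProduct_self_pos hb0
  have haa := dotProduct_self_pos ha0
  set α := a ⬝ᵥ u
  set β := b ⬝ᵥ u
  set α' := a ⬝ᵥ v
  set β' := b ⬝ᵥ v
  set σ := a ⬝ᵥ a
  set μ := b ⬝ᵥ b
  have hev : ∀ᶠ t : ℝ in nhdsWithin 0 {0}ᶜ,
      2 * t * (σ * β * β' - μ * α * α') - (μ - t ^ 2 * σ) * (β * α' + α * β') ≠ 0 := by
    by_cases hp : β * α' + α * β' = 0
    · have hq : σ * β * β' - μ * α * α' ≠ 0 := by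
        intro hq
        have hpos : 0 < σ * β ^ 2 + μ * α ^ 2 := by
          rcases hu' with h | h <;> positivity
        have e1 : α' * (σ * β ^ 2 + μ * α ^ 2) = 0 := by
          linear_combination σ * β * hp - α * hq
        have e2 : β' * (σ * β ^ 2 + μ * α ^ 2) = 0 := by
          linear_combination μ * α * hp + β * hq
        rcases hv' with h | h
        · exact (mul_ne_zero h hpos.ne') e1
        · exact (mul_ne_zero h hpos.ne') e2
      filter_upwards [self_mem_nhdsWithin] with t ht
      rw [hp, mul_zero, sub_zero]
      exact mul_ne_zero (mul_ne_zero two_ne_zero ht) hq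
    · refine nhdsWithin_le_nhds (ContinuousAt.eventually_ne (by fun_prop) ?_)
      simpa using ⟨hbb.ne', hp⟩
  have hcont : ContinuousAt
      (fun t : ℝ => reflection (b + t • a) * A * reflection (b + t • a)) 0 := by
    have hR : ContinuousAt (fun t : ℝ => reflection (b + t • a)) 0 := by
      unfold reflection
      have hdiv : ContinuousAt (fun t : ℝ => 2 / ((b + t • a) ⬝ᵥ (b + t • a))) 0 :=
        ContinuousAt.div (by fun_prop) (by fun_prop) (by simpa using hb0)
      have hvec : Continuous fun t : ℝ => vecMulVec (b + t • a) (b + t • a) :=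
        Continuous.matrix_vecMulVec (by fun_prop) (by fun_prop)
      exact continuousAt_const.sub (hdiv.smul hvec.continuousAt)
    exact (hR.mul continuousAt_const).mul hR
  have hzero : reflection (b + (0 : ℝ) • a) * A * reflection (b + (0 : ℝ) • a) = A := by
    have hbA : b ᵥ* A = 0 := by rw [← mulVec_transpose, h1.eq, hb]
    simp [reflection, sub_mul, mul_sub, vecMulVec_mul, mul_vecMulVec, hb, hbA]
  have hmem : ∀ᶠ t : ℝ in nhdsWithin 0 {0}ᶜ,
      reflection (b + t • a) * A * reflection (b + t • a) ∈ s :=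
    nhdsWithin_le_nhds (hcont.eventually_mem (by rw [hzero]; exact hs.mem_nhds hAs))
  obtain ⟨t, ⟨ht1, ht2⟩, ht3⟩ := ((hev.and hmem).and self_mem_nhdsWithin).exists
  refine ⟨_, ⟨conj_mem_projections ⟨h1, h2, h3⟩ (reflection_isSymm _) (reflection_mul_self _),
    ht2⟩, fun h => ?_⟩
  have := key t
  rw [h, zero_mul] at this
  exact mul_ne_zero (mul_ne_zero two_ne_zero ht3) ht1 this.symm

/-- Finitely many pairs of nonzero vectors can be treated simultaneously. -/
lemma exists_mem_projections_forall_dotProduct_ne_zero {d r : ℕ} (hr1 : 1 ≤ r) (hr2 : r < d)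
    {A : Matrix (Fin d) (Fin d) ℝ} (hA : A ∈ projections d r)
    {s : Set (Matrix (Fin d) (Fin d) ℝ)} (hs : IsOpen s) (hAs : A ∈ s)
    {ι : Type*} (T : Finset ι) (u v : ι → Fin d → ℝ) (hu : ∀ i, u i ≠ 0) (hv : ∀ i, v i ≠ 0) :
    ∃ B ∈ projections d r ∩ s, ∀ i ∈ T, u i ⬝ᵥ B *ᵥ v i ≠ 0 := by
  classical
  induction T using Finset.induction_on with
  | empty => exact ⟨A, ⟨hA, hAs⟩, by simp⟩
  | insert i T _ ih =>
    obtain ⟨B, ⟨hB, hBs⟩, hBT⟩ := ih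
    have hopen : IsOpen (s ∩ ⋂ j ∈ T, {C | u j ⬝ᵥ C *ᵥ v j ≠ 0}) :=
      hs.inter (isOpen_biInter_finset fun j _ =>
        isOpen_ne_fun (by fun_prop) continuous_const)
    obtain ⟨C, ⟨hC, hCs, hCT⟩, hCi⟩ := exists_mem_projections_dotProduct_ne_zero hr1 hr2 hB hopen
      ⟨hBs, by simpa using hBT⟩ (hu i) (hv i)
    refine ⟨C, ⟨hC, hCs⟩, fun j hj => ?_⟩
    rcases Finset.mem_insert.1 hj with rfl | hj
    · exact hCi
    · simp only [Set.mem_iInter] at hCT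
      exact hCT j hj

section GenericZeros

open MvPolynomial

variable {ι σ M : Type*} [Finite ι] [Finite σ]

/-- Equations chosen one at a time, each of them avoiding finitely many prescribed points, raise
the height of all minimal primes having a real zero. -/
lemma exists_forall_le_height (F : ι → M → MvPolynomial σ ℝ) :
    ∀ (N : ℕ) (S : Fin N → Set M),
      (∀ j, ∀ T : Finset (ι × (σ → ℝ)), ∃ B ∈ S j, ∀ p ∈ T, eval p.2 (F p.1 B) ≠ 0) →
      ∃ B : Fin N → M, (∀ j, B j ∈ S j) ∧
        ∀ c, ∀ P ∈ (Ideal.span (Set.range fun j => F c (B j))).minimalPrimes,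
          (∃ z : σ → ℝ, P ≤ RingHom.ker (eval z)) → (N : ℕ∞) ≤ P.height := by
  intro N
  induction N with
  | zero => exact fun S _ => ⟨Fin.elim0, fun j => j.elim0, by simp⟩
  | succ N ih =>
    intro S hS
    obtain ⟨B, hBS, hB⟩ := ih (fun j => S j.castSucc) fun j => hS j.castSucc
    let I : ι → Ideal (MvPolynomial σ ℝ) := fun c => Ideal.span (Set.range fun j => F c (B j))
    have hfin : ({q : (_ : ι) × Ideal (MvPolynomial σ ℝ) | q.2 ∈ (I q.1).minimalPrimes}).Finite := by
      refine (Set.finite_iUnion fun c =>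
        ((I c).finite_minimalPrimes_of_isNoetherianRing).image (Sigma.mk c)).subset ?_
      rintro ⟨c, P⟩ hP
      exact Set.mem_iUnion.2 ⟨c, P, hP, rfl⟩
    classical
    let z : ((_ : ι) × Ideal (MvPolynomial σ ℝ)) → (σ → ℝ) := fun q =>
      if h : ∃ z : σ → ℝ, q.2 ≤ RingHom.ker (eval z) then h.choose else 0
    obtain ⟨C, hCS, hC⟩ := hS (Fin.last N) (hfin.toFinset.image fun q => (q.1, z q))
    refine ⟨Fin.snoc (α := fun _ => M) B C, ?_, ?_⟩
    · intro j
      refine Fin.lastCases ?_ (fun j => ?_) j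
      · simpa using hCS
      · simpa using hBS j
    · rintro c Q hQ ⟨x, hx⟩
      have hQp : Q.IsPrime := hQ.1.1
      have hgen : ∀ j, F c (Fin.snoc (α := fun _ => M) B C j) ∈ Q :=
        fun j => hQ.1.2 (Ideal.subset_span ⟨j, rfl⟩)
      have hIQ : I c ≤ Q := by
        rw [Ideal.span_le]
        rintro _ ⟨j, rfl⟩
        simpa using hgen j.castSucc
      obtain ⟨P, hP, hPQ⟩ := Ideal.exists_minimalPrimes_le hIQ
      have hPp : P.IsPrime := hP.1.1
      have hex : ∃ z : σ → ℝ, P ≤ RingHom.ker (eval z) := ⟨x, hPQ.trans hx⟩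
      have hne : F c C ∉ P := by
        intro hmem
        have hz : z ⟨c, P⟩ = hex.choose := dif_pos hex
        refine hC (c, z ⟨c, P⟩) ?_ ?_
        · exact Finset.mem_image.2 ⟨⟨c, P⟩, hfin.mem_toFinset.2 hP, rfl⟩
        · rw [hz]
          exact hex.choose_spec hmem
      have hlt : P < Q := lt_of_le_of_ne hPQ fun h => hne (by
        rw [h]; simpa using hgen (Fin.last N))
      calc ((N + 1 : ℕ) : ℕ∞) = N + 1 := by push_cast; rfl
        _ ≤ P.height + 1 := by gcongr; exact hB c P hP hex
        _ ≤ Q.height := Ideal.height_add_one_le_of_lt_of_isPrime hlt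

/-- More than `card σ` generic equations in the variables `σ` have no common real zero. -/
lemma exists_forall_exists_eval_ne_zero (F : ι → M → MvPolynomial σ ℝ) {N : ℕ}
    (hN : Nat.card σ < N) (S : Fin N → Set M)
    (hS : ∀ j, ∀ T : Finset (ι × (σ → ℝ)), ∃ B ∈ S j, ∀ p ∈ T, eval p.2 (F p.1 B) ≠ 0) :
    ∃ B : Fin N → M, (∀ j, B j ∈ S j) ∧ ∀ c z, ∃ j, eval z (F c (B j)) ≠ 0 := by
  obtain ⟨B, hBS, hB⟩ := exists_forall_le_height F N S hS
  refine ⟨B, hBS, fun c z => ?_⟩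
  by_contra! h
  have hle : Ideal.span (Set.range fun j => F c (B j)) ≤ RingHom.ker (eval z) := by
    rw [Ideal.span_le]
    rintro _ ⟨j, rfl⟩
    exact h j
  have : (RingHom.ker (eval z)).IsPrime := RingHom.ker_isPrime _
  obtain ⟨P, hP, hPz⟩ := Ideal.exists_minimalPrimes_le hle
  have hPp : P.IsPrime := hP.1.1
  have h1 := hB c P hP ⟨z, hPz⟩
  have h2 := Ideal.height_le_ringKrullDim_of_isPrime (I := P)
  rw [MvPolynomial.ringKrullDim_of_isNoetherianRing, ringKrullDim_eq_zero_of_field,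
    zero_add] at h2
  have h3 : P.height ≤ (Nat.card σ : ℕ∞) := by exact_mod_cast h2
  have h4 : N ≤ Nat.card σ := by exact_mod_cast h1.trans h3
  omega

end GenericZeros

/-- A tuple of symmetric matrices whose bilinear forms have no common nontrivial zero has the
phase retrieval property. -/
lemma phaseRetrievableR_of_forall_exists {d N : ℕ} {A : Fin N → Matrix (Fin d) (Fin d) ℝ}
    (hA : ∀ j, (A j).IsSymm)
    (h : ∀ u v : Fin d → ℝ, u ≠ 0 → v ≠ 0 → ∃ j, u ⬝ᵥ A j *ᵥ v ≠ 0) :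
    PhaseRetrievableR A := by
  intro x y hxy
  by_contra! hne
  obtain ⟨j, hj⟩ := h (x - y) (x + y) (sub_ne_zero.2 hne.1)
    (fun h0 => hne.2 (eq_neg_of_add_eq_zero_left h0))
  refine hj ?_
  have hcomm : x ⬝ᵥ A j *ᵥ y = y ⬝ᵥ A j *ᵥ x := by
    rw [dotProduct_mulVec_comm (hA j), dotProduct_comm]
  simp only [mulVec_add, dotProduct_add, sub_dotProduct]
  linarith [hxy j]

/-- Every nonzero vector is a multiple of one with a coordinate equal to `1`. -/
lemma exists_eq_smul_insertNth {m : ℕ} {u : Fin (m + 1) → ℝ} (hu : u ≠ 0) :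
    ∃ (i : Fin (m + 1)) (k : ℝ) (z : Fin m → ℝ), k ≠ 0 ∧
      u = k • i.insertNth (α := fun _ => ℝ) 1 z := by
  obtain ⟨i, hi⟩ := Function.ne_iff.1 hu
  refine ⟨i, u i, fun l => u (i.succAbove l) / u i, hi, ?_⟩
  ext l
  refine Fin.succAboveCases i ?_ (fun l => ?_) l
  · simp
  · have : u i ≠ 0 := hi
    simp
    field_simp

lemma insertNth_one_ne_zero {m : ℕ} (i : Fin (m + 1)) (z : Fin m → ℝ) :
    i.insertNth (α := fun _ => ℝ) 1 z ≠ 0 := fun h => by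
  simpa using congrFun h i

/-- The bilinear form of `A` in the affine chart where the `c.1`-th coordinate of the first
vector and the `c.2`-th coordinate of the second vector are `1`. -/
noncomputable def chartForm {m : ℕ} (c : Fin (m + 1) × Fin (m + 1))
    (A : Matrix (Fin (m + 1)) (Fin (m + 1)) ℝ) : MvPolynomial (Fin m ⊕ Fin m) ℝ :=
  c.1.insertNth (α := fun _ => MvPolynomial (Fin m ⊕ Fin m) ℝ) 1
      (fun k => MvPolynomial.X (Sum.inl k)) ⬝ᵥ
    A.map MvPolynomial.C *ᵥ
      c.2.insertNth (α := fun _ => MvPolynomial (Fin m ⊕ Fin m) ℝ) 1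
        (fun k => MvPolynomial.X (Sum.inr k))

lemma eval_chartForm {m : ℕ} (c : Fin (m + 1) × Fin (m + 1))
    (A : Matrix (Fin (m + 1)) (Fin (m + 1)) ℝ) (z : Fin m ⊕ Fin m → ℝ) :
    MvPolynomial.eval z (chartForm c A) =
      c.1.insertNth (α := fun _ => ℝ) 1 (z ∘ Sum.inl) ⬝ᵥ
        A *ᵥ c.2.insertNth (α := fun _ => ℝ) 1 (z ∘ Sum.inr) := by
  have h : ∀ (i : Fin (m + 1)) (f : Fin m → Fin m ⊕ Fin m) (l : Fin (m + 1)),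
      MvPolynomial.eval z (i.insertNth (α := fun _ => MvPolynomial (Fin m ⊕ Fin m) ℝ) 1
        (fun k => MvPolynomial.X (f k)) l) =
      i.insertNth (α := fun _ => ℝ) 1 (z ∘ f) l := by
    intro i f l
    refine Fin.succAboveCases i ?_ (fun l => ?_) l <;> simp
  simp [chartForm, dotProduct, mulVec, h]

end PhaseRetrieval

open PhaseRetrieval

theorem stmt_12 (d N : ℕ) (hd : 1 ≤ d) (hN : 2 * d - 1 ≤ N)
    (r : Fin N → ℕ) (hr : ∀ j, 1 ≤ r j ∧ r j ≤ d - 1) :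
    {A : Fin N → Matrix (Fin d) (Fin d) ℝ |
        ∀ j, (A j).IsSymm ∧ A j * A j = A j ∧ (A j).rank = r j} ⊆
      closure {A : Fin N → Matrix (Fin d) (Fin d) ℝ |
        (∀ j, (A j).IsSymm ∧ A j * A j = A j ∧ (A j).rank = r j) ∧
        PhaseRetrievableR A} := by
  obtain ⟨m, rfl⟩ : ∃ m, d = m + 1 := ⟨d - 1, by omega⟩
  intro A hA
  rw [mem_closure_iff]
  intro O hO hAO
  obtain ⟨s, hs, hsO⟩ := isOpen_pi_iff'.1 hO A hAO
  obtain ⟨B, hBS, hB⟩ := exists_forall_exists_eval_ne_zero (N := N) (chartForm (m := m))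
    (by rw [Nat.card_sum, Nat.card_fin]; omega) (fun j => projections (m + 1) (r j) ∩ s j) <| by
      intro j T
      simp only [eval_chartForm]
      exact exists_mem_projections_forall_dotProduct_ne_zero (hr j).1
        (by have := (hr j).2; omega) (hA j) (hs j).1 (hs j).2 T _ _
        (fun p => insertNth_one_ne_zero _ _) (fun p => insertNth_one_ne_zero _ _)
  refine ⟨B, hsO fun j _ => (hBS j).2, fun j => (hBS j).1,
    phaseRetrievableR_of_forall_exists (fun j => (hBS j).1.1) fun u v hu hv => ?_⟩
  obtain ⟨i, k, x, hk, rfl⟩ := exists_eq_smul_insertNth hu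
  obtain ⟨l, k', y, hk', rfl⟩ := exists_eq_smul_insertNth hv
  obtain ⟨j, hj⟩ := hB (i, l) (Sum.elim x y)
  refine ⟨j, ?_⟩
  rw [eval_chartForm, Sum.elim_comp_inl, Sum.elim_comp_inr] at hj
  rw [mulVec_smul, dotProduct_smul, smul_dotProduct]
  exact smul_ne_zero hk' (smul_ne_zero hk hj)
end
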